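/- arXiv:2604.25829 — 5 statements merged into one kernel-verified Lean document; each statement's English description precedes it below -/
import Mathlib

section
/- For every graph G on n ≥ 5 vertices, if G is planar and contains no induced copy of Θ_4, then G has at most 8(n−2)/3 edges. -/
open SimpleGraph

/-- `G` contains a subdivision of `H`, i.e. `H` is a topological minor of `G`:
there are branch vertices given by an injection `f` and, for each edge of `H`,
a path in `G` between the corresponding branch vertices, such that these paths
are internally disjoint from each other and from the branch vertices. -/
def ContainsSubdivision {W V : Type*} (H : SimpleGraph W) (G : SimpleGraph V) : Prop :=
  ∃ (f : W ↪ V) (p : ∀ ⦃a b : W⦄, H.Adj a b → G.Walk (f a) (f b)),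
    (∀ ⦃a b : W⦄ (h : H.Adj a b), (p h).IsPath) ∧
    (∀ ⦃a b : W⦄ (h : H.Adj a b) (w : W), f w ∈ (p h).support → w = a ∨ w = b) ∧
    (∀ ⦃a b c d : W⦄ (h₁ : H.Adj a b) (h₂ : H.Adj c d), s(a, b) ≠ s(c, d) →
      ∀ x, x ∈ (p h₁).support → x ∈ (p h₂).support →
        (x = f a ∨ x = f b) ∧ (x = f c ∨ x = f d))

/-- A graph is planar iff it contains no subdivision of `K₅` or of `K₃,₃`
(Kuratowski's characterization). -/
def IsPlanar {V : Type*} (G : SimpleGraph V) : Prop :=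
  ¬ ContainsSubdivision (completeGraph (Fin 5)) G ∧
  ¬ ContainsSubdivision (completeBipartiteGraph (Fin 3) (Fin 3)) G

/-- `G` contains an induced copy of `F`. -/
def ContainsInduced {W V : Type*} (F : SimpleGraph W) (G : SimpleGraph V) : Prop :=
  ∃ s : Set V, Nonempty (F ≃g G.induce s)

/-- `Θ₄`: the 4-cycle with one chord, i.e. `K₄` minus an edge. -/
def theta4 : SimpleGraph (Fin 4) := (completeGraph (Fin 4)).deleteEdges {s(0, 1)}

open Classical in
/-- The number of `k`-cliques of `G` inside the finite set `A`. -/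
noncomputable def cliqueCount {V : Type*} (G : SimpleGraph V) (A : Finset V) (k : ℕ) : ℕ :=
  {s ∈ A.powersetCard k | G.IsClique ↑(s : Finset V)}.card

section CliqueCount

open Classical

variable {V : Type*} {G : SimpleGraph V}

lemma cliqueCount_one (A : Finset V) : cliqueCount G A 1 = A.card := by
  unfold cliqueCount
  rw [Finset.filter_true_of_mem]
  · simp
  · intro s hs
    obtain ⟨a, rfl⟩ := Finset.card_eq_one.1 (Finset.mem_powersetCard.1 hs).2
    simp

lemma cliqueCount_congr {G' : SimpleGraph V} {A : Finset V}
    (h : ∀ u ∈ A, ∀ v ∈ A, G.Adj u v ↔ G'.Adj u v) (k : ℕ) :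
    cliqueCount G A k = cliqueCount G' A k := by
  unfold cliqueCount
  congr 1
  refine Finset.filter_congr fun s hs => ?_
  have hs := (Finset.mem_powersetCard.1 hs).1
  exact ⟨fun hc u hu v hv huv => (h u (hs hu) v (hs hv)).1 (hc hu hv huv),
    fun hc u hu v hv huv => (h u (hs hu) v (hs hv)).2 (hc hu hv huv)⟩

lemma cliqueCount_insert {A : Finset V} {v : V} (hv : v ∉ A) (k : ℕ) :
    cliqueCount G (insert v A) (k + 1) =
      cliqueCount G A (k + 1) + cliqueCount G {u ∈ A | G.Adj v u} k := by
  unfold cliqueCount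
  rw [Finset.powersetCard_succ_insert hv, Finset.filter_union, Finset.card_union_of_disjoint]
  · congr 1
    symm
    refine Finset.card_bij (fun s _ => insert v s) ?_ ?_ ?_
    · intro s hs
      simp only [Finset.mem_filter, Finset.mem_powersetCard, Finset.mem_image] at hs ⊢
      obtain ⟨⟨hs, hk⟩, hc⟩ := hs
      refine ⟨⟨s, ⟨hs.trans (Finset.filter_subset _ _), hk⟩, rfl⟩, ?_⟩
      rw [Finset.coe_insert]
      exact hc.insert fun b hb _ => (Finset.mem_filter.1 (hs hb)).2
    · intro s hs t ht hst
      simp only [Finset.mem_filter, Finset.mem_powersetCard] at hs ht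
      have h1 : v ∉ s := fun h => hv (Finset.mem_filter.1 (hs.1.1 h)).1
      have h2 : v ∉ t := fun h => hv (Finset.mem_filter.1 (ht.1.1 h)).1
      rw [← Finset.erase_insert h1, ← Finset.erase_insert h2, hst]
    · intro s hs
      simp only [Finset.mem_filter, Finset.mem_powersetCard, Finset.mem_image] at hs ⊢
      obtain ⟨⟨t, ⟨ht, hk⟩, rfl⟩, hc⟩ := hs
      refine ⟨t, ⟨⟨fun u hu => Finset.mem_filter.2 ⟨ht hu, ?_⟩, hk⟩, ?_⟩, rfl⟩
      · exact hc (by simp) (by simp [hu]) (fun h => hv (h ▸ ht hu))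
      · exact hc.subset (by simp)
  · rw [Finset.disjoint_left]
    intro s hs hs'
    simp only [Finset.mem_filter, Finset.mem_powersetCard, Finset.mem_image] at hs hs'
    obtain ⟨⟨t, -, rfl⟩, -⟩ := hs'
    exact hv (hs.1.1 (Finset.mem_insert_self _ _))

/-- Clique counts are additive over a separation. -/
lemma cliqueCount_union_add_inter {A B : Finset V}
    (h : ∀ u ∈ A \ B, ∀ v ∈ B \ A, ¬ G.Adj u v) (k : ℕ) :
    cliqueCount G (A ∪ B) k + cliqueCount G (A ∩ B) k =
      cliqueCount G A k + cliqueCount G B k := by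
  unfold cliqueCount
  refine Eq.trans ?_ (Finset.card_union_add_card_inter _ _)
  congr 2
  · ext s
    simp only [Finset.mem_filter, Finset.mem_powersetCard, Finset.mem_union]
    constructor
    · rintro ⟨⟨hs, hk⟩, hc⟩
      by_cases hA : s ⊆ A
      · exact Or.inl ⟨⟨hA, hk⟩, hc⟩
      · refine Or.inr ⟨⟨?_, hk⟩, hc⟩
        obtain ⟨v, hv, hvA⟩ := Finset.not_subset.1 hA
        intro u hu
        by_contra huB
        have huA : u ∈ A := (Finset.mem_union.1 (hs hu)).resolve_right huB
        have hvB : v ∈ B := (Finset.mem_union.1 (hs hv)).resolve_left hvA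
        exact h u (Finset.mem_sdiff.2 ⟨huA, huB⟩) v (Finset.mem_sdiff.2 ⟨hvB, hvA⟩)
          (hc hu hv (fun e => hvA (e ▸ huA)))
    · rintro (⟨⟨hs, hk⟩, hc⟩ | ⟨⟨hs, hk⟩, hc⟩)
      · exact ⟨⟨hs.trans Finset.subset_union_left, hk⟩, hc⟩
      · exact ⟨⟨hs.trans Finset.subset_union_right, hk⟩, hc⟩
  · ext s
    simp only [Finset.mem_filter, Finset.mem_powersetCard, Finset.mem_inter,
      Finset.subset_inter_iff]
    tauto

lemma sum_cliqueCount_neighbors (A : Finset V) (k : ℕ) :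
    ∑ v ∈ A, cliqueCount G {u ∈ A | G.Adj v u} k = (k + 1) * cliqueCount G A (k + 1) := by
  have key : ∀ v ∈ A, cliqueCount G {u ∈ A | G.Adj v u} k =
      {s ∈ {s ∈ A.powersetCard (k + 1) | G.IsClique ↑(s : Finset V)} | v ∈ s}.card := by
    intro v hv
    have h1 := cliqueCount_insert (G := G) (Finset.notMem_erase v A) k
    rw [Finset.insert_erase hv] at h1
    have h2 : {u ∈ A.erase v | G.Adj v u} = {u ∈ A | G.Adj v u} := by
      ext u
      simp only [Finset.mem_filter, Finset.mem_erase]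
      exact ⟨fun h => ⟨h.1.2, h.2⟩, fun h => ⟨⟨h.2.ne', h.1⟩, h.2⟩⟩
    rw [h2] at h1
    have h3 : cliqueCount G (A.erase v) (k + 1) =
        {s ∈ {s ∈ A.powersetCard (k + 1) | G.IsClique ↑(s : Finset V)} | v ∉ s}.card := by
      unfold cliqueCount
      congr 1
      ext s
      simp only [Finset.mem_filter, Finset.mem_powersetCard, Finset.subset_erase]
      tauto
    have h4 := Finset.card_filter_add_card_filter_not
      (s := {s ∈ A.powersetCard (k + 1) | G.IsClique ↑(s : Finset V)}) (fun s => v ∈ s)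
    rw [h3] at h1
    unfold cliqueCount at h1 ⊢
    omega
  rw [Finset.sum_congr rfl key]
  have := Finset.sum_card_bipartiteAbove_eq_sum_card_bipartiteBelow
    (s := A) (t := {s ∈ A.powersetCard (k + 1) | G.IsClique ↑(s : Finset V)}) (fun v s => v ∈ s)
  unfold Finset.bipartiteAbove Finset.bipartiteBelow at this
  rw [this, Finset.sum_const_nat (m := k + 1)]
  · rw [mul_comm]; rfl
  · intro s hs
    simp only [Finset.mem_filter, Finset.mem_powersetCard] at hs
    rw [Finset.filter_mem_eq_inter, Finset.inter_eq_right.2 hs.1.1, hs.1.2]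

lemma cliqueCount_two_insert_insert {B : Finset V} {x y : V} (hx : x ∉ B) (hy : y ∉ B)
    (hxy : x ≠ y) :
    cliqueCount G (insert x (insert y B)) 2 = cliqueCount G B 2 +
      {u ∈ B | G.Adj x u}.card + {u ∈ B | G.Adj y u}.card + (if G.Adj x y then 1 else 0) := by
  rw [cliqueCount_insert (by simp [hx, hxy]), cliqueCount_insert hy, cliqueCount_one,
    cliqueCount_one, Finset.filter_insert]
  split_ifs
  · rw [Finset.card_insert_of_notMem (by simp [hy])]
    ring
  · ring

lemma cliqueCount_three_insert_insert {B : Finset V} {x y : V} (hx : x ∉ B) (hy : y ∉ B)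
    (hxy : x ≠ y) :
    cliqueCount G (insert x (insert y B)) 3 = cliqueCount G B 3 +
      cliqueCount G {u ∈ B | G.Adj x u} 2 + cliqueCount G {u ∈ B | G.Adj y u} 2 +
      (if G.Adj x y then ({u ∈ B | G.Adj x u} ∩ {u ∈ B | G.Adj y u}).card else 0) := by
  rw [cliqueCount_insert (by simp [hx, hxy]), cliqueCount_insert hy, Finset.filter_insert]
  split_ifs
  · rw [cliqueCount_insert (by simp [hy]), cliqueCount_one]
    have : {u ∈ {u ∈ B | G.Adj x u} | G.Adj y u} =
        {u ∈ B | G.Adj x u} ∩ {u ∈ B | G.Adj y u} := by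
      ext u; simp only [Finset.mem_filter, Finset.mem_inter]; tauto
    rw [this]
    ring
  · ring

lemma cliqueCount_two_union_le (M N : Finset V) :
    cliqueCount G (M ∪ N) 2 ≤ cliqueCount G M 2 + cliqueCount G N 2 +
      {p ∈ (M \ N) ×ˢ (N \ M) | G.Adj p.1 p.2}.card := by
  unfold cliqueCount
  refine le_trans (Finset.card_le_card (t := ({s ∈ M.powersetCard 2 | G.IsClique ↑(s : Finset V)} ∪
    {s ∈ N.powersetCard 2 | G.IsClique ↑(s : Finset V)}) ∪
    {p ∈ (M \ N) ×ˢ (N \ M) | G.Adj p.1 p.2}.image fun p => {p.1, p.2}) ?_) ?_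
  · intro s hs
    simp only [Finset.mem_filter, Finset.mem_powersetCard] at hs
    obtain ⟨⟨hs, hk⟩, hc⟩ := hs
    obtain ⟨a, b, hab, rfl⟩ := Finset.card_eq_two.1 hk
    have hadj : G.Adj a b := hc (by simp) (by simp) hab
    have ha := hs (Finset.mem_insert_self a _)
    have hb := hs (show b ∈ ({a, b} : Finset V) by simp)
    simp only [Finset.mem_union] at ha hb
    simp only [Finset.mem_union, Finset.mem_filter, Finset.mem_powersetCard, Finset.mem_image,
      Finset.mem_product, Finset.mem_sdiff, hk, hc, and_true, Finset.insert_subset_iff,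
      Finset.singleton_subset_iff, Prod.exists]
    by_cases h1 : a ∈ M <;> by_cases h2 : b ∈ M <;> by_cases h3 : a ∈ N <;> by_cases h4 : b ∈ N <;>
      simp only [h1, h2, h3, h4] at ha hb ⊢ <;> simp at ha hb ⊢
    · exact ⟨a, b, by simp_all⟩
    · exact ⟨b, a, by simp_all [hadj.symm, Finset.pair_comm]⟩
  · exact (Finset.card_union_le _ _).trans
      (add_le_add (Finset.card_union_le _ _) Finset.card_image_le)

lemma cliqueCount_mono {A B : Finset V} (h : A ⊆ B) (k : ℕ) :
    cliqueCount G A k ≤ cliqueCount G B k :=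
  Finset.card_le_card (Finset.filter_subset_filter _ (Finset.powersetCard_mono h))

lemma cliqueCount_of_isClique {A : Finset V} (h : G.IsClique (A : Set V)) (k : ℕ) :
    cliqueCount G A k = A.card.choose k := by
  unfold cliqueCount
  rw [Finset.filter_true_of_mem, Finset.card_powersetCard]
  exact fun s hs => h.subset (Finset.coe_subset.2 (Finset.mem_powersetCard.1 hs).1)

lemma exists_isClique_of_cliqueCount_ne_zero {A : Finset V} {k : ℕ}
    (h : cliqueCount G A k ≠ 0) : ∃ s ⊆ A, s.card = k ∧ G.IsClique (s : Set V) := by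
  obtain ⟨s, hs⟩ := Finset.card_ne_zero.1 h
  simp only [Finset.mem_filter, Finset.mem_powersetCard] at hs
  exact ⟨s, hs.1.1, hs.1.2, hs.2⟩

lemma cliqueCount_four_cycle {a b c d : V} (hac : a ≠ c) (hbd : b ≠ d)
    (hab : G.Adj a b) (hbc : G.Adj b c) (hcd : G.Adj c d) (hda : G.Adj d a) :
    8 + cliqueCount G {a, b, c, d} 3 ≤ 2 * cliqueCount G {a, b, c, d} 2 := by
  have h0 : ∀ k, cliqueCount G ∅ (k + 1) = 0 := fun k => by simp [cliqueCount]
  have h1 : ∀ v k, cliqueCount G {v} (k + 2) = 0 := fun v k => by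
    rw [← insert_empty_eq, cliqueCount_insert (by simp), h0, Finset.filter_empty, h0]
  rw [cliqueCount_two_insert_insert (by simp [hac, hda.ne']) (by simp [hbc.ne, hbd]) hab.ne,
    cliqueCount_three_insert_insert (by simp [hac, hda.ne']) (by simp [hbc.ne, hbd]) hab.ne]
  have h2 : cliqueCount G {c, d} 2 = 1 := by
    rw [cliqueCount_of_isClique (by simp [hcd]), Finset.card_pair hcd.ne]; rfl
  have h3 : cliqueCount G {c, d} 3 = 0 := by
    rw [cliqueCount_of_isClique (by simp [hcd]), Finset.card_pair hcd.ne]; rfl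
  rw [h2, h3]
  by_cases e2 : G.Adj a c <;> by_cases e5 : G.Adj b d <;>
    simp [Finset.filter_insert, Finset.filter_singleton, hab, e2, hda.symm, hbc, e5, h1, h2,
      hcd.ne]

lemma cliqueCount_four_points {a b c d : V} (hab : a ≠ b) (hac : a ≠ c) (had : a ≠ d)
    (hbc : b ≠ c) (hbd : b ≠ d) (hcd : c ≠ d) :
    2 * cliqueCount G {a, b, c, d} 2 ≤ 8 + cliqueCount G {a, b, c, d} 3 := by
  have h0 : ∀ k, cliqueCount G ∅ (k + 1) = 0 := fun k => by simp [cliqueCount]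
  have h1 : ∀ v k, cliqueCount G {v} (k + 2) = 0 := fun v k => by
    rw [← insert_empty_eq, cliqueCount_insert (by simp), h0, Finset.filter_empty, h0]
  rw [cliqueCount_two_insert_insert (by simp [hac, had]) (by simp [hbc, hbd]) hab,
    cliqueCount_three_insert_insert (by simp [hac, had]) (by simp [hbc, hbd]) hab]
  have h2 : cliqueCount G {c, d} 2 = if G.Adj c d then 1 else 0 := by
    rw [cliqueCount_insert (by simpa using hcd), h1, cliqueCount_one, Finset.filter_singleton]
    split_ifs <;> simp
  have h3 : cliqueCount G {c, d} 3 = 0 := by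
    rw [cliqueCount_insert (by simpa using hcd), h1, Finset.filter_singleton]
    split_ifs <;> simp [h0, h1]
  rw [h2, h3]
  by_cases e1 : G.Adj a b <;> by_cases e2 : G.Adj a c <;> by_cases e3 : G.Adj a d <;>
    by_cases e4 : G.Adj b c <;> by_cases e5 : G.Adj b d <;>
    simp [Finset.filter_insert, Finset.filter_singleton, e1, e2, e3, e4, e5, h0, h1, h2, hcd,
      hcd.symm] <;> split_ifs <;> simp

end CliqueCount

/-- The set `S` is nonempty and induces a connected subgraph of `G`, phrased via cuts. -/
def IsLinked {V : Type*} (G : SimpleGraph V) (S : Set V) : Prop :=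
  S.Nonempty ∧ ∀ T ⊆ S, T.Nonempty → (∀ u ∈ T, ∀ v ∈ S, G.Adj u v → v ∈ T) → S ⊆ T

/-- Some edge of `G` joins `S` to `T`. -/
def Touches {V : Type*} (G : SimpleGraph V) (S T : Set V) : Prop :=
  ∃ u ∈ S, ∃ v ∈ T, G.Adj u v

/-- `H` is a minor of the subgraph of `G` induced by `A`: disjoint linked branch sets in `A`
represent the vertices of `H`, and branch sets of adjacent vertices touch. -/
def HasMinor {W V : Type*} (H : SimpleGraph W) (G : SimpleGraph V) (A : Set V) : Prop :=
  ∃ φ : W → Set V, (∀ w, φ w ⊆ A) ∧ (∀ w, IsLinked G (φ w)) ∧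
    (∀ a b, a ≠ b → Disjoint (φ a) (φ b)) ∧ ∀ a b, H.Adj a b → Touches G (φ a) (φ b)

/-- The subgraph of `G` induced by `A` has neither a `K₅` minor nor a `K₃,₃` minor. -/
def KuratowskiMinorFree {V : Type*} (G : SimpleGraph V) (A : Set V) : Prop :=
  ¬ HasMinor (completeGraph (Fin 5)) G A ∧
  ¬ HasMinor (completeBipartiteGraph (Fin 3) (Fin 3)) G A

section Minors

variable {W V : Type*} {G : SimpleGraph V}

lemma Touches.symm {S T : Set V} (h : Touches G S T) : Touches G T S := by
  obtain ⟨u, hu, v, hv, huv⟩ := h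
  exact ⟨v, hv, u, hu, huv.symm⟩

lemma Touches.mono {G' : SimpleGraph V} {S T S' T' : Set V} (h : Touches G S T) (hG : G ≤ G')
    (hS : S ⊆ S') (hT : T ⊆ T') : Touches G' S' T' := by
  obtain ⟨u, hu, v, hv, huv⟩ := h
  exact ⟨u, hS hu, v, hT hv, hG huv⟩

lemma IsLinked.mono {G' : SimpleGraph V} {S : Set V} (h : IsLinked G S) (hG : G ≤ G') :
    IsLinked G' S :=
  ⟨h.1, fun T hT hne hc => h.2 T hT hne fun u hu v hv huv => hc u hu v hv (hG huv)⟩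

lemma isLinked_singleton (v : V) : IsLinked G {v} := by
  refine ⟨Set.singleton_nonempty v, fun T hT hne _ => ?_⟩
  rw [(Set.subset_singleton_iff_eq.1 hT).resolve_left hne.ne_empty]

lemma IsLinked.union {S T : Set V} (hS : IsLinked G S) (hT : IsLinked G T)
    (h : Touches G S T) : IsLinked G (S ∪ T) := by
  obtain ⟨u, hu, v, hv, huv⟩ := h
  refine ⟨hS.1.inl, fun U hU hne hc => ?_⟩
  have key : ∀ R, IsLinked G R → R ⊆ S ∪ T → (∃ r ∈ R, r ∈ U) → R ⊆ U := by
    rintro R hR hRS ⟨r, hr, hrU⟩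
    refine (hR.2 (R ∩ U) Set.inter_subset_left ⟨r, hr, hrU⟩ ?_).trans Set.inter_subset_right
    exact fun a ha b hb hab => ⟨hb, hc a ha.2 b (hRS hb) hab⟩
  have hST : u ∈ U ↔ v ∈ U := ⟨fun h => hc u h v (Or.inr hv) huv,
    fun h => hc v h u (Or.inl hu) huv.symm⟩
  obtain ⟨r, hr⟩ := hne
  rcases hU hr with hrS | hrT
  · have h1 := key S hS Set.subset_union_left ⟨r, hrS, hr⟩
    exact Set.union_subset h1 (key T hT Set.subset_union_right ⟨v, hv, hST.1 (h1 hu)⟩)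
  · have h1 := key T hT Set.subset_union_right ⟨r, hrT, hr⟩
    exact Set.union_subset (key S hS Set.subset_union_left ⟨u, hu, hST.2 (h1 hv)⟩) h1

lemma isLinked_pair {u v : V} (h : G.Adj u v) : IsLinked G {u, v} :=
  (isLinked_singleton u).union (isLinked_singleton v) ⟨u, rfl, v, rfl, h⟩

/-- A linked set is not split by a partition into two nonempty parts without edges between. -/
lemma IsLinked.touches {S X Y : Set V} (h : IsLinked G S) (hS : S = X ∪ Y)
    (hX : X.Nonempty) (hY : Y.Nonempty) (hXY : Disjoint X Y) : Touches G X Y := by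
  by_contra hn
  obtain ⟨y, hy⟩ := hY
  refine hXY.notMem_of_mem_right hy (h.2 X (hS ▸ Set.subset_union_left) hX ?_
    (hS ▸ Or.inr hy))
  intro u hu v hv huv
  rw [hS] at hv
  exact hv.resolve_right fun hvY => hn ⟨u, hu, v, hvY, huv⟩

/-- Every element of a finite set lies in a connected component of it. -/
lemma exists_component [Finite V] (R : Set V) {r : V} (hr : r ∈ R) :
    ∃ D ⊆ R, r ∈ D ∧ IsLinked G D ∧ ∀ u ∈ D, ∀ v ∈ R, G.Adj u v → v ∈ D := by
  obtain ⟨D, ⟨hDR, hrD, hc⟩, hmin⟩ := Set.Finite.exists_minimal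
    (Set.toFinite {D : Set V | D ⊆ R ∧ r ∈ D ∧ ∀ u ∈ D, ∀ v ∈ R, G.Adj u v → v ∈ D})
    ⟨R, subset_rfl, hr, fun _ _ _ hv _ => hv⟩
  refine ⟨D, hDR, hrD, ⟨⟨r, hrD⟩, fun T hTD hT hTc => ?_⟩, hc⟩
  by_cases hrT : r ∈ T
  · exact hmin ⟨hTD.trans hDR, hrT, fun u hu v hv huv =>
      hTc u hu v (hc u (hTD hu) v hv huv) huv⟩ hTD
  · obtain ⟨t, ht⟩ := hT
    have := hmin (y := D \ T) ⟨Set.sdiff_subset.trans hDR, ⟨hrD, hrT⟩, fun u hu v hv huv =>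
      ⟨hc u hu.1 v hv huv, fun hvT => hu.2 (hTc v hvT u hu.1 huv.symm)⟩⟩ Set.sdiff_subset
    exact absurd ht (this (hTD ht)).2

lemma HasMinor.mono {H : SimpleGraph W} {G' : SimpleGraph V} {A A' : Set V}
    (h : HasMinor H G A) (hG : G ≤ G') (hA : A ⊆ A') : HasMinor H G' A' := by
  obtain ⟨φ, h1, h2, h3, h4⟩ := h
  exact ⟨φ, fun w => (h1 w).trans hA, fun w => (h2 w).mono hG, h3,
    fun a b hab => (h4 a b hab).mono hG subset_rfl subset_rfl⟩

lemma KuratowskiMinorFree.mono {G' : SimpleGraph V} {A A' : Set V}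
    (h : KuratowskiMinorFree G' A') (hG : G ≤ G') (hA : A ⊆ A') : KuratowskiMinorFree G A :=
  ⟨fun h' => h.1 (h'.mono hG hA), fun h' => h.2 (h'.mono hG hA)⟩

/-- Contraction of `y` into `x`; the vertex `y` itself is to be discarded afterwards. -/
def contractInto (G : SimpleGraph V) (x y : V) : SimpleGraph V where
  Adj u v := u ≠ v ∧ (G.Adj u v ∨ (u = x ∧ G.Adj y v) ∨ (v = x ∧ G.Adj y u))
  symm := ⟨fun u v h => ⟨h.1.symm, by have := G.adj_comm u v; tauto⟩⟩
  loopless := ⟨fun _ h => h.1 rfl⟩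

lemma HasMinor.of_contractInto {H : SimpleGraph W} {A : Set V} {x y : V} (hxy : G.Adj x y)
    (hy : y ∈ A) (h : HasMinor H (contractInto G x y) (A \ {y})) : HasMinor H G A := by
  obtain ⟨φ, h1, h2, h3, h4⟩ := h
  have hyφ : ∀ w, y ∉ φ w := fun w hw => (h1 w hw).2 rfl
  refine ⟨fun w => φ w ∪ {v | v = y ∧ x ∈ φ w}, ?_, ?_, ?_, ?_⟩
  · rintro w v (hv | ⟨rfl, -⟩)
    exacts [(h1 w hv).1, hy]
  · intro w
    refine ⟨(h2 w).1.inl, fun T hT hne hc => ?_⟩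
    have hxT : x ∈ φ w → (x ∈ T ↔ y ∈ T) := fun hx =>
      ⟨fun h => hc x h y (Or.inr ⟨rfl, hx⟩) hxy, fun h => hc y h x (Or.inl hx) hxy.symm⟩
    have hφT : φ w ⊆ T := by
      refine ((h2 w).2 (T ∩ φ w) Set.inter_subset_right ?_ ?_).trans Set.inter_subset_left
      · obtain ⟨t, ht⟩ := hne
        rcases hT ht with h | ⟨rfl, hx⟩
        exacts [⟨t, ht, h⟩, ⟨x, (hxT hx).2 ht, hx⟩]
      · rintro u ⟨huT, hu⟩ v hv ⟨-, huv | ⟨rfl, hyv⟩ | ⟨rfl, hyu⟩⟩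
        · exact ⟨hc u huT v (Or.inl hv) huv, hv⟩
        · exact ⟨hc y ((hxT hu).1 huT) v (Or.inl hv) hyv, hv⟩
        · exact ⟨(hxT hv).2 (hc u huT y (Or.inr ⟨rfl, hv⟩) hyu.symm), hv⟩
    rintro v (hv | ⟨rfl, hx⟩)
    exacts [hφT hv, (hxT hx).1 (hφT hx)]
  · intro a b hab
    rw [Set.disjoint_left]
    rintro v (hv | ⟨rfl, hx⟩) (hv' | ⟨hvy, hx'⟩)
    · exact Set.disjoint_left.1 (h3 a b hab) hv hv'
    · exact hyφ a (hvy ▸ hv)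
    · exact hyφ b hv'
    · exact Set.disjoint_left.1 (h3 a b hab) hx hx'
  · intro a b hab
    obtain ⟨u, hu, v, hv, -, huv | ⟨rfl, hyv⟩ | ⟨rfl, hyu⟩⟩ := h4 a b hab
    · exact ⟨u, Or.inl hu, v, Or.inl hv, huv⟩
    · exact ⟨y, Or.inr ⟨rfl, hu⟩, v, Or.inl hv, hyv⟩
    · exact ⟨u, Or.inl hu, y, Or.inr ⟨rfl, hv⟩, hyu.symm⟩

lemma KuratowskiMinorFree.contractInto {A : Set V} {x y : V} (h : KuratowskiMinorFree G A)
    (hxy : G.Adj x y) (hy : y ∈ A) :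
    KuratowskiMinorFree (_root_.contractInto G x y) (A \ {y}) :=
  ⟨fun h' => h.1 (h'.of_contractInto hxy hy), fun h' => h.2 (h'.of_contractInto hxy hy)⟩

lemma hasMinor_K33 {A : Set V} (X Y : Fin 3 → Set V) (hXA : ∀ i, X i ⊆ A) (hYA : ∀ i, Y i ⊆ A)
    (hX : ∀ i, IsLinked G (X i)) (hY : ∀ i, IsLinked G (Y i))
    (hXX : ∀ i j, i < j → Disjoint (X i) (X j)) (hYY : ∀ i j, i < j → Disjoint (Y i) (Y j))
    (hXY : ∀ i j, Disjoint (X i) (Y j)) (h : ∀ i j, Touches G (X i) (Y j)) :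
    HasMinor (completeBipartiteGraph (Fin 3) (Fin 3)) G A := by
  refine ⟨Sum.elim X Y, ?_, ?_, ?_, ?_⟩
  · rintro (i | i)
    exacts [hXA i, hYA i]
  · rintro (i | i)
    exacts [hX i, hY i]
  · rintro (i | i) (j | j) hij
    · rcases lt_or_gt_of_ne (fun e => hij (congrArg Sum.inl e)) with h | h
      exacts [hXX i j h, (hXX j i h).symm]
    · exact hXY i j
    · exact (hXY j i).symm
    · rcases lt_or_gt_of_ne (fun e => hij (congrArg Sum.inr e)) with h | h
      exacts [hYY i j h, (hYY j i h).symm]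
  · rintro (i | i) (j | j) hij
    · simp at hij
    · exact h i j
    · exact (h j i).symm
    · simp at hij

lemma hasMinor_K5 {A : Set V} (X : Fin 5 → Set V) (hXA : ∀ i, X i ⊆ A)
    (hX : ∀ i, IsLinked G (X i)) (hXX : ∀ i j, i < j → Disjoint (X i) (X j))
    (h : ∀ i j, i < j → Touches G (X i) (X j)) :
    HasMinor (completeGraph (Fin 5)) G A := by
  refine ⟨X, hXA, hX, fun i j hij => ?_, fun i j hij => ?_⟩
  · rcases lt_or_gt_of_ne hij with h | h
    exacts [hXX i j h, (hXX j i h).symm]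
  · rcases lt_or_gt_of_ne hij.ne with h' | h'
    exacts [h i j h', (h j i h').symm]

end Minors

section NonseparatingParts

variable {V : Type*} [Finite V] {G : SimpleGraph V}

lemma hasMinor_K33_of_K23 {A R : Set V} {x b : V} {z : Fin 3 → V} (hxA : x ∈ A) (hbA : b ∈ A)
    (hzA : ∀ i, z i ∈ A) (hRA : R ⊆ A) (hz : ∀ i j, i < j → z i ≠ z j) (hxb : x ≠ b)
    (hxR : x ∉ R) (hbR : b ∉ R) (hzR : ∀ i, z i ∉ R) (hxz : ∀ i, G.Adj x (z i))
    (hbz : ∀ i, G.Adj b (z i)) (hR : R.Nonempty) (hlink : ∀ i, IsLinked G (R ∪ {z i})) :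
    HasMinor (completeBipartiteGraph (Fin 3) (Fin 3)) G A := by
  obtain ⟨r, hr⟩ := hR
  obtain ⟨D, hDR, hrD, hD, hDc⟩ := exists_component (G := G) R hr
  have hDz : ∀ i, Touches G D {z i} := by
    intro i
    obtain ⟨u, hu, v, ⟨hv | hv, hvD⟩, huv⟩ := (hlink i).touches (X := D)
      (Y := (R ∪ {z i}) \ D) (by rw [Set.union_sdiff_cancel (hDR.trans Set.subset_union_left)])
      ⟨r, hrD⟩ ⟨z i, Or.inr rfl, fun h => hzR i (hDR h)⟩ Set.disjoint_sdiff_right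
    · exact absurd (hDc u hu v hv huv) hvD
    · exact ⟨u, hu, v, hv, huv⟩
  refine hasMinor_K33 ![{x}, {b}, D] (fun i => {z i}) ?_ ?_ ?_ ?_ ?_ ?_ ?_ ?_
  · intro i; fin_cases i
    · simpa using hxA
    · simpa using hbA
    · exact hDR.trans hRA
  · intro i; simpa using hzA i
  · intro i; fin_cases i
    · exact isLinked_singleton x
    · exact isLinked_singleton b
    · exact hD
  · intro i; exact isLinked_singleton _
  · intro i j hij
    fin_cases i <;> fin_cases j <;> simp at hij
    · simpa using hxb
    · simpa using fun h => hxR (hDR h)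
    · simpa using fun h => hbR (hDR h)
  · intro i j hij
    simpa using hz i j hij
  · intro i j
    fin_cases i
    · simpa using (hxz j).ne
    · simpa using (hbz j).ne
    · simpa using fun h => hzR j (hDR h)
  · intro i j
    fin_cases i
    · exact ⟨x, rfl, z j, rfl, hxz j⟩
    · exact ⟨b, rfl, z j, rfl, hbz j⟩
    · exact hDz j

lemma exists_connector {R P Q : Set V} (hP : IsLinked G P) (hQ : Q.Nonempty)
    (hPQ : Disjoint P Q) (hQR : Disjoint Q R) (hlink : IsLinked G (P ∪ (R ∪ Q))) :
    ∃ E ⊆ R, IsLinked G (P ∪ E) ∧ Touches G (P ∪ E) Q ∧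
      (E.Nonempty → IsLinked G E ∧ (∀ u ∈ E, ∀ v ∈ R, G.Adj u v → v ∈ E) ∧
        Touches G E P ∧ Touches G E Q) := by
  by_cases hT : Touches G P Q
  · exact ⟨∅, Set.empty_subset _, by simpa using hP, by simpa using hT, by simp⟩
  set F : Set V := {v | ∃ D ⊆ R, v ∈ D ∧ IsLinked G D ∧
    (∀ u ∈ D, ∀ v ∈ R, G.Adj u v → v ∈ D) ∧ Touches G D P} with hF
  have hFR : F ⊆ R := fun v ⟨D, hDR, hv, _⟩ => hDR hv
  obtain ⟨p, hp⟩ := hP.1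
  obtain ⟨q, hq⟩ := hQ
  have hqPF : q ∉ P ∪ F := by
    rintro (h | h)
    exacts [Set.disjoint_left.1 hPQ h hq, Set.disjoint_left.1 hQR hq (hFR h)]
  obtain ⟨u, hu, v, ⟨hv, hvPF⟩, huv⟩ := hlink.touches (X := P ∪ F)
    (Y := (P ∪ (R ∪ Q)) \ (P ∪ F))
    (by rw [Set.union_sdiff_cancel]
        exact Set.union_subset_union_right _ (hFR.trans Set.subset_union_left))
    ⟨p, Or.inl hp⟩ ⟨q, Or.inr (Or.inr hq), hqPF⟩ Set.disjoint_sdiff_right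
  rcases hv with hv | hv | hv
  · exact absurd (Or.inl hv) hvPF
  · refine absurd (Or.inr ?_) hvPF
    rcases hu with hu | ⟨D, hDR, huD, hD, hDc, hDP⟩
    · obtain ⟨D, hDR, hvD, hD, hDc⟩ := exists_component (G := G) R hv
      exact ⟨D, hDR, hvD, hD, hDc, v, hvD, u, hu, huv.symm⟩
    · exact ⟨D, hDR, hDc u huD v hv huv, hD, hDc, hDP⟩
  · rcases hu with hu | ⟨D, hDR, huD, hD, hDc, hDP⟩
    · exact absurd ⟨u, hu, v, hv, huv⟩ hT
    · exact ⟨D, hDR, hP.union hD hDP.symm, ⟨u, Or.inr huD, v, hv, huv⟩,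
        fun _ => ⟨hD, hDc, hDP, u, huD, v, hv, huv⟩⟩

/-- If both ends of an edge `xy` see three disjoint linked sets, none of which separates the
graph minus `x` and `y`, then there is a `K₅` or `K₃,₃` minor. -/
lemma not_kuratowskiMinorFree_of_parts {A : Set V} {x y : V} {P : Fin 3 → Set V}
    (hxy : G.Adj x y) (hx : x ∈ A) (hy : y ∈ A) (hP : ∀ i, IsLinked G (P i))
    (hPA : ∀ i, P i ⊆ A \ {x, y}) (hPP : ∀ i j, i ≠ j → Disjoint (P i) (P j))
    (hPx : ∀ i, Touches G {x} (P i)) (hPy : ∀ i, Touches G {y} (P i))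
    (hlink : ∀ i, IsLinked G ((A \ {x, y}) \ P i)) : ¬ KuratowskiMinorFree G A := by
  intro hfree
  set R : Set V := (A \ {x, y}) \ (⋃ i, P i) with hR
  have hRA : R ⊆ A \ {x, y} := Set.sdiff_subset
  have hRP : ∀ i, Disjoint (P i) R := by
    intro i
    rw [Set.disjoint_left]
    rintro v hv ⟨-, hvn⟩
    exact hvn (Set.mem_iUnion.2 ⟨i, hv⟩)
  have hxU : ∀ {S : Set V}, S ⊆ A \ {x, y} → x ∉ S := fun h hxS => (h hxS).2 (by simp)
  have hyU : ∀ {S : Set V}, S ⊆ A \ {x, y} → y ∉ S := fun h hyS => (h hyS).2 (by simp)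
  have hno : ∀ D ⊆ R, IsLinked G D → ¬ ∀ i, Touches G D (P i) := by
    intro D hDR hD hDP
    refine hfree.2 (hasMinor_K33 ![{x}, {y}, D] P ?_ ?_ ?_ hP ?_ ?_ ?_ ?_)
    · intro i; fin_cases i
      · simpa using hx
      · simpa using hy
      · exact (hDR.trans hRA).trans Set.sdiff_subset
    · exact fun i => (hPA i).trans Set.sdiff_subset
    · intro i; fin_cases i
      · exact isLinked_singleton x
      · exact isLinked_singleton y
      · exact hD
    · intro i j hij
      fin_cases i <;> fin_cases j <;> simp at hij
      · simpa using hxy.ne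
      · simpa using hxU (hDR.trans hRA)
      · simpa using hyU (hDR.trans hRA)
    · exact fun i j hij => hPP i j hij.ne
    · intro i j
      fin_cases i
      · simpa using hxU (hPA j)
      · simpa using hyU (hPA j)
      · exact ((hRP j).mono_right hDR).symm
    · intro i j
      fin_cases i
      · exact hPx j
      · exact hPy j
      · exact hDP j
  have hcon : ∀ i j k, i ≠ j → i ≠ k → j ≠ k → P j ∪ (R ∪ P k) = (A \ {x, y}) \ P i := by
    intro i j k hij hik hjk
    ext v
    have h1 : v ∈ P j → _ := fun h => hPA j h
    have h2 : v ∈ P k → _ := fun h => hPA k h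
    have h3 : v ∈ P i → v ∉ P j := fun h => Set.disjoint_left.1 (hPP i j hij) h
    have h4 : v ∈ P i → v ∉ P k := fun h => Set.disjoint_left.1 (hPP i k hik) h
    have h5 : (∃ l, v ∈ P l) ↔ v ∈ P i ∨ v ∈ P j ∨ v ∈ P k := by
      refine ⟨fun ⟨l, hl⟩ => ?_, by rintro (h | h | h) <;> exact ⟨_, h⟩⟩
      have : l = i ∨ l = j ∨ l = k := by omega
      rcases this with rfl | rfl | rfl <;> simp [hl]
    simp only [hR, Set.mem_union, Set.mem_sdiff, Set.mem_iUnion, h5] at h1 h2 ⊢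
    tauto
  have hE : ∀ i j k, i ≠ j → i ≠ k → j ≠ k → _ := fun i j k hij hik hjk =>
    exists_connector (hP j) (hP k).1 (hPP j k hjk) (hRP k)
      ((hcon i j k hij hik hjk).symm ▸ hlink i)
  obtain ⟨E, hER, hEl, hEt, hE'⟩ := hE 2 0 1 (by decide) (by decide) (by decide)
  obtain ⟨F, hFR, hFl, hFt, hF'⟩ := hE 0 1 2 (by decide) (by decide) (by decide)
  obtain ⟨K, hKR, hKl, hKt, hK'⟩ := hE 1 2 0 (by decide) (by decide) (by decide)
  have hdisj : ∀ {D D' : Set V}, D ⊆ R → D' ⊆ R → IsLinked G D →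
      (∀ u ∈ D', ∀ v ∈ R, G.Adj u v → v ∈ D') → ∀ r ∈ D, r ∈ D' → D ⊆ D' := by
    intro D D' hD hD' hl hc r hr hr'
    exact (hl.2 (D ∩ D') Set.inter_subset_left ⟨r, hr, hr'⟩
      fun u hu v hv huv => ⟨hv, hc u hu.2 v (hD hv) huv⟩).trans Set.inter_subset_right
  have hEF : Disjoint E F := by
    rw [Set.disjoint_left]
    intro r h1 h2
    obtain ⟨hl, hc, ht0, ht1⟩ := hE' ⟨r, h1⟩
    obtain ⟨hl', hc', -, ht2⟩ := hF' ⟨r, h2⟩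
    have ht2' := ht2.mono le_rfl (hdisj hFR hER hl' hc r h2 h1) subset_rfl
    refine hno E hER hl fun i => ?_
    fin_cases i
    exacts [ht0, ht1, ht2']
  have hFK : Disjoint F K := by
    rw [Set.disjoint_left]
    intro r h1 h2
    obtain ⟨hl, hc, ht1, ht2⟩ := hF' ⟨r, h1⟩
    obtain ⟨hl', hc', -, ht0⟩ := hK' ⟨r, h2⟩
    have ht0' := ht0.mono le_rfl (hdisj hKR hFR hl' hc r h2 h1) subset_rfl
    refine hno F hFR hl fun i => ?_
    fin_cases i
    exacts [ht0', ht1, ht2]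
  have hEK : Disjoint E K := by
    rw [Set.disjoint_left]
    intro r h1 h2
    obtain ⟨hl, hc, ht0, ht1⟩ := hE' ⟨r, h1⟩
    obtain ⟨hl', hc', ht2, -⟩ := hK' ⟨r, h2⟩
    have ht2' := ht2.mono le_rfl (hdisj hKR hER hl' hc r h2 h1) subset_rfl
    refine hno E hER hl fun i => ?_
    fin_cases i
    exacts [ht0, ht1, ht2']
  have hsub : ∀ {i} {D : Set V}, D ⊆ R → P i ∪ D ⊆ A \ {x, y} := fun hD =>
    Set.union_subset (hPA _) (hD.trans hRA)
  have hdis : ∀ {i j} {D D' : Set V}, i ≠ j → D ⊆ R → D' ⊆ R → Disjoint D D' →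
      Disjoint (P i ∪ D) (P j ∪ D') := fun hij hD hD' hDD' =>
    Set.disjoint_union_left.2 ⟨Set.disjoint_union_right.2 ⟨hPP _ _ hij, (hRP _).mono_right hD'⟩,
      Set.disjoint_union_right.2 ⟨((hRP _).mono_right hD).symm, hDD'⟩⟩
  refine hfree.1 (hasMinor_K5 ![{x}, {y}, P 0 ∪ E, P 1 ∪ F, P 2 ∪ K] ?_ ?_ ?_ ?_)
  · intro i; fin_cases i
    · simpa using hx
    · simpa using hy
    · exact (hsub hER).trans Set.sdiff_subset
    · exact (hsub hFR).trans Set.sdiff_subset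
    · exact (hsub hKR).trans Set.sdiff_subset
  · intro i; fin_cases i
    exacts [isLinked_singleton x, isLinked_singleton y, hEl, hFl, hKl]
  · intro i j hij
    fin_cases i <;> fin_cases j <;> first | (exfalso; revert hij; decide) | skip
    · simpa using hxy.ne
    · exact Set.disjoint_singleton_left.2 (hxU (hsub hER))
    · exact Set.disjoint_singleton_left.2 (hxU (hsub hFR))
    · exact Set.disjoint_singleton_left.2 (hxU (hsub hKR))
    · exact Set.disjoint_singleton_left.2 (hyU (hsub hER))
    · exact Set.disjoint_singleton_left.2 (hyU (hsub hFR))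
    · exact Set.disjoint_singleton_left.2 (hyU (hsub hKR))
    · exact hdis (by decide) hER hFR hEF
    · exact hdis (by decide) hER hKR hEK
    · exact hdis (by decide) hFR hKR hFK
  · intro i j hij
    fin_cases i <;> fin_cases j <;> first | (exfalso; revert hij; decide) | skip
    · exact ⟨x, rfl, y, rfl, hxy⟩
    · exact (hPx 0).mono le_rfl subset_rfl Set.subset_union_left
    · exact (hPx 1).mono le_rfl subset_rfl Set.subset_union_left
    · exact (hPx 2).mono le_rfl subset_rfl Set.subset_union_left
    · exact (hPy 0).mono le_rfl subset_rfl Set.subset_union_left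
    · exact (hPy 1).mono le_rfl subset_rfl Set.subset_union_left
    · exact (hPy 2).mono le_rfl subset_rfl Set.subset_union_left
    · exact hEt.mono le_rfl subset_rfl Set.subset_union_left
    · exact (hKt.mono le_rfl subset_rfl Set.subset_union_left).symm
    · exact hFt.mono le_rfl subset_rfl Set.subset_union_left

end NonseparatingParts

section EdgeBound

open Classical

variable {V : Type*} {G : SimpleGraph V}

lemma cliqueCount_contractInto {B : Finset V} {x y : V} (hx : x ∉ B) (k : ℕ) :
    cliqueCount (contractInto G x y) (insert x B) (k + 1) = cliqueCount G B (k + 1) +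
      cliqueCount G ({u ∈ B | G.Adj x u} ∪ {u ∈ B | G.Adj y u}) k := by
  have hB : ∀ S ⊆ B, ∀ k, cliqueCount (contractInto G x y) S k = cliqueCount G S k := by
    intro S hS k
    refine cliqueCount_congr (fun u hu v hv => ?_) k
    have hu' : u ≠ x := fun h => hx (h ▸ hS hu)
    have hv' : v ≠ x := fun h => hx (h ▸ hS hv)
    simp only [contractInto, hu', hv', false_and, or_false]
    exact ⟨fun h => h.2, fun h => ⟨h.ne, h⟩⟩
  have hN : {u ∈ B | (contractInto G x y).Adj x u} =
      {u ∈ B | G.Adj x u} ∪ {u ∈ B | G.Adj y u} := by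
    ext u
    simp only [Finset.mem_filter, Finset.mem_union, contractInto]
    constructor
    · rintro ⟨hu, -, h | h | h⟩
      exacts [Or.inl ⟨hu, h⟩, Or.inr ⟨hu, h.2⟩, absurd (h.1 ▸ hu) hx]
    · rintro (⟨hu, h⟩ | ⟨hu, h⟩)
      · exact ⟨hu, h.ne, Or.inl h⟩
      · exact ⟨hu, fun e => hx (e ▸ hu), Or.inr (Or.inl ⟨trivial, h⟩)⟩
  rw [cliqueCount_insert hx, hN, hB _ subset_rfl, hB _ (Finset.union_subset
    (Finset.filter_subset _ _) (Finset.filter_subset _ _))]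

lemma cliqueCount_contractInto_two {B : Finset V} {x y : V} (hx : x ∉ B) (hy : y ∉ B)
    (hxy : G.Adj x y) :
    cliqueCount (contractInto G x y) (insert x B) 2 +
      ({u ∈ B | G.Adj x u} ∩ {u ∈ B | G.Adj y u}).card + 1 =
      cliqueCount G (insert x (insert y B)) 2 := by
  rw [cliqueCount_contractInto hx, cliqueCount_two_insert_insert hx hy hxy.ne, if_pos hxy,
    cliqueCount_one, add_assoc (cliqueCount G B (1 + 1)), Finset.card_union_add_card_inter]
  ring

lemma cliqueCount_contractInto_three_le {B : Finset V} {x y : V} (hx : x ∉ B) (hy : y ∉ B)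
    (hxy : G.Adj x y) :
    cliqueCount (contractInto G x y) (insert x B) 3 +
      ({u ∈ B | G.Adj x u} ∩ {u ∈ B | G.Adj y u}).card ≤
      cliqueCount G (insert x (insert y B)) 3 +
      {p ∈ ({u ∈ B | G.Adj x u} \ {u ∈ B | G.Adj y u}) ×ˢ
        ({u ∈ B | G.Adj y u} \ {u ∈ B | G.Adj x u}) | G.Adj p.1 p.2}.card := by
  rw [cliqueCount_contractInto hx, cliqueCount_three_insert_insert hx hy hxy.ne, if_pos hxy]
  have := cliqueCount_two_union_le (G := G) {u ∈ B | G.Adj x u} {u ∈ B | G.Adj y u}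
  simp only [Nat.reduceAdd]
  omega

/-- Separation along a set `C` that is itself tight for the edge bound. -/
lemma isLinked_of_not_edge_bound {A C : Finset V}
    (IH : ∀ A' ⊂ A, 4 ≤ A'.card →
      2 * cliqueCount G A' 2 + 8 ≤ 4 * A'.card + cliqueCount G A' 3)
    (hA : ¬ 2 * cliqueCount G A 2 + 8 ≤ 4 * A.card + cliqueCount G A 3) (hCA : C ⊂ A)
    (hC : 3 ≤ C.card) (hCt : 4 * C.card + cliqueCount G C 3 ≤ 8 + 2 * cliqueCount G C 2) :
    IsLinked G ((A : Set V) \ C) := by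
  obtain ⟨v, hv, hvC⟩ := Finset.exists_of_ssubset hCA
  refine ⟨⟨v, hv, hvC⟩, fun T hT hne hTc => ?_⟩
  by_contra hn
  obtain ⟨w, hw, hwT⟩ := Set.not_subset.1 hn
  obtain ⟨t, ht⟩ := hne
  have htA := hT ht
  simp only [Set.mem_sdiff, Finset.mem_coe] at htA hw
  set A₁ := C ∪ {u ∈ A | u ∈ T}
  set A₂ := {u ∈ A | u ∉ T}
  have hCT : ∀ u ∈ C, u ∉ T := fun u hu huT => (hT huT).2 hu
  have hU : A₁ ∪ A₂ = A := by
    ext u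
    simp only [A₁, A₂, Finset.mem_union, Finset.mem_filter]
    have := @hCA.1 u
    tauto
  have hI : A₁ ∩ A₂ = C := by
    ext u
    simp only [A₁, A₂, Finset.mem_union, Finset.mem_inter, Finset.mem_filter]
    have := @hCA.1 u
    have := hCT u
    tauto
  have h₁ : A₁ ⊂ A := by
    refine (Finset.ssubset_iff_of_subset (hU ▸ Finset.subset_union_left)).2 ⟨w, hw.1, ?_⟩
    simp only [A₁, Finset.mem_union, Finset.mem_filter]
    tauto
  have h₂ : A₂ ⊂ A := by
    refine (Finset.ssubset_iff_of_subset (hU ▸ Finset.subset_union_right)).2 ⟨t, htA.1, ?_⟩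
    simp [A₂, ht]
  have hlt₁ : C ⊂ A₁ := (Finset.ssubset_iff_of_subset Finset.subset_union_left).2
    ⟨t, by simp [htA.1, ht], htA.2⟩
  have hlt₂ : C ⊂ A₂ := (Finset.ssubset_iff_of_subset (hI ▸ Finset.inter_subset_right)).2
    ⟨w, by simp [A₂, hw.1, hwT], hw.2⟩
  have hno : ∀ u ∈ A₁ \ A₂, ∀ v ∈ A₂ \ A₁, ¬ G.Adj u v := by
    intro u hu v hv huv
    simp only [A₁, A₂, Finset.mem_union, Finset.mem_sdiff, Finset.mem_filter, not_or] at hu hv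
    have huT : u ∈ T := by
      rcases hu.1 with h | h
      · exact absurd ⟨hCA.1 h, hCT u h⟩ hu.2
      · exact h.2
    exact hv.1.2 (hTc u huT v ⟨hv.1.1, hv.2.1⟩ huv)
  have e2 := cliqueCount_union_add_inter hno 2
  have e3 := cliqueCount_union_add_inter hno 3
  have e1 := Finset.card_union_add_card_inter A₁ A₂
  rw [hU, hI] at e1 e2 e3
  have c1 := Finset.card_lt_card hlt₁
  have c2 := Finset.card_lt_card hlt₂
  have i1 := IH A₁ h₁ (by omega)
  have i2 := IH A₂ h₂ (by omega)
  omega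

theorem edge_bound [Finite V] {A : Finset V} (hG : KuratowskiMinorFree G (A : Set V))
    (hA : 4 ≤ A.card) : 2 * cliqueCount G A 2 + 8 ≤ 4 * A.card + cliqueCount G A 3 := by
  induction hm : A.card + cliqueCount G A 2 using Nat.strong_induction_on generalizing G A with
  | _ m IH =>
  subst hm
  by_contra hbad
  have IHs : ∀ A' ⊂ A, 4 ≤ A'.card →
      2 * cliqueCount G A' 2 + 8 ≤ 4 * A'.card + cliqueCount G A' 3 := by
    intro A' hA' h4
    refine IH _ ?_ (hG.mono le_rfl (Finset.coe_subset.2 hA'.1)) h4 rfl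
    have := Finset.card_lt_card hA'
    have := cliqueCount_mono (G := G) hA'.1 2
    omega
  have h5 : 5 ≤ A.card := by
    by_contra h5
    obtain ⟨a, ha⟩ := Finset.card_pos.1 (show 0 < A.card by omega)
    obtain ⟨b, c, d, hbc, hbd, hcd, he⟩ := Finset.card_eq_three.1
      (show (A.erase a).card = 3 by rw [Finset.card_erase_of_mem ha]; omega)
    have hae : a ∉ A.erase a := Finset.notMem_erase a A
    rw [he] at hae
    simp only [Finset.mem_insert, Finset.mem_singleton, not_or] at hae
    have := cliqueCount_four_points (G := G) hae.1 hae.2.1 hae.2.2 hbc hbd hcd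
    rw [← he, Finset.insert_erase ha] at this
    omega
  have hsplit : ∀ x ∈ A, ∀ y ∈ A, x ≠ y → ∃ B : Finset V, x ∉ B ∧ y ∉ B ∧
      A = insert x (insert y B) ∧ ∀ v, v ∈ B ↔ v ∈ A ∧ v ≠ x ∧ v ≠ y := by
    intro x hx y hy hxy
    refine ⟨(A.erase x).erase y, by simp, by simp, ?_, by intro v; simp; tauto⟩
    rw [Finset.insert_erase (by simp [hxy.symm, hy]), Finset.insert_erase hx]
  have hdeg : ∀ v ∈ A, 3 ≤ {u ∈ A | G.Adj v u}.card := by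
    intro v hv
    have h1 := IHs (A.erase v) (Finset.erase_ssubset hv)
      (by rw [Finset.card_erase_of_mem hv]; omega)
    have h2 := cliqueCount_insert (G := G) (Finset.notMem_erase v A) 1
    have h3 := cliqueCount_mono (G := G) (Finset.erase_subset v A) 3
    have h4 : {u ∈ A.erase v | G.Adj v u} = {u ∈ A | G.Adj v u} := by
      ext u
      simp only [Finset.mem_filter, Finset.mem_erase]
      exact ⟨fun h => ⟨h.1.2, h.2⟩, fun h => ⟨⟨h.2.ne', h.1⟩, h.2⟩⟩
    rw [Finset.insert_erase hv, cliqueCount_one, h4] at h2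
    rw [Finset.card_erase_of_mem hv] at h1
    norm_num at h2
    omega
  have htri : ∀ x ∈ A, ∀ y ∈ A, ∀ z ∈ A, ∀ w ∈ A, G.Adj x y → G.Adj x z → G.Adj y z →
      G.Adj x w → G.Adj y w → z = w := by
    intro x hx y hy z hz w hw hxy hxz hyz hxw hyw
    by_contra hzw
    obtain ⟨B, hxB, hyB, rfl, hB⟩ := hsplit x hx y hy hxy.ne
    obtain ⟨G', hG'eq⟩ : ∃ G', G' = G.deleteEdges {s(x, y)} := ⟨_, rfl⟩
    have hle : G' ≤ G := hG'eq ▸ deleteEdges_le _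
    have hG' : ∀ u v, v ∈ B → (G'.Adj u v ↔ G.Adj u v) := by
      intro u v hv
      have hvx : v ≠ x := ((hB v).1 hv).2.1
      have hvy : v ≠ y := ((hB v).1 hv).2.2
      simp only [hG'eq, deleteEdges_adj, Set.mem_singleton_iff, Sym2.eq_iff]
      tauto
    have hN : ∀ u, {v ∈ B | G'.Adj u v} = {v ∈ B | G.Adj u v} :=
      fun u => Finset.filter_congr fun v hv => hG' u v hv
    have hc : ∀ S ⊆ B, ∀ k, cliqueCount G' S k = cliqueCount G S k := fun S hS k =>
      cliqueCount_congr (fun u _ v hv => hG' u v (hS hv)) k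
    have hxy' : ¬ G'.Adj x y := by simp [hG'eq]
    have i := IH (G := G') (A := insert x (insert y B))
    have e2' := cliqueCount_two_insert_insert (G := G') hxB hyB hxy.ne
    have e3' := cliqueCount_three_insert_insert (G := G') hxB hyB hxy.ne
    rw [if_neg hxy', hN, hN, hc _ subset_rfl] at e2' e3'
    rw [hc _ (Finset.filter_subset _ _), hc _ (Finset.filter_subset _ _)] at e3'
    have e2 := cliqueCount_two_insert_insert (G := G) hxB hyB hxy.ne
    have e3 := cliqueCount_three_insert_insert (G := G) hxB hyB hxy.ne
    rw [if_pos hxy] at e2 e3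
    have hi := i _ (by omega) (hG.mono hle subset_rfl) hA rfl
    have hcard : 1 < ({u ∈ B | G.Adj x u} ∩ {u ∈ B | G.Adj y u}).card := by
      refine Finset.one_lt_card.2 ⟨z, ?_, w, ?_, hzw⟩
      · have := (hB z).2 ⟨hz, hxz.ne', hyz.ne'⟩
        exact Finset.mem_inter.2 ⟨Finset.mem_filter.2 ⟨this, hxz⟩, Finset.mem_filter.2 ⟨this, hyz⟩⟩
      · have := (hB w).2 ⟨hw, hxw.ne', hyw.ne'⟩
        exact Finset.mem_inter.2 ⟨Finset.mem_filter.2 ⟨this, hxw⟩, Finset.mem_filter.2 ⟨this, hyw⟩⟩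
    omega
  have hcyc : ∀ a ∈ A, ∀ b ∈ A, ∀ c ∈ A, ∀ d ∈ A, a ≠ c → b ≠ d → G.Adj a b → G.Adj b c →
      G.Adj c d → G.Adj d a → IsLinked G ((A : Set V) \ {a, b, c, d}) := by
    intro a ha b hb c hc d hd hac hbd hab hbc hcd hda
    have h4 : ({a, b, c, d} : Finset V).card = 4 := by
      simp [hab.ne, hac, hda.ne', hbc.ne, hbd, hcd.ne]
    have hsub : ({a, b, c, d} : Finset V) ⊆ A := by
      simp [Finset.insert_subset_iff, ha, hb, hc, hd]
    have := cliqueCount_four_cycle hac hbd hab hbc hcd hda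
    simpa using isLinked_of_not_edge_bound IHs hbad
      (hsub.ssubset_of_ne fun h => by rw [h] at h4; omega) (by omega) (by omega)
  have htriangle : ∀ a ∈ A, ∀ b ∈ A, ∀ c ∈ A, G.Adj a b → G.Adj b c → G.Adj a c →
      IsLinked G ((A : Set V) \ {a, b, c}) := by
    intro a ha b hb c hc hab hbc hac
    have h3 : ({a, b, c} : Finset V).card = 3 := by simp [hab.ne, hac.ne, hbc.ne]
    have hsub : ({a, b, c} : Finset V) ⊆ A := by simp [Finset.insert_subset_iff, ha, hb, hc]
    have hcl : G.IsClique (({a, b, c} : Finset V) : Set V) := by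
      simp [isClique_insert, hab, hac, hbc]
    have e2 := cliqueCount_of_isClique hcl 2
    have e3 := cliqueCount_of_isClique hcl 3
    rw [h3] at e2 e3
    norm_num [Nat.choose] at e2 e3
    simpa using isLinked_of_not_edge_bound IHs hbad
      (hsub.ssubset_of_ne fun h => by rw [h] at h3; omega) (by omega) (by omega)
  have hK23 : ∀ x ∈ A, ∀ y ∈ A, ∀ b ∈ A, ∀ a ∈ A, ∀ a' ∈ A, x ≠ b → a ≠ a' → a ≠ y → a' ≠ y →
      G.Adj x y → G.Adj x a → G.Adj x a' → G.Adj b y → G.Adj b a → G.Adj b a' → False := by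
    intro x hx y hy b hb a ha a' ha' hxb haa' hay ha'y hxy hxa hxa' hby hba hba'
    obtain ⟨r, hr, hrx, hrb⟩ : ∃ r ∈ {u ∈ A | G.Adj a u}, r ≠ x ∧ r ≠ b := by
      by_contra! h
      have h1 : {u ∈ A | G.Adj a u} ⊆ {x, b} := fun u hu => by
        have := h u hu
        simp only [Finset.mem_insert, Finset.mem_singleton]
        tauto
      have := (Finset.card_le_card h1).trans Finset.card_le_two
      have := hdeg a ha
      omega
    obtain ⟨hrA, har⟩ := Finset.mem_filter.1 hr
    have hry : r ≠ y := by
      rintro rfl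
      exact hxb (htri a ha r hy x hx b hb har hxa.symm hxy.symm hba.symm hby.symm)
    have hra' : r ≠ a' := by
      rintro rfl
      exact hxb (htri a ha r ha' x hx b hb har hxa.symm hxa'.symm hba.symm hba'.symm)
    have hset : ∀ {p q s : V}, p ∈ A → p ≠ x → p ≠ b → p ≠ q → p ≠ s →
        ({q, p, s} : Set V) = {a, a', y} → ((A : Set V) \ {x, a, b, a', y}) ∪ {p} =
          (A : Set V) \ {x, q, b, s} := by
      intro p q s hp h1 h2 h3 h4 h
      ext v
      have hv : v ∈ ({q, p, s} : Set V) ↔ v ∈ ({a, a', y} : Set V) := by rw [h]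
      simp only [Set.mem_insert_iff, Set.mem_singleton_iff, Set.mem_union, Set.mem_sdiff,
        Finset.mem_coe, not_or] at hv ⊢
      by_cases hvp : v = p
      · subst hvp; tauto
      · tauto
    refine hG.2 (hasMinor_K33_of_K23 (R := (A : Set V) \ {x, a, b, a', y}) (x := x) (b := b)
      (z := ![a, a', y]) hx hb ?_ Set.sdiff_subset ?_ hxb (by simp) (by simp) ?_ ?_ ?_
      ⟨r, by simp [hrA, hrx, hrb, hry, hra', har.ne']⟩ ?_)
    · intro i; fin_cases i
      exacts [ha, ha', hy]
    · intro i j hij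
      fin_cases i <;> fin_cases j <;> simp at hij
      exacts [haa', hay, ha'y]
    · intro i; fin_cases i <;> simp
    · intro i; fin_cases i
      exacts [hxa, hxa', hxy]
    · intro i; fin_cases i
      exacts [hba, hba', hby]
    · intro i; fin_cases i
      · change IsLinked G (_ ∪ {a})
        rw [hset (p := a) (q := a') (s := y) ha hxa.ne' hba.ne' haa' hay
          (by rw [Set.insert_comm])]
        exact hcyc x hx a' ha' b hb y hy hxb ha'y hxa' hba'.symm hby hxy.symm
      · change IsLinked G (_ ∪ {a'})
        rw [hset (p := a') (q := a) (s := y) ha' hxa'.ne' hba'.ne' haa'.symm ha'y rfl]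
        exact hcyc x hx a ha b hb y hy hxb hay hxa hba.symm hby hxy.symm
      · change IsLinked G (_ ∪ {y})
        rw [hset (p := y) (q := a) (s := a') hy hxy.ne' hby.ne' hay.symm ha'y.symm
          (by rw [Set.pair_comm])]
        exact hcyc x hx a ha b hb a' ha' hxb haa' hxa hba.symm hba' hxa'.symm
  obtain ⟨x, hx⟩ := Finset.card_pos.1 (show 0 < A.card by omega)
  obtain ⟨y, hy⟩ := Finset.card_pos.1 (show 0 < {u ∈ A | G.Adj x u}.card by
    have := hdeg x hx; omega)
  obtain ⟨hy, hxy⟩ := Finset.mem_filter.1 hy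
  obtain ⟨B, hxB, hyB, hAB, hB⟩ := hsplit x hx y hy hxy.ne
  set M := {u ∈ B | G.Adj x u} with hM
  set N := {u ∈ B | G.Adj y u} with hN
  set Q := {p ∈ (M \ N) ×ˢ (N \ M) | G.Adj p.1 p.2} with hQ
  have hmany : 2 < (M ∩ N).card + Q.card := by
    have e2 := cliqueCount_contractInto_two hxB hyB hxy
    have e3 := cliqueCount_contractInto_three_le hxB hyB hxy
    rw [← hAB, ← hM, ← hN] at e2 e3
    rw [← hQ] at e3
    have hc : A.card = (insert x B).card + 1 := by
      rw [hAB, Finset.insert_comm, Finset.card_insert_of_notMem (by simp [hyB, hxy.ne'])]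
    have hsub : ((insert x B : Finset V) : Set V) ⊆ (A : Set V) \ {y} := by
      intro v hv
      rcases Finset.mem_insert.1 (Finset.mem_coe.1 hv) with rfl | hv
      exacts [⟨hx, hxy.ne⟩, ⟨((hB v).1 hv).1, ((hB v).1 hv).2.2⟩]
    have i := IH _ (by omega) ((hG.contractInto hxy hy).mono le_rfl hsub) (by omega) rfl
    omega
  have hcard : 2 < (Q ∪ (M ∩ N).image fun z => (z, z)).card := by
    rw [Finset.card_union_of_disjoint, Finset.card_image_of_injective]
    · omega
    · exact fun a b h => (Prod.ext_iff.1 h).1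
    · rw [Finset.disjoint_left]
      intro q hq hq'
      obtain ⟨z, -, rfl⟩ := Finset.mem_image.1 hq'
      exact (Finset.mem_filter.1 hq).2.ne rfl
  obtain ⟨p₀, hp₀, p₁, hp₁, p₂, hp₂, h01, h02, h12⟩ := Finset.two_lt_card.1 hcard
  have hQ' : ∀ q ∈ Q ∪ (M ∩ N).image fun z => (z, z), q.1 ∈ M ∧ q.2 ∈ N ∧
      (q.1 = q.2 ∨ (G.Adj q.1 q.2 ∧ q.1 ∉ N ∧ q.2 ∉ M)) := by
    intro q hq
    rcases Finset.mem_union.1 hq with hq | hq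
    · obtain ⟨hq, hadj⟩ := Finset.mem_filter.1 hq
      simp only [Finset.mem_product, Finset.mem_sdiff] at hq
      exact ⟨hq.1.1, hq.2.1, Or.inr ⟨hadj, hq.1.2, hq.2.2⟩⟩
    · obtain ⟨z, hz, rfl⟩ := Finset.mem_image.1 hq
      obtain ⟨hzM, hzN⟩ := Finset.mem_inter.1 hz
      exact ⟨hzM, hzN, Or.inl rfl⟩
  have hMA : ∀ v ∈ M, v ∈ A ∧ v ≠ x ∧ v ≠ y ∧ G.Adj x v := fun v hv => by
    obtain ⟨h1, h2⟩ := Finset.mem_filter.1 hv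
    exact ⟨((hB v).1 h1).1, ((hB v).1 h1).2.1, ((hB v).1 h1).2.2, h2⟩
  have hNA : ∀ v ∈ N, v ∈ A ∧ v ≠ x ∧ v ≠ y ∧ G.Adj y v := fun v hv => by
    obtain ⟨h1, h2⟩ := Finset.mem_filter.1 hv
    exact ⟨((hB v).1 h1).1, ((hB v).1 h1).2.1, ((hB v).1 h1).2.2, h2⟩
  have hdisj : ∀ q ∈ Q ∪ (M ∩ N).image fun z => (z, z),
      ∀ q' ∈ Q ∪ (M ∩ N).image fun z => (z, z), q ≠ q' →
      Disjoint ({q.1, q.2} : Set V) {q'.1, q'.2} := by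
    intro q hq q' hq' hne
    obtain ⟨a, b⟩ := q
    obtain ⟨a', b'⟩ := q'
    obtain ⟨h1, h2, h3⟩ := hQ' _ hq
    obtain ⟨h1', h2', h3'⟩ := hQ' _ hq'
    simp only at h1 h2 h3 h1' h2' h3' ⊢
    have n1 : a ≠ a' := by
      rintro rfl
      rcases h3 with rfl | ⟨h3, h4, h5⟩ <;> rcases h3' with rfl | ⟨h3', h4', h5'⟩
      · exact hne rfl
      · exact h4' h2
      · exact h4 h2'
      · exact hK23 y hy x hx a (hMA a h1).1 b (hNA b h2).1 b' (hNA b' h2').1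
          (hMA a h1).2.2.1.symm (fun e => hne (e ▸ rfl)) (hNA b h2).2.1 (hNA b' h2').2.1
          hxy.symm (hNA b h2).2.2.2 (hNA b' h2').2.2.2 (hMA a h1).2.2.2.symm h3 h3'
    have n2 : b ≠ b' := by
      rintro rfl
      rcases h3 with rfl | ⟨h3, h4, h5⟩ <;> rcases h3' with rfl | ⟨h3', h4', h5'⟩
      · exact hne rfl
      · exact h5' h1
      · exact h5 h1'
      · exact hK23 x hx y hy b (hNA b h2).1 a (hMA a h1).1 a' (hMA a' h1').1
          (hNA b h2).2.1.symm (fun e => hne (e ▸ rfl)) (hMA a h1).2.2.1 (hMA a' h1').2.2.1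
          hxy (hMA a h1).2.2.2 (hMA a' h1').2.2.2 (hNA b h2).2.2.2.symm h3.symm h3'.symm
    have n3 : a ≠ b' := by
      rintro rfl
      rcases h3 with rfl | ⟨h3, h4, h5⟩
      · exact n2 rfl
      · exact h4 h2'
    have n4 : b ≠ a' := by
      rintro rfl
      rcases h3 with rfl | ⟨h3, h4, h5⟩
      · exact n1 rfl
      · exact h5 h1'
    simp [n1.symm, n2.symm, n3.symm, n4.symm]
  set p : Fin 3 → V × V := ![p₀, p₁, p₂] with hp
  have hpQ : ∀ i, p i ∈ Q ∪ (M ∩ N).image fun z => (z, z) := by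
    intro i; fin_cases i
    exacts [hp₀, hp₁, hp₂]
  have hpne : ∀ i j, i ≠ j → p i ≠ p j := by
    intro i j hij
    fin_cases i <;> fin_cases j <;> first | exact absurd rfl hij | skip
    exacts [h01, h02, h01.symm, h12, h02.symm, h12.symm]
  refine not_kuratowskiMinorFree_of_parts (P := fun i => {(p i).1, (p i).2}) hxy hx hy
    (fun i => ?_) (fun i => ?_) (fun i j hij => hdisj _ (hpQ i) _ (hpQ j) (hpne i j hij))
    (fun i => ?_) (fun i => ?_) (fun i => ?_) hG
  all_goals
    obtain ⟨h1, h2, h3⟩ := hQ' _ (hpQ i)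
    obtain ⟨m1, m2, m3, m4⟩ := hMA _ h1
    obtain ⟨n1, n2, n3, n4⟩ := hNA _ h2
  · rcases h3 with h3 | h3
    · rw [h3, Set.pair_eq_singleton]
      exact isLinked_singleton _
    · exact isLinked_pair h3.1
  · rintro v (rfl | rfl)
    · simp [m1, m2, m3]
    · simp [n1, n2, n3]
  · exact ⟨x, rfl, _, Or.inl rfl, m4⟩
  · exact ⟨y, rfl, _, Or.inr rfl, n4⟩
  · rw [Set.sdiff_sdiff]
    rcases h3 with h3 | ⟨h3, h4, h5⟩
    · have := htriangle x hx y hy (p i).1 m1 hxy (h3 ▸ n4) m4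
      rwa [← h3, Set.pair_eq_singleton, Set.insert_union, Set.singleton_union]
    · have := hcyc x hx y hy (p i).2 n1 (p i).1 m1 n2.symm m3.symm hxy n4 h3.symm m4.symm
      rwa [Set.insert_union, Set.singleton_union, Set.pair_comm (p i).1]

end EdgeBound

section DiamondFree

open Classical

variable {V : Type*} {G : SimpleGraph V}

/-- Any two common neighbours of adjacent vertices are equal or adjacent. -/
def DiamondFree (G : SimpleGraph V) : Prop :=
  ∀ ⦃u v w w' : V⦄, G.Adj u v → G.Adj u w → G.Adj v w → G.Adj u w' → G.Adj v w' →
    w ≠ w' → G.Adj w w'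

lemma hasMinor_K5_of_isClique {A C : Set V} {K : Finset V} (hK : G.IsClique (K : Set V))
    (hK4 : K.card = 4) (hKA : (K : Set V) ⊆ A) (hCA : C ⊆ A) (hC : IsLinked G C)
    (hCK : Disjoint C K) (h : ∀ d ∈ K, Touches G C {d}) :
    HasMinor (completeGraph (Fin 5)) G A := by
  have f := (K.equivFinOfCardEq hK4).symm
  refine hasMinor_K5 (Fin.cons C fun i => {(f i : V)}) ?_ ?_ ?_ ?_
  · refine Fin.cases hCA fun i => ?_
    simpa using hKA (f i).2
  · refine Fin.cases hC fun i => ?_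
    simpa using isLinked_singleton _
  · refine Fin.cases (Fin.cases (fun h => absurd h (lt_irrefl _)) fun j _ => ?_) fun i =>
      Fin.cases (fun h => absurd h (by simp)) fun j hij => ?_
    · simpa using hCK.notMem_of_mem_right (f j).2
    · have : f j ≠ f i := fun e => (Fin.succ_lt_succ_iff.1 hij).ne' (f.injective e)
      simpa [Subtype.ext_iff] using this.symm
  · refine Fin.cases (Fin.cases (fun h => absurd h (lt_irrefl _)) fun j _ => ?_) fun i =>
      Fin.cases (fun h => absurd h (by simp)) fun j hij => ?_
    · simpa using h _ (f j).2
    · have : f j ≠ f i := fun e => (Fin.succ_lt_succ_iff.1 hij).ne' (f.injective e)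
      exact ⟨f i, rfl, f j, rfl, hK (f i).2 (f j).2 fun e => this (Subtype.ext e.symm)⟩

theorem DiamondFree.edge_bound [Finite V] (hD : DiamondFree G)
    (hG : KuratowskiMinorFree G Set.univ) {A : Finset V} (hA : 4 ≤ A.card)
    (hA4 : A.card = 4 → ¬ G.IsClique (A : Set V)) :
    2 * cliqueCount G A 2 + cliqueCount G A 4 + 8 ≤ 4 * A.card + cliqueCount G A 3 := by
  induction A using Finset.strongInduction with
  | H A IH =>
  by_cases h0 : cliqueCount G A 4 = 0
  · have := _root_.edge_bound (hG.mono le_rfl (Set.subset_univ (A : Set V))) hA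
    omega
  obtain ⟨K, hKA, hK4, hK⟩ := exists_isClique_of_cliqueCount_ne_zero h0
  obtain ⟨r, hrA, hrK⟩ := Finset.exists_of_ssubset (hKA.ssubset_of_ne fun h => by
    subst h; exact hA4 hK4 hK)
  obtain ⟨D, hDR, hrD, hDl, hDc⟩ := exists_component (G := G) ((A : Set V) \ K)
    (r := r) ⟨hrA, hrK⟩
  obtain ⟨d, hdK, hd⟩ : ∃ d ∈ K, ¬ Touches G D {d} := by
    by_contra! h
    exact hG.1 (hasMinor_K5_of_isClique hK hK4 (Set.subset_univ _) (Set.subset_univ _) hDl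
      (Set.disjoint_left.2 fun v hv => (hDR hv).2) h)
  set A₁ := {v ∈ A | v ∈ D} ∪ K.erase d with hA₁
  set A₂ := {v ∈ A | v ∉ D} with hA₂
  have hKD : ∀ v ∈ K, v ∉ D := fun v hv h => (hDR h).2 hv
  have hU : A₁ ∪ A₂ = A := by
    ext u
    simp only [A₁, A₂, Finset.mem_union, Finset.mem_filter, Finset.mem_erase]
    have := @hKA u
    tauto
  have hI : A₁ ∩ A₂ = K.erase d := by
    ext u
    simp only [A₁, A₂, Finset.mem_union, Finset.mem_inter, Finset.mem_filter, Finset.mem_erase]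
    have := @hKA u
    have := hKD u
    tauto
  have hno : ∀ u ∈ A₁ \ A₂, ∀ v ∈ A₂ \ A₁, ¬ G.Adj u v := by
    intro u hu v hv huv
    simp only [A₁, A₂, Finset.mem_union, Finset.mem_sdiff, Finset.mem_filter, not_or,
      Finset.mem_erase] at hu hv
    have huD : u ∈ D := by
      have := @hKA u
      tauto
    by_cases hvd : v = d
    · exact hd ⟨u, huD, v, hvd, huv⟩
    · exact hv.1.2 (hDc u huD v ⟨hv.1.1, fun h => hv.2.2 ⟨hvd, h⟩⟩ huv)
  have hrA₁ : r ∈ A₁ := by simp [A₁, hrA, hrD]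
  have hKA₂ : K ⊆ A₂ := fun v hv => Finset.mem_filter.2 ⟨hKA hv, hKD v hv⟩
  have h₁ : A₁ ⊂ A := by
    refine (Finset.ssubset_iff_of_subset (hU ▸ Finset.subset_union_left)).2 ⟨d, hKA hdK, ?_⟩
    simp [A₁, hKD d hdK]
  have h₂ : A₂ ⊂ A := by
    refine (Finset.ssubset_iff_of_subset (hU ▸ Finset.subset_union_right)).2 ⟨r, hrA, ?_⟩
    simp [A₂, hrD]
  have hK3 : (K.erase d).card = 3 := by rw [Finset.card_erase_of_mem hdK, hK4]
  have hKe : K.erase d ⊂ A₁ := (Finset.ssubset_iff_of_subset Finset.subset_union_right).2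
    ⟨r, hrA₁, fun h => hrK (Finset.mem_of_mem_erase h)⟩
  have hcl : ¬ G.IsClique (A₁ : Set V) := by
    intro hcl
    obtain ⟨a, ha, b, hb, hab⟩ := Finset.one_lt_card.1 (show 1 < (K.erase d).card by omega)
    have hra : ∀ a ∈ K.erase d, G.Adj a r := fun a ha =>
      hcl (hKe.1 ha) hrA₁ fun e => hrK (e ▸ Finset.mem_of_mem_erase ha)
    have hda : ∀ a ∈ K.erase d, G.Adj a d := fun a ha =>
      hK (Finset.mem_of_mem_erase ha) hdK (Finset.ne_of_mem_erase ha)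
    exact hd ⟨r, hrD, d, rfl, hD (hcl (hKe.1 ha) (hKe.1 hb) hab) (hra a ha) (hra b hb)
      (hda a ha) (hda b hb) fun e => hrK (e ▸ hdK)⟩
  have b₁ := IH A₁ h₁ (by have := Finset.card_lt_card hKe; omega) fun _ => hcl
  have b₂ : 2 * cliqueCount G A₂ 2 + cliqueCount G A₂ 4 + 7 ≤
      4 * A₂.card + cliqueCount G A₂ 3 := by
    have hle := Finset.card_le_card hKA₂
    rcases hle.eq_or_lt with h | h
    · rw [← Finset.eq_of_subset_of_card_le hKA₂ h.ge, cliqueCount_of_isClique hK,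
        cliqueCount_of_isClique hK, cliqueCount_of_isClique hK, hK4]
      norm_num [Nat.choose]
    · have := IH A₂ h₂ (by omega) fun h => by omega
      omega
  have e1 := Finset.card_union_add_card_inter A₁ A₂
  have e2 := cliqueCount_union_add_inter hno 2
  have e3 := cliqueCount_union_add_inter hno 3
  have e4 := cliqueCount_union_add_inter hno 4
  have hKc : G.IsClique (K.erase d : Set V) := hK.subset (Finset.coe_subset.2 (K.erase_subset d))
  rw [hU, hI] at e1 e2 e3 e4
  rw [cliqueCount_of_isClique hKc, hK3] at e2 e3 e4
  norm_num [Nat.choose] at e2 e3 e4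
  omega

lemma DiamondFree.two_mul_cliqueCount_three_le (hD : DiamondFree G) (A : Finset V) :
    2 * cliqueCount G A 3 ≤ cliqueCount G A 2 + 2 * cliqueCount G A 4 := by
  have h1 : ∀ v ∈ A, 4 * cliqueCount G {u ∈ A | G.Adj v u} 2 ≤
      3 * cliqueCount G {u ∈ A | G.Adj v u} 1 + 3 * cliqueCount G {u ∈ A | G.Adj v u} 3 := by
    intro v _
    set N := {u ∈ A | G.Adj v u} with hN
    have h2 : ∀ w ∈ N, 2 * cliqueCount G {u ∈ N | G.Adj w u} 1 ≤
        3 + cliqueCount G {u ∈ N | G.Adj w u} 2 := by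
      intro w hw
      have hcl : G.IsClique ({u ∈ N | G.Adj w u} : Finset V) := by
        intro u hu u' hu' huu'
        simp only [hN, Finset.mem_coe, Finset.mem_filter] at hu hu' hw
        exact hD hw.2 hu.1.2 hu.2 hu'.1.2 hu'.2 huu'
      rw [cliqueCount_of_isClique hcl, cliqueCount_of_isClique hcl]
      generalize Finset.card _ = m
      induction m with
      | zero => simp
      | succ m ih =>
        rw [Nat.choose_succ_succ' m 1, Nat.choose_one_right]
        rw [Nat.choose_one_right] at ih ⊢
        simp only [Nat.reduceAdd]
        rcases m with _ | _ | m
        · simp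
        · simp
        · omega
    have h3 := Finset.sum_le_sum h2
    rw [← Finset.mul_sum, Finset.sum_add_distrib, sum_cliqueCount_neighbors,
      sum_cliqueCount_neighbors, Finset.sum_const, smul_eq_mul, ← cliqueCount_one (G := G)] at h3
    norm_num at h3
    omega
  have h3 := Finset.sum_le_sum h1
  rw [← Finset.mul_sum, Finset.sum_add_distrib, ← Finset.mul_sum, ← Finset.mul_sum,
    sum_cliqueCount_neighbors, sum_cliqueCount_neighbors, sum_cliqueCount_neighbors] at h3
  norm_num at h3
  omega

end DiamondFree

section Subdivisions

variable {W V ι κ : Type*} {G : SimpleGraph V}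

/-- Linked subsets of `S` joining a common centre to each `s i` and otherwise disjoint. -/
def HasSpider (G : SimpleGraph V) (S : Set V) (s : ι → V) : Prop :=
  ∃ c ∈ S, ∃ L : ι → Set V,
    (∀ i, IsLinked G (L i) ∧ L i ⊆ S ∧ c ∈ L i ∧ s i ∈ L i) ∧
    ∀ i j, i ≠ j → L i ∩ L j ⊆ {c}

lemma HasSpider.of_surjective {S : Set V} {s : κ → V} {g : ι → κ}
    (hg : Function.Surjective g) (h : HasSpider G S (s ∘ g)) : HasSpider G S s := by
  obtain ⟨c, hc, L, h1, h2⟩ := h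
  obtain ⟨f, hf⟩ := hg.hasRightInverse
  refine ⟨c, hc, L ∘ f, fun k => ?_, fun k l hkl => h2 _ _ fun e => hkl ?_⟩
  · obtain ⟨i1, i2, i3, i4⟩ := h1 (f k)
    refine ⟨i1, i2, i3, ?_⟩
    rwa [Function.comp_apply, hf k] at i4
  · rw [← hf k, ← hf l, e]

lemma IsLinked.exists_isPath {S : Set V} (hS : IsLinked G S) {u v : V} (hu : u ∈ S)
    (hv : v ∈ S) : ∃ p : G.Walk u v, p.IsPath ∧ ∀ x ∈ p.support, x ∈ S := by
  classical
  have h := hS.2 {v | v ∈ S ∧ ∃ p : G.Walk u v, ∀ x ∈ p.support, x ∈ S} (fun x hx => hx.1)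
    ⟨u, hu, Walk.nil, by simpa using hu⟩ (by
      rintro x ⟨-, p, hp⟩ y hy hxy
      refine ⟨hy, p.concat hxy, fun z hz => ?_⟩
      rw [Walk.support_concat] at hz
      rcases List.mem_append.1 hz with hz | hz
      exacts [hp z hz, List.mem_singleton.1 hz ▸ hy])
  obtain ⟨-, p, hp⟩ := h hv
  exact ⟨p.bypass, p.bypass_isPath, fun x hx => hp x (p.support_bypass_subset_support hx)⟩

lemma IsLinked.subset_of_closed {S R D : Set V} (hS : IsLinked G S) (hSR : S ⊆ R)
    (hD : ∀ u ∈ D, ∀ v ∈ R, G.Adj u v → v ∈ D) {x : V} (hxS : x ∈ S) (hxD : x ∈ D) : S ⊆ D :=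
  (hS.2 (S ∩ D) Set.inter_subset_left ⟨x, hxS, hxD⟩ fun u hu v hv huv =>
    ⟨hv, hD u hu.2 v (hSR hv) huv⟩).trans Set.inter_subset_right

lemma IsLinked.exists_component_touches [Finite V] {S X : Set V} (hS : IsLinked G S) (hX : X ⊆ S)
    (hne : X.Nonempty) {r : V} (hr : r ∈ S \ X) :
    ∃ D ⊆ S \ X, r ∈ D ∧ IsLinked G D ∧ (∀ u ∈ D, ∀ v ∈ S \ X, G.Adj u v → v ∈ D) ∧
      Touches G D X := by
  obtain ⟨D, hDS, hrD, hD, hDc⟩ := exists_component (G := G) (S \ X) hr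
  refine ⟨D, hDS, hrD, hD, hDc, ?_⟩
  by_contra hn
  obtain ⟨x, hx⟩ := hne
  refine (hDS (hS.2 D (hDS.trans Set.sdiff_subset) ⟨r, hrD⟩ ?_ (hX hx))).2 hx
  intro u hu v hv huv
  exact hDc u hu v ⟨hv, fun hvX => hn ⟨u, hu, v, hvX, huv⟩⟩ huv

lemma IsLinked.exists_first_hit [Finite V] {S P : Set V} (hS : IsLinked G S) (hP : P ⊆ S)
    (hne : P.Nonempty) {s : V} (hs : s ∈ S) :
    ∃ Q ⊆ S, IsLinked G Q ∧ s ∈ Q ∧ ∃ c ∈ P, c ∈ Q ∧ Q ∩ P ⊆ {c} := by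
  by_cases hsP : s ∈ P
  · exact ⟨{s}, by simpa using hs, isLinked_singleton s, rfl, s, hsP, rfl, Set.inter_subset_left⟩
  obtain ⟨D, hDS, hsD, hD, -, u, hu, c, hc, huc⟩ :=
    hS.exists_component_touches hP hne ⟨hs, hsP⟩
  refine ⟨D ∪ {c}, Set.union_subset (hDS.trans Set.sdiff_subset) (by simpa using hP hc),
    hD.union (isLinked_singleton c) ⟨u, hu, c, rfl, huc⟩, Or.inl hsD, c, hc, Or.inr rfl, ?_⟩
  rintro x ⟨hx | hx, hxP⟩
  exacts [absurd hxP (hDS hx).2, hx]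

lemma IsLinked.union_of_mem {S T : Set V} (hS : IsLinked G S) (hT : IsLinked G T) {x : V}
    (hxS : x ∈ S) (hxT : x ∈ T) : IsLinked G (S ∪ T) :=
  ⟨hS.1.inl, fun U hU ⟨y, hy⟩ hc => by
    have key : ∀ R, IsLinked G R → R ⊆ S ∪ T → ∀ z ∈ R, z ∈ U → R ⊆ U := fun R hR hRS z hz hzU =>
      hR.subset_of_closed hRS hc hz hzU
    have hxU : x ∈ U := by
      rcases hU hy with h | h
      exacts [key S hS Set.subset_union_left y h hy hxS, key T hT Set.subset_union_right y h hy hxT]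
    exact Set.union_subset (key S hS Set.subset_union_left x hxS hxU)
      (key T hT Set.subset_union_right x hxT hxU)⟩

/-- A minimal linked set joining `a` to `b` is cut by each of its vertices other than `a`. -/
lemma IsLinked.exists_minimal_joining [Finite V] {S : Set V} (hS : IsLinked G S) {a b : V}
    (ha : a ∈ S) (hb : b ∈ S) :
    ∃ P ⊆ S, IsLinked G P ∧ a ∈ P ∧ b ∈ P ∧ ∀ c ∈ P, c ≠ a →
      ∃ E F, E ⊆ P ∧ F ⊆ P ∧ IsLinked G E ∧ IsLinked G F ∧ a ∈ E ∧ c ∈ F ∧ b ∈ F ∧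
        Disjoint E F ∧ Touches G E {c} := by
  obtain ⟨P, ⟨hPS, hP, haP, hbP⟩, hmin⟩ := Set.Finite.exists_minimal
    (Set.toFinite {P : Set V | P ⊆ S ∧ IsLinked G P ∧ a ∈ P ∧ b ∈ P}) ⟨S, subset_rfl, hS, ha, hb⟩
  refine ⟨P, hPS, hP, haP, hbP, fun c hc hca => ?_⟩
  obtain ⟨E, hEP, haE, hE, hEc, hEt⟩ := hP.exists_component_touches
    (Set.singleton_subset_iff.2 hc) ⟨c, rfl⟩ (r := a) ⟨haP, hca.symm⟩
  have hcE : c ∉ E := fun h => (hEP h).2 rfl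
  by_cases hbc : b = c
  · exact ⟨E, {c}, hEP.trans Set.sdiff_subset, Set.singleton_subset_iff.2 hc, hE,
      isLinked_singleton c, haE, rfl, hbc, Set.disjoint_singleton_right.2 hcE, hEt⟩
  have hbE : b ∉ E := fun h =>
    hcE (hmin ⟨(hEP.trans Set.sdiff_subset).trans hPS, hE, haE, h⟩
      (hEP.trans Set.sdiff_subset) hc)
  obtain ⟨F, hFP, hbF, hF, -, hFt⟩ := hP.exists_component_touches
    (Set.singleton_subset_iff.2 hc) ⟨c, rfl⟩ (r := b) ⟨hbP, hbc⟩
  refine ⟨E, F ∪ {c}, hEP.trans Set.sdiff_subset,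
    Set.union_subset (hFP.trans Set.sdiff_subset) (Set.singleton_subset_iff.2 hc), hE,
    hF.union (isLinked_singleton c) hFt, haE, Or.inr rfl, Or.inl hbF, ?_, hEt⟩
  rw [Set.disjoint_union_right, Set.disjoint_singleton_right]
  exact ⟨Set.disjoint_left.2 fun x hxE hxF => hbE (hF.subset_of_closed hFP hEc hxF hxE hbF), hcE⟩

lemma IsLinked.hasSpider_three [Finite V] {S : Set V} (hS : IsLinked G S) {s : Fin 3 → V}
    (hs : ∀ i, s i ∈ S) : HasSpider G S s := by
  obtain ⟨P, hPS, hP, h0, h1, hcut⟩ := hS.exists_minimal_joining (hs 0) (hs 1)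
  obtain ⟨Q, hQS, hQ, h2, c, hcP, hcQ, hQP⟩ := hS.exists_first_hit hPS hP.1 (hs 2)
  obtain ⟨X, Y, hXP, hYP, hX, hY, hcX, hcY, h0X, h1Y, hXY⟩ : ∃ X Y, X ⊆ P ∧ Y ⊆ P ∧
      IsLinked G X ∧ IsLinked G Y ∧ c ∈ X ∧ c ∈ Y ∧ s 0 ∈ X ∧ s 1 ∈ Y ∧ X ∩ Y ⊆ {c} := by
    by_cases hc : c = s 0
    · exact ⟨{c}, P, Set.singleton_subset_iff.2 hcP, subset_rfl, isLinked_singleton c, hP, rfl,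
        hcP, hc.symm, h1, Set.inter_subset_left⟩
    obtain ⟨E, F, hEP, hFP, hE, hF, h0E, hcF, h1F, hEF, hEc⟩ := hcut c hcP hc
    refine ⟨E ∪ {c}, F, Set.union_subset hEP (Set.singleton_subset_iff.2 hcP), hFP,
      hE.union (isLinked_singleton c) hEc, hF, Or.inr rfl, hcF, Or.inl h0E, h1F, ?_⟩
    rintro x ⟨hx | hx, hxF⟩
    exacts [absurd hxF (hEF.notMem_of_mem_left hx), hx]
  have hXQ : X ∩ Q ⊆ {c} := fun x hx => hQP ⟨hx.2, hXP hx.1⟩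
  have hYQ : Y ∩ Q ⊆ {c} := fun x hx => hQP ⟨hx.2, hYP hx.1⟩
  refine ⟨c, hPS hcP, ![X, Y, Q], fun i => ?_, fun i j hij => ?_⟩
  · fin_cases i
    exacts [⟨hX, hXP.trans hPS, hcX, h0X⟩, ⟨hY, hYP.trans hPS, hcY, h1Y⟩, ⟨hQ, hQS, hcQ, h2⟩]
  · fin_cases i <;> fin_cases j <;> first | exact absurd rfl hij | skip
    exacts [hXY, hXQ, (Set.inter_comm _ _).trans_subset hXY, hYQ,
      (Set.inter_comm _ _).trans_subset hXQ, (Set.inter_comm _ _).trans_subset hYQ]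

/-- Four points of a linked set are the feet of a spider, or the set contains two disjoint
touching linked sets with two of the points in each. -/
lemma IsLinked.hasSpider_four_or [Finite V] {S : Set V} (hS : IsLinked G S) {s : Fin 4 → V}
    (hs : ∀ i, s i ∈ S) : HasSpider G S s ∨ ∃ B C, B ⊆ S ∧ C ⊆ S ∧ IsLinked G B ∧
      IsLinked G C ∧ Disjoint B C ∧ Touches G B C ∧ ∃ τ : Fin 4 → Fin 4, Function.Injective τ ∧
        s (τ 0) ∈ B ∧ s (τ 1) ∈ B ∧ s (τ 2) ∈ C ∧ s (τ 3) ∈ C := by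
  obtain ⟨c, hcS, L', hL', hLL'⟩ := hS.hasSpider_three (s := fun i => s i.castSucc) fun i => hs _
  choose L hLL hL hcL hsL hcut using fun i =>
    (hL' i).1.exists_minimal_joining (hL' i).2.2.1 (hL' i).2.2.2
  have hLS : ∀ i, L i ⊆ S := fun i => (hLL i).trans (hL' i).2.1
  have hLi : ∀ i j, i ≠ j → L i ∩ L j ⊆ {c} := fun i j hij =>
    (Set.inter_subset_inter (hLL i) (hLL j)).trans (hLL' i j hij)
  obtain ⟨Q, hQS, hQ, hsQ, c', hc', hcQ, hQL⟩ := hS.exists_first_hit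
    (Set.iUnion_subset hLS) ⟨c, Set.mem_iUnion.2 ⟨0, hcL 0⟩⟩ (hs (Fin.last 3))
  have hQi : ∀ i, Q ∩ L i ⊆ {c'} := fun i =>
    (Set.inter_subset_inter_right _ (Set.subset_iUnion L i)).trans hQL
  by_cases hcc : c' = c
  · subst hcc
    refine Or.inl ⟨c', hcS, Fin.snoc L Q, fun i => ?_, fun i j => ?_⟩
    · refine Fin.lastCases ?_ (fun i => ?_) i
      · simpa using ⟨hQ, hQS, hcQ, hsQ⟩
      · simpa using ⟨hL i, hLS i, hcL i, hsL i⟩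
    · refine Fin.lastCases ?_ (fun i => ?_) i <;> refine Fin.lastCases ?_ (fun j => ?_) j
      · simp
      · rw [Fin.snoc_last, Fin.snoc_castSucc]
        exact fun _ => hQi j
      · rw [Fin.snoc_last, Fin.snoc_castSucc, Set.inter_comm]
        exact fun _ => hQi i
      · simpa using hLi i j
  · right
    have split : ∀ i j k : Fin 3, i ≠ j → i ≠ k → j ≠ k → c' ∈ L i → ∃ B C, B ⊆ S ∧ C ⊆ S ∧
        IsLinked G B ∧ IsLinked G C ∧ Disjoint B C ∧ Touches G B C ∧ ∃ τ : Fin 4 → Fin 4,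
          Function.Injective τ ∧ s (τ 0) ∈ B ∧ s (τ 1) ∈ B ∧ s (τ 2) ∈ C ∧ s (τ 3) ∈ C := by
      intro i j k hij hik hjk hi
      obtain ⟨E, F, hEL, hFL, hE, hF, hcE, hcF, hsF, hEF, hEc⟩ := hcut i c' hi hcc
      have hτ : ∀ i j k : Fin 3, i ≠ j → i ≠ k → j ≠ k →
          Function.Injective ![i.castSucc, Fin.last 3, j.castSucc, k.castSucc] := by decide
      have hcF' : c ∉ F := hEF.notMem_of_mem_left hcE
      have hcQ' : c ∉ Q := fun h => hcc (hQi i ⟨h, hcL i⟩).symm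
      have hEQ : Disjoint E Q := Set.disjoint_left.2 fun x hxE hxQ =>
        hEF.notMem_of_mem_left hxE ((hQi i ⟨hxQ, hEL hxE⟩ : x = c') ▸ hcF)
      have hLj : ∀ j, i ≠ j → Disjoint (F ∪ Q) (L j) := by
        intro j hij
        refine Set.disjoint_left.2 ?_
        rintro x (hx | hx) hxj
        · exact hcF' ((hLi i j hij ⟨hFL hx, hxj⟩ : x = c) ▸ hx)
        · have hxc : x = c' := hQi j ⟨hx, hxj⟩
          exact hcc (hLi i j hij ⟨hi, hxc ▸ hxj⟩)
      refine ⟨F ∪ Q, (E ∪ L j) ∪ L k, Set.union_subset (hFL.trans (hLS i)) hQS,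
        Set.union_subset (Set.union_subset (hEL.trans (hLS i)) (hLS j)) (hLS k), ?_, ?_, ?_, ?_,
        _, hτ i j k hij hik hjk, Or.inl hsF, Or.inr hsQ, Or.inl (Or.inr (hsL j)),
        Or.inr (hsL k)⟩
      · exact hF.union_of_mem hQ hcF hcQ
      · exact (hE.union_of_mem (hL j) hcE (hcL j)).union_of_mem (hL k) (Or.inl hcE) (hcL k)
      · rw [Set.disjoint_union_right, Set.disjoint_union_right]
        exact ⟨⟨Set.disjoint_union_left.2 ⟨hEF.symm, hEQ.symm⟩, hLj j hij⟩, hLj k hik⟩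
      · exact hEc.symm.mono le_rfl (by simp [hcF]) fun x hx => Or.inl (Or.inl hx)
    obtain ⟨i, hi⟩ := Set.mem_iUnion.1 hc'
    fin_cases i
    · exact split 0 1 2 (by decide) (by decide) (by decide) hi
    · exact split 1 0 2 (by decide) (by decide) (by decide) hi
    · exact split 2 0 1 (by decide) (by decide) (by decide) hi

lemma containsSubdivision_of_hasSpider {H : SimpleGraph W} {φ : W → Set V}
    (hφ : ∀ a b, a ≠ b → Disjoint (φ a) (φ b)) {u : W → W → V}
    (hu : ∀ a b, H.Adj a b → G.Adj (u a b) (u b a))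
    (h : ∀ a, HasSpider G (φ a) fun b : {b // H.Adj a b} => u a b) :
    ContainsSubdivision H G := by
  choose c hc L hL hLL using h
  have hφ' : ∀ {a b x}, x ∈ φ a → x ∈ φ b → a = b := fun {a b x} ha hb => by
    by_contra hab
    exact (hφ a b hab).notMem_of_mem_left ha hb
  have hp : ∀ a b (hab : H.Adj a b), ∃ p : G.Walk (c a) (c b), p.IsPath ∧
      ∀ x ∈ p.support, x ∈ L a ⟨b, hab⟩ ∪ L b ⟨a, hab.symm⟩ := by
    intro a b hab
    exact ((hL a ⟨b, hab⟩).1.union (hL b ⟨a, hab.symm⟩).1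
      ⟨_, (hL a ⟨b, hab⟩).2.2.2, _, (hL b ⟨a, hab.symm⟩).2.2.2, hu a b hab⟩).exists_isPath
      (Or.inl (hL a ⟨b, hab⟩).2.2.1) (Or.inr (hL b ⟨a, hab.symm⟩).2.2.1)
  choose p hpp hps using hp
  have hinj : Function.Injective c := fun a b hab => hφ' (hc a) (hab ▸ hc b)
  refine ⟨⟨c, hinj⟩, p, hpp, ?_, ?_⟩
  · intro a b hab w hw
    rcases hps a b hab _ hw with hw | hw
    · exact Or.inl (hφ' (hc w) ((hL a ⟨b, hab⟩).2.1 hw))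
    · exact Or.inr (hφ' (hc w) ((hL b ⟨a, hab.symm⟩).2.1 hw))
  · intro a b a' b' hab hab' hne x hx hx'
    have key : ∀ a b a' b' (hab : H.Adj a b) (hab' : H.Adj a' b'), s(a, b) ≠ s(a', b') →
        x ∈ L a ⟨b, hab⟩ → x ∈ L a' ⟨b', hab'⟩ → x = c a ∧ x = c a' := by
      intro a b a' b' hab hab' hne hx hx'
      obtain rfl := hφ' ((hL a ⟨b, hab⟩).2.1 hx) ((hL a' ⟨b', hab'⟩).2.1 hx')
      have : x = c a := hLL a ⟨b, hab⟩ ⟨b', hab'⟩ (fun e => hne (by simp_all)) ⟨hx, hx'⟩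
      exact ⟨this, this⟩
    change (x = c a ∨ x = c b) ∧ (x = c a' ∨ x = c b')
    rcases hps a b hab _ hx with hx | hx <;> rcases hps a' b' hab' _ hx' with hx' | hx'
    · have := key a b a' b' hab hab' hne hx hx'
      tauto
    · have := key a b b' a' hab hab'.symm (by rwa [Sym2.eq_swap (a := b')]) hx hx'
      tauto
    · have := key b a a' b' hab.symm hab' (by rwa [Sym2.eq_swap (a := b)]) hx hx'
      tauto
    · have := key b a b' a' hab.symm hab'.symm
        (by rwa [Sym2.eq_swap (a := b), Sym2.eq_swap (a := b')]) hx hx'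
      tauto

lemma HasMinor.exists_contacts {H : SimpleGraph W} {A : Set V} (h : HasMinor H G A) :
    ∃ (φ : W → Set V) (u : W → W → V), (∀ w, IsLinked G (φ w)) ∧
      (∀ a b, a ≠ b → Disjoint (φ a) (φ b)) ∧ (∀ a b, H.Adj a b → u a b ∈ φ a) ∧
      ∀ a b, H.Adj a b → G.Adj (u a b) (u b a) := by
  classical
  obtain ⟨φ, -, h2, h3, h4⟩ := h
  have h5 : ∀ e : H.edgeSet, ∃ g : W → V, ∀ a b, e.1 = s(a, b) → g a ∈ φ a ∧ G.Adj (g a) (g b) := by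
    rintro ⟨e, he⟩
    induction e using Sym2.ind with
    | _ a b =>
    obtain ⟨x, hx, y, hy, hxy⟩ := h4 a b he
    have hab : a ≠ b := Adj.ne (G := H) he
    refine ⟨fun w => if w = a then x else y, fun a' b' hab' => ?_⟩
    rcases Sym2.eq_iff.1 hab' with ⟨rfl, rfl⟩ | ⟨rfl, rfl⟩
    · simp [hab.symm, hx, hxy]
    · simp [hab.symm, hy, hxy.symm]
  choose g hg using h5
  refine ⟨φ, fun a b => if hab : H.Adj a b then g ⟨s(a, b), hab⟩ a else (h2 a).1.some, h2, h3,
    fun a b hab => ?_, fun a b hab => ?_⟩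
  · simpa [hab] using (hg ⟨s(a, b), hab⟩ a b rfl).1
  · have := (hg ⟨s(a, b), hab⟩ a b rfl).2
    simp only [hab, hab.symm, dif_pos]
    convert this using 3
    exact Subtype.ext Sym2.eq_swap

lemma HasMinor.containsSubdivision_K33 [Finite V] {A : Set V}
    (h : HasMinor (completeBipartiteGraph (Fin 3) (Fin 3)) G A) :
    ContainsSubdivision (completeBipartiteGraph (Fin 3) (Fin 3)) G := by
  obtain ⟨φ, u, h1, h2, h3, h4⟩ := h.exists_contacts
  refine containsSubdivision_of_hasSpider h2 h4 ?_
  rintro (i | i)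
  · refine HasSpider.of_surjective (g := fun j : Fin 3 => ⟨Sum.inr j, by simp⟩) ?_
      ((h1 _).hasSpider_three fun j => h3 _ _ (by simp))
    rintro ⟨j | j, hj⟩
    · simp at hj
    · exact ⟨j, rfl⟩
  · refine HasSpider.of_surjective (g := fun j : Fin 3 => ⟨Sum.inl j, by simp⟩) ?_
      ((h1 _).hasSpider_three fun j => h3 _ _ (by simp))
    rintro ⟨j | j, hj⟩
    · exact ⟨j, rfl⟩
    · simp at hj

lemma HasMinor.containsSubdivision_K5_or [Finite V] {A : Set V}
    (h : HasMinor (completeGraph (Fin 5)) G A) :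
    ContainsSubdivision (completeGraph (Fin 5)) G ∨
      HasMinor (completeBipartiteGraph (Fin 3) (Fin 3)) G Set.univ := by
  obtain ⟨φ, u, h1, h2, h3, h4⟩ := h.exists_contacts
  by_cases hsp : ∀ a, HasSpider G (φ a) fun i : Fin 4 => u a (a.succAbove i)
  · refine Or.inl (containsSubdivision_of_hasSpider h2 h4 fun a => ?_)
    refine HasSpider.of_surjective (g := fun i : Fin 4 =>
      ⟨a.succAbove i, (Fin.succAbove_ne a i).symm⟩) ?_ (hsp a)
    rintro ⟨b, hb⟩
    obtain ⟨i, hi⟩ := Fin.exists_succAbove_eq (Ne.symm hb)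
    exact ⟨i, Subtype.ext hi⟩
  · right
    push Not at hsp
    obtain ⟨a, ha⟩ := hsp
    have hadj : ∀ i, (completeGraph (Fin 5)).Adj a (a.succAbove i) := fun i =>
      (Fin.succAbove_ne a i).symm
    obtain ⟨B, C, hB, hC, hBl, hCl, hBC, hBCt, τ, hτ, t0, t1, t2, t3⟩ :=
      ((h1 a).hasSpider_four_or fun i => h3 _ _ (hadj i)).resolve_left ha
    set ψ : Fin 4 → Set V := fun i => φ (a.succAbove (τ i)) with hψ
    have hψne : ∀ i j, i ≠ j → a.succAbove (τ i) ≠ a.succAbove (τ j) := fun i j hij e =>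
      hij (hτ (Fin.succAbove_right_injective e))
    have hψd : ∀ i j, i ≠ j → Disjoint (ψ i) (ψ j) := fun i j hij => h2 _ _ (hψne i j hij)
    have hψt : ∀ i j, i ≠ j → Touches G (ψ i) (ψ j) := fun i j hij =>
      ⟨_, h3 _ _ (hψne i j hij), _, h3 _ _ (hψne i j hij).symm, h4 _ _ (hψne i j hij)⟩
    have hψa : ∀ i, Disjoint (φ a) (ψ i) := fun i => h2 _ _ (hadj _).ne
    have htt : ∀ {D : Set V} i, u a (a.succAbove (τ i)) ∈ D → Touches G D (ψ i) := fun i hi =>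
      ⟨_, hi, _, h3 _ _ (hadj _).symm, h4 _ _ (hadj _)⟩
    refine hasMinor_K33 ![B, ψ 2, ψ 3] ![C, ψ 0, ψ 1] (fun i => Set.subset_univ _)
      (fun i => Set.subset_univ _) ?_ ?_ ?_ ?_ ?_ ?_
    · intro i; fin_cases i
      exacts [hBl, h1 _, h1 _]
    · intro i; fin_cases i
      exacts [hCl, h1 _, h1 _]
    · intro i j hij
      fin_cases i <;> fin_cases j <;> simp at hij
      exacts [(hψa 2).mono_left hB, (hψa 3).mono_left hB, hψd 2 3 (by decide)]
    · intro i j hij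
      fin_cases i <;> fin_cases j <;> simp at hij
      exacts [(hψa 0).mono_left hC, (hψa 1).mono_left hC, hψd 0 1 (by decide)]
    · intro i j
      fin_cases i <;> fin_cases j
      exacts [hBC, (hψa 0).mono_left hB, (hψa 1).mono_left hB, ((hψa 2).mono_left hC).symm,
        hψd 2 0 (by decide), hψd 2 1 (by decide), ((hψa 3).mono_left hC).symm,
        hψd 3 0 (by decide), hψd 3 1 (by decide)]
    · intro i j
      fin_cases i <;> fin_cases j
      exacts [hBCt, htt 0 t0, htt 1 t1, (htt 2 t2).symm, hψt 2 0 (by decide),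
        hψt 2 1 (by decide), (htt 3 t3).symm, hψt 3 0 (by decide), hψt 3 1 (by decide)]

theorem IsPlanar.kuratowskiMinorFree [Finite V] (h : IsPlanar G) :
    KuratowskiMinorFree G Set.univ :=
  ⟨fun h5 => h5.containsSubdivision_K5_or.elim h.1 fun h33 => h.2 h33.containsSubdivision_K33,
    fun h33 => h.2 h33.containsSubdivision_K33⟩

end Subdivisions

section Assembly

variable {V : Type*} {G : SimpleGraph V}

lemma diamondFree_of_not_containsInduced (h : ¬ ContainsInduced theta4 G) : DiamondFree G := by
  intro u v w w' huv huw hvw huw' hvw' hne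
  by_contra hww
  have hww' : ¬ G.Adj w' w := fun e => hww e.symm
  have hinj : Function.Injective ![w, w', u, v] := by
    intro i j hij
    have := huv.ne; have := huw.ne; have := hvw.ne; have := huw'.ne; have := hvw'.ne
    fin_cases i <;> fin_cases j <;> simp_all
  refine h ⟨Set.range ![w, w', u, v], ⟨Equiv.ofInjective _ hinj, ?_⟩⟩
  intro i j
  simp only [comap_adj, Function.Embedding.subtype_apply, Equiv.ofInjective_apply, theta4,
    deleteEdges_adj, Set.mem_singleton_iff]
  fin_cases i <;> fin_cases j <;>
    simp [huv, huw, hvw, huw', hvw', hww, hww', huv.symm, huw.symm, hvw.symm, huw'.symm,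
      hvw'.symm]

lemma ncard_edgeSet_eq_cliqueCount [Fintype V] :
    G.edgeSet.ncard = cliqueCount G Finset.univ 2 := by
  classical
  have h1 := G.sum_degrees_eq_twice_card_edges
  have h2 := sum_cliqueCount_neighbors (G := G) Finset.univ 1
  simp only [cliqueCount_one] at h2
  simp only [← card_neighborFinset_eq_degree, neighborFinset_eq_filter] at h1
  rw [← coe_edgeFinset, Set.ncard_coe_finset]
  have h3 : 2 * G.edgeFinset.card = 2 * cliqueCount G Finset.univ 2 := by
    rw [← h1, h2.symm]
  omega

end Assembly

theorem stmt_0 (n : ℕ) (hn : 5 ≤ n) (G : SimpleGraph (Fin n))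
    (hP : IsPlanar G) (hF : ¬ ContainsInduced theta4 G) :
    3 * G.edgeSet.ncard ≤ 8 * (n - 2) := by
  have hD := diamondFree_of_not_containsInduced hF
  have hcard : (Finset.univ : Finset (Fin n)).card = n := by simp
  have h1 := hD.edge_bound hP.kuratowskiMinorFree (A := Finset.univ) (by omega) (by omega)
  have h2 := hD.two_mul_cliqueCount_three_le Finset.univ
  rw [ncard_edgeSet_eq_cliqueCount]
  omega
end

section
/- For every positive integer n with n ≡ 20 (mod 36), there exists a planar graph on n vertices that contains no induced copy of Θ_4 and has exactly 8(n−2)/3 edges. -/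
open SimpleGraph

/-- The mod 2 boundary of a 1-chain `z` of the multigraph with edges `e` joining `src e` and
`dst e`. -/
def boundary {V E : Type*} [DecidableEq V] [Fintype E] (src dst : E → V) (z : E → ZMod 2)
    (v : V) : ZMod 2 :=
  ∑ e, z e * ((if src e = v then 1 else 0) + if dst e = v then 1 else 0)

/-- A combinatorial planarity certificate (a 2-basis in the sense of Mac Lane): a simple graph
given by its list of edges, each edge `e` separating two faces `left e` and `right e`, such that
the mod 2 cycles are exactly the boundaries of sets of faces. -/
structure IsSphereMap {V E F : Type*} [DecidableEq V] [Fintype E] (src dst : E → V)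
    (left right : E → F) : Prop where
  injective : Function.Injective fun e => s(src e, dst e)
  ne : ∀ e, src e ≠ dst e
  exists_primitive : ∀ z : E → ZMod 2, boundary src dst z = 0 → ∃ t : F → ZMod 2,
    ∀ e, t (left e) + t (right e) = z e
  closed : ∀ t : F → ZMod 2, boundary src dst (fun e => t (left e) + t (right e)) = 0

section Subdivision

variable {V E F : Type*} {src dst : E → V}

/-- The simple graph with the given list of edges. -/
def graphOfEdges (src dst : E → V) : SimpleGraph V :=
  SimpleGraph.fromEdgeSet (Set.range fun e => s(src e, dst e))

lemma exists_of_adj {u v : V} (h : (graphOfEdges src dst).Adj u v) :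
    ∃ e, s(src e, dst e) = s(u, v) := by
  simpa [graphOfEdges] using h.1

variable [DecidableEq V]

lemma incidence_eq_zero {e : E} {v : V} (h : v ∉ s(src e, dst e)) :
    ((if src e = v then 1 else 0) + if dst e = v then 1 else 0 : ZMod 2) = 0 := by
  rw [Sym2.mem_iff, not_or] at h
  simp [Ne.symm h.1, Ne.symm h.2]

lemma incidence_eq {e : E} {u w : V} (h : s(src e, dst e) = s(u, w)) (v : V) :
    ((if src e = v then 1 else 0) + if dst e = v then 1 else 0 : ZMod 2) =
      (if u = v then 1 else 0) + if w = v then 1 else 0 := by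
  rcases Sym2.eq_iff.1 h with ⟨h₁, h₂⟩ | ⟨h₁, h₂⟩
  · rw [h₁, h₂]
  · rw [h₁, h₂, add_comm]

variable [Fintype E]

lemma boundary_walk (hinj : Function.Injective fun e => s(src e, dst e)) {u w : V}
    (p : (graphOfEdges src dst).Walk u w) (v : V) :
    boundary src dst (fun e => (p.edges.count s(src e, dst e) : ZMod 2)) v =
      (if u = v then 1 else 0) + if w = v then 1 else 0 := by
  classical
  induction p with
  | nil => simp [boundary, CharTwo.add_self_eq_zero]
  | @cons a b c h q ih =>
    obtain ⟨e₀, he₀⟩ := exists_of_adj h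
    have key : ∀ e, ((q.cons h).edges.count s(src e, dst e) : ZMod 2) =
        (q.edges.count s(src e, dst e) : ZMod 2) + if e = e₀ then 1 else 0 := by
      intro e
      rw [SimpleGraph.Walk.edges_cons, List.count_cons, ← he₀]
      by_cases hee : e = e₀
      · simp [hee]
      · have : s(src e₀, dst e₀) ≠ s(src e, dst e) := fun h' => hee (hinj h').symm
        simp [hee, this]
    unfold boundary at ih ⊢
    simp only [key, add_mul, Finset.sum_add_distrib, ih, ite_mul, one_mul, zero_mul,
      Finset.sum_ite_eq', Finset.mem_univ, if_true]
    rw [incidence_eq he₀]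
    linear_combination CharTwo.add_self_eq_zero (if b = v then 1 else 0 : ZMod 2)

lemma exists_const_on_path (hinj : Function.Injective fun e => s(src e, dst e))
    {D : E → ZMod 2} {u w : V} (p : (graphOfEdges src dst).Walk u w) (hp : p.IsPath)
    (hbd : ∀ v ∈ p.support, v ≠ u → v ≠ w → boundary src dst D v = 0)
    (hsupp : ∀ v ∈ p.support, v ≠ u → v ≠ w → ∀ e, v ∈ s(src e, dst e) → D e ≠ 0 →
      s(src e, dst e) ∈ p.edges) :
    ∃ t, ∀ e, s(src e, dst e) ∈ p.edges → D e = t := by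
  induction p with
  | nil => exact ⟨0, by simp⟩
  | @cons a b c h q ih =>
    obtain ⟨e₀, he₀⟩ := exists_of_adj h
    have hq := hp.of_cons
    have ha : a ∉ q.support := ((SimpleGraph.Walk.cons_isPath_iff h q).1 hp).2
    obtain ⟨t, ht⟩ := ih hq
      (fun v hv hvb hvc => hbd v (by simp [hv]) (by rintro rfl; exact ha hv) hvc)
      (fun v hv hvb hvc e hve hD => by
        have hva : v ≠ a := by rintro rfl; exact ha hv
        have := hsupp v (by simp [hv]) hva hvc e hve hD
        rw [SimpleGraph.Walk.edges_cons, List.mem_cons] at this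
        refine this.resolve_left fun h' => ?_
        rw [h', Sym2.mem_iff] at hve
        exact hve.elim hva hvb)
    have first : ∀ e, s(src e, dst e) = s(a, b) → e = e₀ := fun e he =>
      hinj (he.trans he₀.symm)
    cases q with
    | nil =>
      refine ⟨D e₀, fun e he => ?_⟩
      simp at he
      rw [first e (by simpa using he)]
    | @cons _ b' _ h' q' =>
      obtain ⟨e₁, he₁⟩ := exists_of_adj h'
      have hb : b ∉ q'.support := ((SimpleGraph.Walk.cons_isPath_iff h' q').1 hq).2
      have hba : b ≠ a := fun h => ha (by simp [h])
      have hbc : b ≠ c := fun h => hb (by simp [h])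
      have hab' : a ≠ b' := fun h => ha (by simp [h])
      have hne : e₀ ≠ e₁ := by
        rintro rfl
        rw [he₀, Sym2.eq_iff] at he₁
        rcases he₁ with ⟨h, -⟩ | ⟨h, -⟩
        · exact hba h.symm
        · exact hab' h
      have hsum := hbd b (by simp) hba hbc
      unfold boundary at hsum
      rw [Fintype.sum_eq_add e₀ e₁ hne, incidence_eq he₀, incidence_eq he₁] at hsum
      · simp only [hba.symm, h'.ne.symm, if_true, if_false, zero_add, add_zero, mul_one] at hsum
        refine ⟨t, fun e he => ?_⟩
        rw [SimpleGraph.Walk.edges_cons, List.mem_cons] at he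
        rcases he with he | he
        · rw [first e he, ← ht e₁ (by rw [he₁]; simp)]
          exact CharTwo.add_eq_zero.1 hsum
        · exact ht e he
      · rintro e ⟨hne₀, hne₁⟩
        by_cases hbe : b ∈ s(src e, dst e)
        · by_cases hD : D e = 0
          · simp [hD]
          · exfalso
            have := hsupp b (by simp) hba hbc e hbe hD
            simp only [SimpleGraph.Walk.edges_cons, List.mem_cons] at this
            rcases this with h₁ | h₁ | h₁
            · exact hne₀ (first e h₁)
            · exact hne₁ (hinj (h₁.trans he₁.symm))
            · exact hb (q'.mem_support_of_mem_edges h₁ hbe)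
        · rw [incidence_eq_zero hbe, mul_zero]

/-- If a graph on the sphere contains a subdivision of a graph with edges `a i`, `b i` all of whose
nonzero cycles have length at least `m`, then its number of cycles is bounded in terms of the number
`k` of regions, and `k` is bounded by double counting the incidences of edges and regions. -/
theorem IsSphereMap.exists_card_cycles_le {left right : E → F}
    (hM : IsSphereMap src dst left right) {W ι : Type*} [DecidableEq W] [Fintype ι]
    {H : SimpleGraph W} {a b : ι → W} (hadj : ∀ i, H.Adj (a i) (b i))
    (hab : Function.Injective fun i => s(a i, b i)) {m : ℕ}
    (hm : ∀ c : ι → ZMod 2, boundary a b c = 0 → c ≠ 0 →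
      m ≤ (Finset.univ.filter fun i => c i ≠ 0).card)
    (hZ : ∃ c : ι → ZMod 2, boundary a b c = 0 ∧ c ≠ 0)
    (hH : ContainsSubdivision H (graphOfEdges src dst)) :
    ∃ k, m * k ≤ 2 * Fintype.card ι ∧
      2 * Nat.card {c : ι → ZMod 2 // boundary a b c = 0} ≤ 2 ^ k := by
  classical
  obtain ⟨f, p, hpath, hbranch, hdisj⟩ := hH
  set P := fun i => p (hadj i) with hP
  set chain : ι → E → ZMod 2 := fun i e => ((P i).edges.count s(src e, dst e) : ZMod 2)
    with hchain
  have chain_mem : ∀ i e, s(src e, dst e) ∈ (P i).edges → chain i e = 1 := fun i e h => by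
    simp only [hchain]
    rw [List.count_eq_one_of_mem (hpath (hadj i)).isTrail.edges_nodup h, Nat.cast_one]
  have chain_notMem : ∀ i e, s(src e, dst e) ∉ (P i).edges → chain i e = 0 := fun i e h => by
    simp only [hchain]
    rw [List.count_eq_zero_of_not_mem h, Nat.cast_zero]
  have shared : ∀ i j, i ≠ j → ∀ x ∈ (P i).support, x ∈ (P j).support →
      (x = f (a i) ∨ x = f (b i)) ∧ (x = f (a j) ∨ x = f (b j)) := fun i j hij x hi hj =>
    hdisj (hadj i) (hadj j) (fun h => hij (hab h)) x hi hj
  have unique : ∀ i j e, s(src e, dst e) ∈ (P i).edges → s(src e, dst e) ∈ (P j).edges →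
      i = j := by
    intro i j e hi hj
    by_contra hij
    have h₁ := shared i j hij _ ((P i).fst_mem_support_of_mem_edges hi)
      ((P j).fst_mem_support_of_mem_edges hj)
    have h₂ := shared i j hij _ ((P i).snd_mem_support_of_mem_edges hi)
      ((P j).snd_mem_support_of_mem_edges hj)
    have hne := hM.ne e
    have hi' : s(src e, dst e) = s(f (a i), f (b i)) := by
      rw [Sym2.eq_iff]; grind
    have hj' : s(src e, dst e) = s(f (a j), f (b j)) := by
      rw [Sym2.eq_iff]; grind
    refine hij (hab ?_)
    have h := hi'.symm.trans hj'
    simpa [Sym2.eq_iff] using h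
  -- every path contains an edge
  have hedge : ∀ i, ∃ e, s(src e, dst e) ∈ (P i).edges := by
    intro i
    have hne : f (a i) ≠ f (b i) := fun h => (hadj i).ne (f.injective h)
    obtain ⟨x, h, q, hq⟩ := SimpleGraph.Walk.exists_eq_cons_of_ne hne (P i)
    obtain ⟨e, he⟩ := exists_of_adj h
    exact ⟨e, by simp [hq, he]⟩
  choose e₀ he₀ using hedge
  -- chains of the abstract graph lift to the subdivision
  set lift : (ι → ZMod 2) → E → ZMod 2 := fun c e => ∑ i, c i * chain i e with hlift
  have lift_mem : ∀ c i e, s(src e, dst e) ∈ (P i).edges → lift c e = c i := by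
    intro c i e h
    simp only [hlift]
    rw [Fintype.sum_eq_single i, chain_mem i e h, mul_one]
    intro j hj
    rw [chain_notMem j e fun h' => hj (unique j i e h' h), mul_zero]
  have lift_notMem : ∀ c e, (∀ i, s(src e, dst e) ∉ (P i).edges) → lift c e = 0 := fun c e h =>
    Finset.sum_eq_zero fun i _ => by rw [chain_notMem i e (h i), mul_zero]
  have boundary_lift : ∀ c v, boundary src dst (lift c) v =
      ∑ i, c i * ((if f (a i) = v then 1 else 0) + if f (b i) = v then 1 else 0) := by
    intro c v
    simp only [← boundary_walk hM.injective (P _) v]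
    simp only [boundary, hlift, hchain, Finset.sum_mul, Finset.mul_sum, mul_assoc]
    exact Finset.sum_comm
  have boundary_lift_apply : ∀ c w, boundary src dst (lift c) (f w) = boundary a b c w := by
    intro c w
    rw [boundary_lift]
    simp only [f.injective.eq_iff, boundary]
  have lift_cycle : ∀ c, boundary a b c = 0 → boundary src dst (lift c) = 0 := by
    intro c hc
    funext v
    by_cases hv : ∃ w, f w = v
    · obtain ⟨w, rfl⟩ := hv
      rw [boundary_lift_apply, hc]; rfl
    · push Not at hv
      rw [boundary_lift]
      simp [hv]
  -- regions are the classes of faces not separated by any cycle of the subdivision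
  let Z := {c : ι → ZMod 2 // boundary a b c = 0}
  choose t ht using fun c : Z => hM.exists_primitive (lift c.1) (lift_cycle c.1 c.2)
  set Φ : F → Z → ZMod 2 := fun x c => t c x with hΦ
  set D : (Z → ZMod 2) → E → ZMod 2 := fun x e =>
    (if Φ (left e) = x then 1 else 0) + if Φ (right e) = x then 1 else 0 with hD
  have D_closed : ∀ x, boundary src dst (D x) = 0 := fun x =>
    hM.closed fun y => if Φ y = x then 1 else 0
  have D_supp : ∀ x e, D x e ≠ 0 → ∃ i, s(src e, dst e) ∈ (P i).edges := by
    intro x e h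
    by_contra! hcon
    have : Φ (left e) = Φ (right e) := by
      funext c
      exact CharTwo.add_eq_zero.1 ((ht c e).trans (lift_notMem _ e hcon))
    exact h (by simp only [hD, this, CharTwo.add_self_eq_zero])
  have D_const : ∀ x i, ∃ s, ∀ e, s(src e, dst e) ∈ (P i).edges → D x e = s := by
    intro x i
    refine exists_const_on_path hM.injective (P i) (hpath (hadj i))
      (fun v _ _ _ => congrFun (D_closed x) v) ?_
    intro v hv hva hvb e hve hDe
    obtain ⟨j, hj⟩ := D_supp x e hDe
    by_cases hij : i = j
    · rwa [hij]
    · exact absurd (shared i j hij v hv ((P j).mem_support_of_mem_edges hj hve)).1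
        (by simp [hva, hvb])
  choose d hd using D_const
  have D_eq : ∀ x, D x = lift (d x) := by
    intro x
    funext e
    by_cases h : ∃ i, s(src e, dst e) ∈ (P i).edges
    · obtain ⟨i, hi⟩ := h
      rw [hd x i e hi, lift_mem _ i e hi]
    · push Not at h
      rw [lift_notMem _ e h]
      by_contra hDe
      obtain ⟨i, hi⟩ := D_supp x e hDe
      exact h i hi
  have d_cycle : ∀ x, boundary a b (d x) = 0 := by
    intro x
    funext w
    rw [← boundary_lift_apply, ← D_eq, D_closed]; rfl
  have d_eq : ∀ x i, d x i = (if Φ (left (e₀ i)) = x then 1 else 0) +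
      if Φ (right (e₀ i)) = x then 1 else 0 := fun x i => (hd x i _ (he₀ i)).symm
  have sum_d : ∀ (c : Z) (ε : ZMod 2) i, ∑ x, (x c + ε) * d x i = c.1 i := by
    intro c ε i
    have single : ∀ y : Z → ZMod 2, ∑ x, (x c + ε) * (if y = x then 1 else 0) = y c + ε := by
      intro y
      rw [Fintype.sum_eq_single y fun x hx => by rw [if_neg hx.symm, mul_zero], if_pos rfl,
        mul_one]
    have := ht c (e₀ i)
    rw [lift_mem _ i _ (he₀ i)] at this
    simp only [d_eq, mul_add, Finset.sum_add_distrib, single]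
    simp only [hΦ]
    linear_combination this + CharTwo.add_self_eq_zero ε
  set N := Finset.univ.filter fun x => d x ≠ 0 with hN
  have sum_N : ∀ (c : Z) (ε : ZMod 2) i, ∑ x : N, (x.1 c + ε) * d x.1 i = c.1 i := by
    intro c ε i
    rw [← sum_d c ε i, Finset.sum_coe_sort N fun x => (x c + ε) * d x i]
    refine Finset.sum_subset (Finset.subset_univ _) fun x _ hx => ?_
    have : d x = 0 := by simpa [hN] using hx
    simp [this]
  refine ⟨N.card, ?_, ?_⟩
  · calc m * N.card = ∑ x ∈ N, m := by rw [Finset.sum_const, smul_eq_mul, mul_comm]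
      _ ≤ ∑ x ∈ N, (Finset.univ.filter fun i => d x i ≠ 0).card :=
        Finset.sum_le_sum fun x hx => hm (d x) (d_cycle x) (by simpa [hN] using hx)
      _ = ∑ i, (N.filter fun x => d x i ≠ 0).card :=
        Finset.sum_card_bipartiteAbove_eq_sum_card_bipartiteBelow fun x i => d x i ≠ 0
      _ ≤ ∑ _i : ι, 2 := by
        refine Finset.sum_le_sum fun i _ => ?_
        refine (Finset.card_le_card (t := {Φ (left (e₀ i)), Φ (right (e₀ i))}) ?_).trans
          Finset.card_le_two
        intro x hx
        have hx := (Finset.mem_filter.1 hx).2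
        by_contra hcon
        simp only [Finset.mem_insert, Finset.mem_singleton, not_or] at hcon
        exact hx (by rw [d_eq, if_neg (Ne.symm hcon.1), if_neg (Ne.symm hcon.2), add_zero])
      _ = 2 * Fintype.card ι := by simp [mul_comm]
  · obtain ⟨c₀, hc₀, hne⟩ := hZ
    have hN' : Nonempty N := by
      by_contra hcon
      rw [not_nonempty_iff] at hcon
      refine hne (funext fun i => ?_)
      simpa using (sum_N ⟨c₀, hc₀⟩ 0 i).symm
    have hinj : Function.Injective fun (q : Z × ZMod 2) (x : N) => x.1 q.1 + q.2 := by
      rintro ⟨c, ε⟩ ⟨c', ε'⟩ h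
      have hc : c = c' := by
        refine Subtype.ext (funext fun i => ?_)
        rw [← sum_N c ε i, ← sum_N c' ε' i]
        exact Finset.sum_congr rfl fun x _ => by rw [show x.1 c + ε = x.1 c' + ε' from congrFun h x]
      subst hc
      obtain ⟨x⟩ := hN'
      exact Prod.ext rfl (add_left_cancel (congrFun h x))
    have := Fintype.card_le_of_injective _ hinj
    rw [Fintype.card_prod, Fintype.card_fun, ZMod.card, Fintype.card_coe, mul_comm] at this
    rwa [Nat.card_eq_fintype_card]

end Subdivision

lemma IsSphereMap.not_containsSubdivision_completeBipartite {V E F : Type*} [DecidableEq V]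
    [Fintype E] {src dst : E → V} {left right : E → F} (hM : IsSphereMap src dst left right) :
    ¬ ContainsSubdivision (completeBipartiteGraph (Fin 3) (Fin 3)) (graphOfEdges src dst) := by
  intro hH
  let a : Fin 9 → Fin 3 ⊕ Fin 3 := ![.inl 0, .inl 0, .inl 0, .inl 1, .inl 1, .inl 1,
    .inl 2, .inl 2, .inl 2]
  let b : Fin 9 → Fin 3 ⊕ Fin 3 := ![.inr 0, .inr 1, .inr 2, .inr 0, .inr 1, .inr 2,
    .inr 0, .inr 1, .inr 2]
  have hcard : Nat.card {c : Fin 9 → ZMod 2 // boundary a b c = 0} = 16 := by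
    rw [Nat.card_eq_fintype_card]
    decide +kernel
  obtain ⟨k, hk, hk'⟩ := hM.exists_card_cycles_le (a := a) (b := b) (m := 4)
    (by simp [a, b, Fin.forall_fin_succ]) (by decide +kernel) (by decide +kernel)
    (by decide +kernel) hH
  rw [hcard] at hk'
  rw [Fintype.card_fin] at hk
  have : 2 ^ k ≤ 2 ^ 4 := Nat.pow_le_pow_right (by norm_num) (by omega)
  omega

lemma IsSphereMap.not_containsSubdivision_complete {V E F : Type*} [DecidableEq V]
    [Fintype E] {src dst : E → V} {left right : E → F} (hM : IsSphereMap src dst left right) :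
    ¬ ContainsSubdivision (completeGraph (Fin 5)) (graphOfEdges src dst) := by
  intro hH
  let a : Fin 10 → Fin 5 := ![0, 0, 0, 0, 1, 1, 1, 2, 2, 3]
  let b : Fin 10 → Fin 5 := ![1, 2, 3, 4, 2, 3, 4, 3, 4, 4]
  have hcard : Nat.card {c : Fin 10 → ZMod 2 // boundary a b c = 0} = 64 := by
    rw [Nat.card_eq_fintype_card]
    decide +kernel
  obtain ⟨k, hk, hk'⟩ := hM.exists_card_cycles_le (a := a) (b := b) (m := 3)
    (by decide +kernel) (by decide +kernel) (by decide +kernel) (by decide +kernel) hH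
  rw [hcard] at hk'
  rw [Fintype.card_fin] at hk
  have : 2 ^ k ≤ 2 ^ 6 := Nat.pow_le_pow_right (by norm_num) (by omega)
  omega

lemma IsSphereMap.isPlanar {V E F : Type*} [DecidableEq V] [Fintype E] {src dst : E → V}
    {left right : E → F} (hM : IsSphereMap src dst left right) :
    IsPlanar (graphOfEdges src dst) :=
  ⟨hM.not_containsSubdivision_complete, hM.not_containsSubdivision_completeBipartite⟩

lemma ContainsSubdivision.map_iso {W V V' : Type*} {H : SimpleGraph W} {G : SimpleGraph V}
    {G' : SimpleGraph V'} (φ : G ≃g G') (h : ContainsSubdivision H G) :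
    ContainsSubdivision H G' := by
  obtain ⟨f, p, hpath, hbranch, hdisj⟩ := h
  have hinj : Function.Injective φ.toHom := φ.injective
  refine ⟨⟨fun w => φ.toHom (f w), hinj.comp f.injective⟩, fun a b h => (p h).map φ.toHom,
    fun a b h => (SimpleGraph.Walk.isPath_map_iff_of_injective hinj).2 (hpath h), ?_, ?_⟩
  · intro a b h w hw
    replace hw : φ.toHom (f w) ∈ ((p h).map φ.toHom).support := hw
    rw [SimpleGraph.Walk.support_map, List.mem_map] at hw
    obtain ⟨x, hx, hxw⟩ := hw
    exact hbranch h w (hinj hxw ▸ hx)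
  · intro a b c d h₁ h₂ hne x hx₁ hx₂
    replace hx₁ : x ∈ ((p h₁).map φ.toHom).support := hx₁
    replace hx₂ : x ∈ ((p h₂).map φ.toHom).support := hx₂
    rw [SimpleGraph.Walk.support_map, List.mem_map] at hx₁ hx₂
    obtain ⟨y, hy, rfl⟩ := hx₁
    obtain ⟨y', hy', hyy⟩ := hx₂
    obtain rfl := hinj hyy
    have := hdisj h₁ h₂ hne y' hy hy'
    exact ⟨this.1.imp (congrArg φ) (congrArg φ), this.2.imp (congrArg φ) (congrArg φ)⟩

lemma IsPlanar.map_iso {V V' : Type*} {G : SimpleGraph V} {G' : SimpleGraph V'} (φ : G ≃g G')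
    (h : IsPlanar G) : IsPlanar G' :=
  ⟨fun h' => h.1 (h'.map_iso φ.symm), fun h' => h.2 (h'.map_iso φ.symm)⟩

/-- Start points of the edges of a block: the cuboctahedron with a vertex inserted in each triangle.
The vertices `Sum.inl 0` and `Sum.inl 1` are opposite corners of the outer square; `Sum.inr j` with
`j ≥ 10` are the inserted vertices. -/
def blockSrc (e : Fin 48) : Fin 2 ⊕ Fin 18 :=
  .inr (![0, 0, 0, 0, 1, 1, 1, 2, 2, 2, 3, 3, 4, 4, 5, 5, 6, 6, 7, 7, 8, 8, 9, 9, 10, 10, 10, 11,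
    11, 11, 12, 12, 12, 13, 13, 13, 14, 14, 14, 15, 15, 15, 16, 16, 16, 17, 17, 17] e)

/-- End points of the edges of a block. -/
def blockDst : Fin 48 → Fin 2 ⊕ Fin 18 :=
  ![.inr 1, .inr 2, .inr 4, .inr 5, .inr 3, .inr 4, .inr 6, .inr 3, .inr 5, .inr 7, .inr 6,
    .inr 7, .inl 1, .inr 8, .inl 1, .inr 9, .inl 0, .inr 8, .inl 0, .inr 9, .inl 0, .inl 1, .inl
    0, .inl 1, .inr 0, .inr 1, .inr 4, .inr 0, .inr 2, .inr 5, .inr 1, .inr 3, .inr 6, .inr 2,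
    .inr 3, .inr 7, .inl 1, .inr 4, .inr 8, .inl 1, .inr 5, .inr 9, .inl 0, .inr 6, .inr 8, .inl
    0, .inr 7, .inr 9]

/-- Left faces of the edges of a block. The faces `29` and `30` are the two halves of the outer
square. -/
def blockLeft : Fin 48 → Fin 31 :=
  ![0, 3, 1, 4, 6, 2, 7, 9, 5, 10, 8, 11, 12, 13, 15, 16, 19, 18, 22, 21, 20, 14, 23, 17, 0,
    0, 1, 3, 3, 4, 6, 6, 7, 9, 9, 10, 12, 12, 13, 15, 15, 16, 19, 18, 18, 22, 21, 21]

/-- Right faces of the edges of a block. -/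
def blockRight : Fin 48 → Fin 31 :=
  ![24, 24, 25, 25, 24, 27, 27, 24, 28, 28, 26, 26, 25, 27, 25, 28, 26, 27, 26, 28, 30, 30,
    29, 29, 1, 2, 2, 4, 5, 5, 7, 8, 8, 10, 11, 11, 14, 13, 14, 17, 16, 17, 20, 19, 20, 23, 22,
    23]

/-- The bits of `blockPath f` are the edges crossed by a path in the dual graph from face `29` to
face `f`. -/
def blockPath : Fin 31 → ℕ :=
  ![549780996100, 549764218884, 549831327748, 140737761509632, 549764218888, 140737493074176,
    35186524029952, 35188671513600, 35184376546304, 35201556416512, 140737493074432,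
    35184376547328, 549764222976, 687203176448, 618483699712, 549764202496, 2199031644160,
    8388608, 43980469633024, 35184376610816, 39582423121920, 140737492549632, 35184376283136,
    4194304, 35186524029968, 549764218880, 35184376545280, 35188671513664, 140737493073920, 0,
    39582424170496]

/-- The bits of `blockCut e` are the inner vertices enclosed by the dual cycle that consists of `e`
and the dual paths to its two faces. -/
def blockCut : Fin 48 → ℕ :=
  ![174765, 139404, 0, 0, 0, 179887, 0, 8, 0, 0, 0, 0, 0, 179903, 0, 512, 0, 64, 0, 0, 0,
    262143, 0, 0, 0, 1024, 0, 35360, 0, 33312, 4096, 0, 0, 139392, 0, 131200, 0, 0, 16384, 0,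
    32768, 0, 0, 0, 65536, 0, 131072, 0]

lemma blockPath_add (e e' : Fin 48) :
    ((if (blockPath (blockLeft e)).testBit e' then 1 else 0) +
      if (blockPath (blockRight e)).testBit e' then 1 else 0 : ZMod 2) =
    (if e' = e then 1 else 0) + ∑ j : Fin 18, (if (blockCut e).testBit j then 1 else 0) *
      ((if blockSrc e' = .inr j then 1 else 0) + if blockDst e' = .inr j then 1 else 0) := by
  revert e e'
  decide +kernel

lemma block_exact {z : Fin 48 → ZMod 2} (hz : ∀ j, boundary blockSrc blockDst z (.inr j) = 0)
    (c : ZMod 2) : ∃ t : Fin 31 → ZMod 2,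
      (∀ e, t (blockLeft e) + t (blockRight e) = z e) ∧ t 29 = c ∧
        t 30 = c + boundary blockSrc blockDst z (.inl 0) := by
  refine ⟨fun f => c + ∑ e, z e * if (blockPath f).testBit e then 1 else 0, fun e => ?_, ?_, ?_⟩
  · have h : ∑ e', z e' * (∑ j : Fin 18, (if (blockCut e).testBit j then 1 else 0) *
        ((if blockSrc e' = .inr j then 1 else 0) +
          if blockDst e' = .inr j then 1 else 0 : ZMod 2)) = 0 := by
      simp only [Finset.mul_sum]
      rw [Finset.sum_comm]
      refine Finset.sum_eq_zero fun j _ => ?_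
      simp only [mul_left_comm (z _)]
      rw [← Finset.mul_sum]
      exact mul_eq_zero_of_right _ (hz j)
    calc _ = ∑ e', z e' * ((if (blockPath (blockLeft e)).testBit e' then 1 else 0) +
          if (blockPath (blockRight e)).testBit e' then 1 else 0) := by
          simp only [mul_add, Finset.sum_add_distrib]
          linear_combination CharTwo.add_self_eq_zero c
      _ = z e := by
          simp only [blockPath_add]
          simp only [mul_add (z _), Finset.sum_add_distrib (f := fun e' => z e' * _), h]
          simp
  · simp [show blockPath 29 = 0 by decide +kernel]
  · have : ∀ e : Fin 48, (if (blockPath 30).testBit e then 1 else 0 : ZMod 2) =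
        (if blockSrc e = .inl 0 then 1 else 0) + if blockDst e = .inl 0 then 1 else 0 := by
      decide +kernel
    simp only [this, boundary]

lemma block_closed (t : Fin 31 → ZMod 2) (v : Fin 2 ⊕ Fin 18) :
    boundary blockSrc blockDst (fun e => t (blockLeft e) + t (blockRight e)) v =
      if v.isLeft then t 29 + t 30 else 0 := by
  have key : ∀ v f, ∑ e, ((if blockLeft e = f then 1 else 0) + if blockRight e = f then 1 else 0) *
      ((if blockSrc e = v then 1 else 0) + if blockDst e = v then 1 else 0 : ZMod 2) =
      if v.isLeft then (if 29 = f then 1 else 0) + if 30 = f then 1 else 0 else 0 := by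
    decide +kernel
  have expand : ∀ f, t f = ∑ f', t f' * if f = f' then 1 else 0 := fun f => by simp
  calc _ = ∑ e, ∑ f, t f * (((if blockLeft e = f then 1 else 0) +
        if blockRight e = f then 1 else 0) *
        ((if blockSrc e = v then 1 else 0) + if blockDst e = v then 1 else 0)) := by
        refine Finset.sum_congr rfl fun e _ => ?_
        dsimp only
        rw [expand (blockLeft e), expand (blockRight e), ← Finset.sum_add_distrib, Finset.sum_mul]
        exact Finset.sum_congr rfl fun f _ => by ring
    _ = ∑ f, t f * if v.isLeft then (if 29 = f then 1 else 0) + if 30 = f then 1 else 0 else 0 := by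
        rw [Finset.sum_comm]
        simp only [← Finset.mul_sum, key]
    _ = _ := by
        split_ifs <;> simp [mul_add, Finset.sum_add_distrib]

/-- Adjacency inside a block. -/
def BlockAdj (x y : Fin 2 ⊕ Fin 18) : Prop :=
  ∃ e, s(blockSrc e, blockDst e) = s(x, y)

instance : DecidableRel BlockAdj := fun _ _ => inferInstanceAs (Decidable (∃ _, _))

lemma block_no_theta : ∀ c d, BlockAdj c d → ∀ a, BlockAdj c a → BlockAdj d a →
    ∀ b, BlockAdj c b → BlockAdj d b → a = b ∨ BlockAdj a b := by
  decide +kernel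

lemma block_injective : Function.Injective fun e => s(blockSrc e, blockDst e) := by
  decide +kernel

lemma blockSrc_ne_blockDst : ∀ e, blockSrc e ≠ blockDst e := by
  decide +kernel

section Ring

variable {r : ℕ}

/-- The vertices of the graph obtained by gluing blocks at their two vertices `Sum.inl`. -/
abbrev RingVertex (r : ℕ) : Type := Fin 2 ⊕ Fin (r + 1) × Fin 18

/-- The inclusion of the vertices of the `i`-th block. -/
def place (i : Fin (r + 1)) : Fin 2 ⊕ Fin 18 → RingVertex r :=
  Sum.map id (Prod.mk i)

/-- The inclusion of the faces of the `i`-th block: the half `30` of its outer square is merged with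
the half `29` of the outer square of the next block. -/
def placeFace (i : Fin (r + 1)) (f : Fin 31) : Fin (r + 1) × Fin 31 :=
  if f = 30 then (i + 1, 29) else (i, f)

/-- Start points of the edges of the glued blocks. -/
def ringSrc (e : Fin (r + 1) × Fin 48) : RingVertex r := place e.1 (blockSrc e.2)

/-- End points of the edges of the glued blocks. -/
def ringDst (e : Fin (r + 1) × Fin 48) : RingVertex r := place e.1 (blockDst e.2)

/-- Left faces of the edges of the glued blocks. -/
def ringLeft (e : Fin (r + 1) × Fin 48) : Fin (r + 1) × Fin 31 := placeFace e.1 (blockLeft e.2)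

/-- Right faces of the edges of the glued blocks. -/
def ringRight (e : Fin (r + 1) × Fin 48) : Fin (r + 1) × Fin 31 := placeFace e.1 (blockRight e.2)

lemma place_injective (i : Fin (r + 1)) : Function.Injective (place i) :=
  Function.injective_id.sumMap (Prod.mk_right_injective i)

lemma exists_of_place_eq {i i' : Fin (r + 1)} {x : Fin 2 ⊕ Fin 18} {j : Fin 18}
    (h : place i' x = .inr (i, j)) : i' = i ∧ x = .inr j := by
  rcases x with w | j'
  · simp [place] at h
  · simpa [place] using h

lemma ringEdge_eq_map (i : Fin (r + 1)) (e : Fin 48) :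
    s(ringSrc (i, e), ringDst (i, e)) = s(blockSrc e, blockDst e).map (place i) := rfl

lemma eq_of_ringEdge_eq {i i' : Fin (r + 1)} {e : Fin 48} {q : Sym2 (Fin 2 ⊕ Fin 18)}
    (h : s(ringSrc (i, e), ringDst (i, e)) = q.map (place i')) :
    i' = i ∧ s(blockSrc e, blockDst e) = q := by
  have hi : i' = i := by
    have hmem : ringSrc (i, e) ∈ q.map (place i') := h ▸ Sym2.mem_mk_left _ _
    obtain ⟨x, -, hx⟩ := Sym2.mem_map.1 hmem
    exact (exists_of_place_eq hx).1
  subst hi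
  exact ⟨rfl, Sym2.map.injective (place_injective i') h⟩

lemma ring_injective :
    Function.Injective fun e : Fin (r + 1) × Fin 48 => s(ringSrc e, ringDst e) := by
  rintro ⟨i, e⟩ ⟨i', e'⟩ h
  obtain ⟨hi, he⟩ := eq_of_ringEdge_eq (h.trans (ringEdge_eq_map i' e'))
  exact Prod.ext hi.symm (block_injective he)

lemma ringSrc_ne_ringDst (e : Fin (r + 1) × Fin 48) : ringSrc e ≠ ringDst e :=
  fun h => blockSrc_ne_blockDst e.2 (place_injective e.1 h)

lemma boundary_ring_inr (z : Fin (r + 1) × Fin 48 → ZMod 2) (i : Fin (r + 1)) (j : Fin 18) :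
    boundary ringSrc ringDst z (.inr (i, j)) =
      boundary blockSrc blockDst (fun e => z (i, e)) (.inr j) := by
  unfold boundary
  rw [Fintype.sum_prod_type, Fintype.sum_eq_single i]
  · simp only [ringSrc, ringDst, show (Sum.inr (i, j) : RingVertex r) = place i (.inr j) from rfl,
      (place_injective i).eq_iff]
  · intro i' hi'
    refine Finset.sum_eq_zero fun e _ => ?_
    rw [ringSrc, ringDst, if_neg fun h => hi' (exists_of_place_eq h).1,
      if_neg fun h => hi' (exists_of_place_eq h).1, add_zero, mul_zero]

lemma boundary_ring_inl (z : Fin (r + 1) × Fin 48 → ZMod 2) (w : Fin 2) :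
    boundary ringSrc ringDst z (.inl w) =
      ∑ i, boundary blockSrc blockDst (fun e => z (i, e)) (.inl w) := by
  unfold boundary
  rw [Fintype.sum_prod_type]
  refine Finset.sum_congr rfl fun i _ => ?_
  simp only [ringSrc, ringDst, show (Sum.inl w : RingVertex r) = place i (.inl w) from rfl,
    (place_injective i).eq_iff]

lemma exists_cyclic_primitive {M : Type*} [AddCommGroup M] (c : Fin (r + 1) → M)
    (hc : ∑ i, c i = 0) : ∃ g : Fin (r + 1) → M, ∀ i, g (i + 1) = g i + c i := by
  refine ⟨fun i => ∑ j ∈ Finset.range i, c (Fin.ofNat (r + 1) j), fun i => ?_⟩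
  have hi : c i = c (Fin.ofNat (r + 1) i) := by simp
  dsimp only
  rw [hi, ← Finset.sum_range_succ (fun j => c (Fin.ofNat (r + 1) j)), Fin.val_add_one]
  split_ifs with h
  · rw [h, Fin.val_last, Finset.sum_range_zero, Finset.sum_range, ← hc]
    simp
  · rfl

lemma ring_isSphereMap :
    IsSphereMap (ringSrc (r := r)) ringDst ringLeft ringRight where
  injective := ring_injective
  ne := ringSrc_ne_ringDst
  exists_primitive z hz := by
    obtain ⟨g, hg⟩ := exists_cyclic_primitive
      (fun i : Fin (r + 1) => boundary blockSrc blockDst (fun e => z (i, e)) (.inl 0))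
      ((boundary_ring_inl z 0).symm.trans (congrFun hz _))
    choose t ht h29 h30 using fun i : Fin (r + 1) => block_exact (z := fun e => z (i, e))
      (fun j => (boundary_ring_inr z i j).symm.trans (congrFun hz _)) (g i)
    have key : ∀ i f, t (placeFace i f).1 (placeFace i f).2 = t i f := by
      intro i f
      unfold placeFace
      split_ifs with h
      · rw [h, h30, h29, hg]
      · rfl
    refine ⟨fun x => t x.1 x.2, fun e => ?_⟩
    simp only [ringLeft, ringRight, key]
    exact ht e.1 e.2
  closed t := by
    have hblock : ∀ i v, boundary blockSrc blockDst
        (fun e => t (ringLeft (i, e)) + t (ringRight (i, e))) v =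
        if v.isLeft then t (i, 29) + t (i + 1, 29) else 0 := fun i v => by
      simpa [ringLeft, ringRight, placeFace] using block_closed (fun f => t (placeFace i f)) v
    funext v
    rcases v with w | ⟨i, j⟩
    · rw [boundary_ring_inl]
      simp only [hblock, Sum.isLeft_inl, if_true, Finset.sum_add_distrib]
      rw [show ∑ i : Fin (r + 1), t (i + 1, 29) = ∑ i, t (i, 29) from
        Equiv.sum_comp (Equiv.addRight (1 : Fin (r + 1))) fun i => t (i, 29),
        CharTwo.add_self_eq_zero]
      rfl
    · rw [boundary_ring_inr, hblock]
      rfl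

lemma adj_place_iff {i : Fin (r + 1)} {x y : Fin 2 ⊕ Fin 18} :
    (graphOfEdges ringSrc ringDst).Adj (place i x) (place i y) ↔ BlockAdj x y := by
  constructor
  · intro h
    obtain ⟨⟨i', e⟩, he⟩ := exists_of_adj h
    obtain ⟨-, he⟩ := eq_of_ringEdge_eq (q := s(x, y)) he
    exact ⟨e, he⟩
  · rintro ⟨e, he⟩
    refine (SimpleGraph.fromEdgeSet_adj _).2 ⟨⟨(i, e), ?_⟩, fun h => ?_⟩
    · exact (ringEdge_eq_map i e).trans (congrArg _ he)
    · have := place_injective i h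
      subst this
      have := blockSrc_ne_blockDst e
      simp_all

lemma exists_place_of_adj {i : Fin (r + 1)} {j : Fin 18} {y : RingVertex r}
    (h : (graphOfEdges ringSrc ringDst).Adj (.inr (i, j)) y) : ∃ y', place i y' = y := by
  obtain ⟨⟨i', e⟩, he⟩ := exists_of_adj h
  have hx : .inr (i, j) ∈ s(ringSrc (i', e), ringDst (i', e)) := he ▸ Sym2.mem_mk_left _ _
  have hy : y ∈ s(ringSrc (i', e), ringDst (i', e)) := he ▸ Sym2.mem_mk_right _ _
  rw [ringEdge_eq_map, Sym2.mem_map] at hx hy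
  obtain ⟨x', -, hx⟩ := hx
  obtain ⟨y', -, rfl⟩ := hy
  exact ⟨y', by rw [(exists_of_place_eq hx).1]⟩

lemma not_adj_inl {w w' : Fin 2} :
    ¬ (graphOfEdges (ringSrc (r := r)) ringDst).Adj (.inl w) (.inl w') := by
  intro h
  obtain ⟨⟨i, e⟩, he⟩ := exists_of_adj h
  have : ringSrc (i, e) ∈ s(.inl w, .inl w') := he ▸ Sym2.mem_mk_left _ _
  simp [ringSrc, place, blockSrc] at this

lemma ring_no_theta_of_inr {i : Fin (r + 1)} {j : Fin 18} {d a b : RingVertex r}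
    (hd : (graphOfEdges ringSrc ringDst).Adj (.inr (i, j)) d)
    (ha : (graphOfEdges ringSrc ringDst).Adj (.inr (i, j)) a)
    (hb : (graphOfEdges ringSrc ringDst).Adj (.inr (i, j)) b)
    (hda : (graphOfEdges ringSrc ringDst).Adj d a) (hdb : (graphOfEdges ringSrc ringDst).Adj d b) :
    a = b ∨ (graphOfEdges ringSrc ringDst).Adj a b := by
  obtain ⟨d, rfl⟩ := exists_place_of_adj hd
  obtain ⟨a, rfl⟩ := exists_place_of_adj ha
  obtain ⟨b, rfl⟩ := exists_place_of_adj hb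
  rw [show (Sum.inr (i, j) : RingVertex r) = place i (.inr j) from rfl, adj_place_iff]
    at hd ha hb
  rw [adj_place_iff] at hda hdb ⊢
  exact (block_no_theta _ _ hd _ ha hda _ hb hdb).imp_left (congrArg _)

lemma ring_no_theta {c d a b : RingVertex r} (hcd : (graphOfEdges ringSrc ringDst).Adj c d)
    (hca : (graphOfEdges ringSrc ringDst).Adj c a) (hcb : (graphOfEdges ringSrc ringDst).Adj c b)
    (hda : (graphOfEdges ringSrc ringDst).Adj d a) (hdb : (graphOfEdges ringSrc ringDst).Adj d b) :
    a = b ∨ (graphOfEdges ringSrc ringDst).Adj a b := by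
  rcases c with w | ⟨i, j⟩
  · rcases d with w' | ⟨i, j⟩
    · exact absurd hcd not_adj_inl
    · exact ring_no_theta_of_inr hcd.symm hda hdb hca hcb
  · exact ring_no_theta_of_inr hcd hca hcb hda hdb

lemma ring_theta4_free : IsEmpty (theta4 ↪g graphOfEdges (ringSrc (r := r)) ringDst) := by
  refine ⟨fun φ => ?_⟩
  have h : ∀ x y, (graphOfEdges ringSrc ringDst).Adj (φ x) (φ y) ↔
      x ≠ y ∧ s(x, y) ≠ s(0, 1) := fun x y => by
    rw [φ.map_adj_iff]
    simp [theta4]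
  rcases ring_no_theta ((h 2 3).2 (by decide)) ((h 2 0).2 (by decide)) ((h 2 1).2 (by decide))
    ((h 3 0).2 (by decide)) ((h 3 1).2 (by decide)) with h' | h'
  · exact absurd (φ.injective h') (by decide)
  · exact ((h 0 1).1 h').2 rfl

lemma card_ringEdges :
    Nat.card (graphOfEdges (ringSrc (r := r)) ringDst).edgeSet = (r + 1) * 48 := by
  have hset : (graphOfEdges (ringSrc (r := r)) ringDst).edgeSet =
      Set.range fun e => s(ringSrc e, ringDst e) := by
    rw [graphOfEdges, SimpleGraph.edgeSet_fromEdgeSet, sdiff_eq_left, Set.disjoint_left]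
    rintro _ ⟨e, rfl⟩ he
    exact ringSrc_ne_ringDst e (by simpa using he)
  rw [hset, Nat.card_range_of_injective ring_injective]
  simp

end Ring

theorem stmt_1 (n : ℕ) (hn : 0 < n) (hmod : n % 36 = 20) :
    ∃ G : SimpleGraph (Fin n), IsPlanar G ∧ ¬ ContainsInduced theta4 G ∧
      3 * G.edgeSet.ncard = 8 * (n - 2) := by
  obtain ⟨r, rfl⟩ : ∃ r, n = 2 + (r + 1) * 18 := ⟨(n - 20) / 18, by omega⟩
  let ε : RingVertex r ≃ Fin (2 + (r + 1) * 18) := Fintype.equivFinOfCardEq (by simp)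
  let φ := SimpleGraph.Iso.map ε (graphOfEdges ringSrc ringDst)
  refine ⟨_, ring_isSphereMap.isPlanar.map_iso φ, ?_, ?_⟩
  · rintro ⟨s, ⟨ψ⟩⟩
    exact ring_theta4_free.false
      (φ.symm.toEmbedding.comp ((SimpleGraph.Embedding.induce s).comp ψ.toEmbedding))
  · rw [← Nat.card_coe_set_eq, ← Nat.card_congr φ.mapEdgeSet, card_ringEdges]
    omega
end

section
/- For every n ≥ 1, the maximum number of edges of a planar graph on n vertices that contains no induced copy of P_3 equals: (3/2)n if n ≡ 0 (mod 4); (3/2)(n−1) if n ≡ 1 (mod 4); (3/2)(n−2) + 1 if n ≡ 2 (mod 4); and (3/2)(n−3) + 3 if n ≡ 3 (mod 4). -/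
open SimpleGraph

/-- A graph without induced paths on three vertices has transitive adjacency. -/
theorem adj_trans_of_not_containsInduced {V : Type*} {G : SimpleGraph V}
    (h : ¬ ContainsInduced (pathGraph 3) G) {a b c : V} (hab : G.Adj a b) (hbc : G.Adj b c)
    (hac : a ≠ c) : G.Adj a c := by
  by_contra hn
  apply h
  have hab' := hab.ne
  have hbc' := hbc.ne
  have hf : Function.Injective ![a, b, c] := by
    intro i j hij
    fin_cases i <;> fin_cases j <;> simp_all
  refine ⟨Set.range ![a, b, c], ⟨⟨Equiv.ofInjective _ hf, ?_⟩⟩⟩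
  intro i j
  have hca : ¬ G.Adj c a := fun h' => hn h'.symm
  fin_cases i <;> fin_cases j <;>
    simp [pathGraph_adj, hab, hbc, hab.symm, hbc.symm, hn, hca]

/-- An injective homomorphism from `H` to `G` exhibits a (trivial) subdivision of `H` in `G`. -/
theorem containsSubdivision_of_embedding {W V : Type*} {H : SimpleGraph W} {G : SimpleGraph V}
    (f : W ↪ V) (hf : ∀ a b, H.Adj a b → G.Adj (f a) (f b)) : ContainsSubdivision H G := by
  refine ⟨f, fun a b h => (hf a b h).toWalk, ?_, ?_, ?_⟩
  · intro a b h
    simpa using (hf a b h).ne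
  · intro a b h w hw
    simpa using hw
  · intro a b c d h₁ h₂ _ x hx₁ hx₂
    exact ⟨by simpa using hx₁, by simpa using hx₂⟩

/-- The closed neighborhood of a vertex. -/
noncomputable def closedNbhd {n : ℕ} (G : SimpleGraph (Fin n)) (v : Fin n) : Finset (Fin n) := by
  classical exact Finset.univ.filter fun u => u = v ∨ G.Adj v u

theorem mem_closedNbhd {n : ℕ} {G : SimpleGraph (Fin n)} {u v : Fin n} :
    u ∈ closedNbhd G v ↔ u = v ∨ G.Adj v u := by
  simp [closedNbhd]

theorem card_closedNbhd {n : ℕ} (G : SimpleGraph (Fin n)) [DecidableRel G.Adj] (v : Fin n) :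
    (closedNbhd G v).card = G.degree v + 1 := by
  have : closedNbhd G v = insert v (G.neighborFinset v) := by
    ext u
    simp [mem_closedNbhd]
  rw [this, Finset.card_insert_of_notMem (by simp), card_neighborFinset_eq_degree]

theorem closedNbhd_eq_iff {n : ℕ} {G : SimpleGraph (Fin n)}
    (h : ¬ ContainsInduced (pathGraph 3) G) {u v : Fin n} :
    closedNbhd G u = closedNbhd G v ↔ u ∈ closedNbhd G v := by
  have key : ∀ {u v w}, u ∈ closedNbhd G v → w ∈ closedNbhd G u → w ∈ closedNbhd G v := by
    intro u v w huv hwu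
    rw [mem_closedNbhd] at *
    rcases huv with rfl | huv
    · exact hwu
    · rcases hwu with rfl | hwu
      · exact Or.inr huv
      · by_cases hvw : w = v
        · exact Or.inl hvw
        · exact Or.inr (adj_trans_of_not_containsInduced h huv hwu (Ne.symm hvw))
  constructor
  · intro e
    rw [← e, mem_closedNbhd]
    exact Or.inl rfl
  · intro huv
    have hvu : v ∈ closedNbhd G u := by
      rw [mem_closedNbhd] at *
      exact huv.imp Eq.symm fun a => a.symm
    ext w
    exact ⟨key huv, key hvu⟩

theorem card_closedNbhd_le {n : ℕ} {G : SimpleGraph (Fin n)} (hP : IsPlanar G)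
    (h : ¬ ContainsInduced (pathGraph 3) G) (v : Fin n) : (closedNbhd G v).card ≤ 4 := by
  by_contra hlt
  have hc : Fintype.card (Fin 5) ≤ Fintype.card (closedNbhd G v) := by
    simp only [Fintype.card_fin, Fintype.card_coe]
    omega
  obtain ⟨f⟩ := Function.Embedding.nonempty_of_card_le hc
  apply hP.1
  refine containsSubdivision_of_embedding (f.trans (Function.Embedding.subtype _)) ?_
  intro a b hab
  have ha := (closedNbhd_eq_iff h).2 (f a).2
  have hb := (closedNbhd_eq_iff h).2 (f b).2
  have hba := (closedNbhd_eq_iff h).1 (hb.trans ha.symm)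
  rw [mem_closedNbhd] at hba
  rcases hba with hba | hba
  · exact absurd (f.injective (Subtype.ext hba)) hab.ne'
  · exact hba

/-- Deficiency of a graph made of as many copies of `K₄` as possible, compared with `3n`. -/
def deficiency (k : ℕ) : ℕ := k % 4 * (4 - k % 4)

theorem deficiency_add_le (a b : ℕ) : deficiency (a + b) ≤ deficiency a + deficiency b := by
  unfold deficiency
  have ha : a % 4 < 4 := Nat.mod_lt _ (by norm_num)
  have hb : b % 4 < 4 := Nat.mod_lt _ (by norm_num)
  rw [Nat.add_mod]
  generalize a % 4 = x at *
  generalize b % 4 = y at *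
  interval_cases x <;> interval_cases y <;> decide

theorem sum_degree_add_deficiency_le {n : ℕ} {G : SimpleGraph (Fin n)} [DecidableRel G.Adj]
    (hP : IsPlanar G) (h : ¬ ContainsInduced (pathGraph 3) G) :
    ∑ v, G.degree v + deficiency n ≤ 3 * n := by
  classical
  set I := Finset.univ.image (closedNbhd G) with hI
  have hmaps : ∀ v ∈ Finset.univ, closedNbhd G v ∈ I := fun v _ => by simp [hI]
  have hfib : ∀ c ∈ I, Finset.univ.filter (fun v => closedNbhd G v = c) = c := by
    intro c hc
    obtain ⟨v, -, rfl⟩ := Finset.mem_image.1 hc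
    ext u
    simp [closedNbhd_eq_iff h]
  have hcard : n = ∑ c ∈ I, c.card := by
    have := Finset.card_eq_sum_card_fiberwise hmaps
    rw [Finset.card_univ, Fintype.card_fin] at this
    exact this.trans <| Finset.sum_congr rfl fun c hc => by rw [hfib c hc]
  have hdeg : ∑ v, G.degree v = ∑ c ∈ I, c.card * (c.card - 1) := by
    rw [← Finset.sum_fiberwise_of_maps_to hmaps]
    refine Finset.sum_congr rfl fun c hc => ?_
    rw [Finset.sum_congr rfl (g := fun _ => c.card - 1), Finset.sum_const, hfib c hc, smul_eq_mul]
    intro v hv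
    rw [← (Finset.mem_filter.1 hv).2, card_closedNbhd, Nat.add_sub_cancel]
  have hdef : deficiency n ≤ ∑ c ∈ I, deficiency c.card := by
    conv_lhs => rw [hcard]
    exact Finset.le_sum_of_subadditive deficiency rfl.le deficiency_add_le _ _
  calc ∑ v, G.degree v + deficiency n
      ≤ ∑ c ∈ I, (c.card * (c.card - 1) + deficiency c.card) := by
        rw [Finset.sum_add_distrib, hdeg]
        exact Nat.add_le_add_left hdef _
    _ ≤ ∑ c ∈ I, 3 * c.card := by
        refine Finset.sum_le_sum fun c hc => ?_
        obtain ⟨v, -, rfl⟩ := Finset.mem_image.1 hc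
        have h4 := card_closedNbhd_le hP h v
        generalize (closedNbhd G v).card = k at *
        interval_cases k <;> decide
    _ = 3 * n := by rw [← Finset.mul_sum, ← hcard]

/-- Disjoint copies of `K₄` on consecutive vertices, followed by a smaller complete graph. -/
def blockGraph (n : ℕ) : SimpleGraph (Fin n) where
  Adj a b := a ≠ b ∧ (a : ℕ) / 4 = b / 4
  symm := ⟨fun _ _ h => ⟨h.1.symm, h.2.symm⟩⟩
  loopless := ⟨fun _ h => h.1 rfl⟩

instance (n : ℕ) : DecidableRel (blockGraph n).Adj :=
  fun a b => inferInstanceAs (Decidable (a ≠ b ∧ (a : ℕ) / 4 = b / 4))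

theorem blockGraph_walk {n : ℕ} {a b : Fin n} (p : (blockGraph n).Walk a b) :
    (a : ℕ) / 4 = b / 4 := by
  induction p with
  | nil => rfl
  | cons h _ ih => exact h.2.trans ih

/-- Connected graphs on more than four vertices have no subdivision in `blockGraph n`. -/
theorem not_containsSubdivision_blockGraph {n : ℕ} {W : Type*} [Fintype W] {H : SimpleGraph W}
    (hH : H.Preconnected) (hW : 4 < Fintype.card W) :
    ¬ ContainsSubdivision H (blockGraph n) := by
  rintro ⟨f, p, -⟩
  have hwalk : ∀ {a b : W}, H.Walk a b → (f a : ℕ) / 4 = f b / 4 := by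
    intro a b q
    induction q with
    | nil => rfl
    | cons h _ ih => exact (blockGraph_walk (p h)).trans ih
  let g : W → Fin 4 := fun w => ⟨(f w : ℕ) % 4, Nat.mod_lt _ (by norm_num)⟩
  have hg : Function.Injective g := by
    intro a b hab
    obtain ⟨q⟩ := hH a b
    have h1 := hwalk q
    have h2 : (f a : ℕ) % 4 = f b % 4 := congrArg Fin.val hab
    exact f.injective (Fin.ext (by omega))
  have := Fintype.card_le_of_injective g hg
  rw [Fintype.card_fin] at this
  omega

theorem isPlanar_blockGraph (n : ℕ) : IsPlanar (blockGraph n) := by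
  refine ⟨not_containsSubdivision_blockGraph (connected_top).preconnected (by simp),
    not_containsSubdivision_blockGraph ?_ (by simp)⟩
  have hlr : ∀ i j : Fin 3, (completeBipartiteGraph (Fin 3) (Fin 3)).Adj (.inl i) (.inr j) := by
    simp
  rintro (i | i) (j | j)
  · exact (hlr i 0).reachable.trans (hlr j 0).symm.reachable
  · exact (hlr i j).reachable
  · exact (hlr j i).symm.reachable
  · exact (hlr 0 i).symm.reachable.trans (hlr 0 j).reachable

theorem not_containsInduced_blockGraph (n : ℕ) :
    ¬ ContainsInduced (pathGraph 3) (blockGraph n) := by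
  rintro ⟨s, ⟨e⟩⟩
  have h01 : (blockGraph n).Adj (e 0) (e 1) := e.map_rel_iff.2 (by simp [pathGraph_adj])
  have h12 : (blockGraph n).Adj (e 1) (e 2) := e.map_rel_iff.2 (by simp [pathGraph_adj])
  have h02 : ¬ (blockGraph n).Adj (e 0) (e 2) := fun h =>
    absurd (e.map_rel_iff.1 h) (by simp [pathGraph_adj])
  refine h02 ⟨fun h => ?_, h01.2.trans h12.2⟩
  exact absurd (e.injective (Subtype.ext h)) (by decide)

theorem degree_blockGraph {n : ℕ} (v : Fin n) :
    (blockGraph n).degree v = min (4 * (v / 4 : ℕ) + 4) n - 4 * (v / 4 : ℕ) - 1 := by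
  have h : ((blockGraph n).neighborFinset v).map Fin.valEmbedding =
      (Finset.Ico (4 * (v / 4 : ℕ)) (min (4 * (v / 4 : ℕ) + 4) n)).erase v := by
    ext u
    simp only [Finset.mem_map, mem_neighborFinset, Fin.valEmbedding_apply, Finset.mem_erase,
      Finset.mem_Ico]
    constructor
    · rintro ⟨w, ⟨hne, hw⟩, rfl⟩
      have := w.2
      have : (v : ℕ) ≠ w := fun h => hne (Fin.ext h)
      omega
    · rintro ⟨h1, h2, h3⟩
      refine ⟨⟨u, by omega⟩, ⟨fun h => h1 (congrArg Fin.val h).symm, ?_⟩, rfl⟩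
      change (v : ℕ) / 4 = u / 4
      omega
  rw [← card_neighborFinset_eq_degree, ← Finset.card_map Fin.valEmbedding, h,
    Finset.card_erase_of_mem, Nat.card_Ico]
  have := v.2
  rw [Finset.mem_Ico]
  omega

theorem sum_degree_blockGraph (n : ℕ) :
    ∑ v, (blockGraph n).degree v = 3 * (4 * (n / 4)) + n % 4 * (n % 4 - 1) := by
  simp only [degree_blockGraph]
  rw [Fin.sum_univ_eq_sum_range
    (fun v => min (4 * (v / 4 : ℕ) + 4) n - 4 * (v / 4 : ℕ) - 1) n]
  obtain ⟨q, r, hr, rfl⟩ : ∃ q r, r < 4 ∧ n = 4 * q + r :=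
    ⟨n / 4, n % 4, Nat.mod_lt _ (by norm_num), by omega⟩
  rw [Finset.sum_range_add, Finset.sum_congr rfl (g := fun _ => 3),
    Finset.sum_congr (s₁ := Finset.range r) rfl (g := fun _ => r - 1)]
  · simp only [Finset.sum_const, Finset.card_range, smul_eq_mul]
    rw [show (4 * q + r) / 4 = q by omega, show (4 * q + r) % 4 = r by omega]
    ring
  · intro x hx
    rw [Finset.mem_range] at hx
    omega
  · intro x hx
    rw [Finset.mem_range] at hx
    omega

theorem sum_degree_eq_two_mul_ncard {n : ℕ} (G : SimpleGraph (Fin n)) [DecidableRel G.Adj] :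
    ∑ v, G.degree v = 2 * G.edgeSet.ncard := by
  rw [sum_degrees_eq_twice_card_edges, ← coe_edgeFinset, Set.ncard_coe_finset]

theorem stmt_5 (n : ℕ) (hn : 1 ≤ n) :
    IsGreatest {m : ℕ | ∃ G : SimpleGraph (Fin n), IsPlanar G ∧
        ¬ ContainsInduced (pathGraph 3) G ∧ G.edgeSet.ncard = m}
      (if n % 4 = 0 then 3 * n / 2
       else if n % 4 = 1 then 3 * (n - 1) / 2
       else if n % 4 = 2 then 3 * (n - 2) / 2 + 1
       else 3 * (n - 3) / 2 + 3) := by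
  have hr : n % 4 = 0 ∨ n % 4 = 1 ∨ n % 4 = 2 ∨ n % 4 = 3 := by omega
  constructor
  · refine ⟨blockGraph n, isPlanar_blockGraph n, not_containsInduced_blockGraph n, ?_⟩
    have h := sum_degree_blockGraph n
    rw [sum_degree_eq_two_mul_ncard] at h
    rcases hr with hr | hr | hr | hr <;> simp only [hr] at h ⊢ <;> norm_num at h ⊢ <;> omega
  · rintro m ⟨G, hP, hG, rfl⟩
    classical
    have h := sum_degree_add_deficiency_le hP hG
    rw [sum_degree_eq_two_mul_ncard, deficiency] at h
    rcases hr with hr | hr | hr | hr <;> simp only [hr] at h ⊢ <;> norm_num at h ⊢ <;> omega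
end

section
/- For every n ≥ 7, every planar graph on n vertices that contains no induced copy of P_4 has at most ⌊8(n−2)/3⌋ + 1 edges. -/
open SimpleGraph

/-- The number of ordered pairs in `S × T` that are adjacent in `G`. -/
noncomputable def adjCount {V : Type*} (G : SimpleGraph V) (S T : Finset V) : ℕ :=
  open Classical in ∑ u ∈ S, ∑ v ∈ T, if G.Adj u v then 1 else 0

section Subdivision

variable {V : Type*} {G : SimpleGraph V}

/-- A copy of `H` in `G`, in which one edge may be replaced by a path of length two. -/
theorem containsSubdivision_of_subdivide_one {W : Type*} {H : SimpleGraph W} (f : W ↪ V)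
    (e : Sym2 W) (x : V)
    (h : ∀ a b, H.Adj a b → G.Adj (f a) (f b) ∨
      (s(a, b) = e ∧ (∀ w, f w ≠ x) ∧ G.Adj (f a) x ∧ G.Adj x (f b))) :
    ContainsSubdivision H G := by
  have key : ∀ a b, H.Adj a b → ∃ p : G.Walk (f a) (f b), p.IsPath ∧
      ∀ y ∈ p.support, y = f a ∨ y = f b ∨ (y = x ∧ s(a, b) = e ∧ ∀ w, f w ≠ x) := by
    intro a b hab
    have hne : f a ≠ f b := fun h' => hab.ne (f.injective h')
    rcases h a b hab with h1 | ⟨he, hx, h1, h2⟩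
    · refine ⟨h1.toWalk, ?_, ?_⟩
      · simp [SimpleGraph.Walk.isPath_def, hne]
      · intro y hy
        simp at hy
        tauto
    · refine ⟨.cons h1 h2.toWalk, ?_, ?_⟩
      · simp [SimpleGraph.Walk.isPath_def, hne, hx, (hx b).symm]
      · intro y hy
        simp at hy
        tauto
  choose p hp hs using key
  refine ⟨f, fun a b hab => p a b hab, fun a b hab => hp a b hab, ?_, ?_⟩
  · intro a b hab w hw
    rcases hs a b hab _ hw with h1 | h1 | ⟨h1, -, h2⟩
    · exact .inl (f.injective h1)
    · exact .inr (f.injective h1)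
    · exact absurd h1 (h2 w)
  · intro a b c d h₁ h₂ hne y hy₁ hy₂
    have h1 := hs a b h₁ y hy₁
    have h2 := hs c d h₂ y hy₂
    grind

theorem IsPlanar.not_subdivided_K5 (hG : IsPlanar G) {a b c d e : V} (hab : a ≠ b)
    (h : G.Adj a b ∨ ∃ x, x ≠ a ∧ x ≠ b ∧ x ≠ c ∧ x ≠ d ∧ x ≠ e ∧ G.Adj a x ∧ G.Adj b x)
    (hac : G.Adj a c) (had : G.Adj a d) (hae : G.Adj a e)
    (hbc : G.Adj b c) (hbd : G.Adj b d) (hbe : G.Adj b e)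
    (hcd : G.Adj c d) (hce : G.Adj c e) (hde : G.Adj d e) : False := by
  have n1 := hac.ne
  have n2 := had.ne
  have n3 := hae.ne
  have n4 := hbc.ne
  have n5 := hbd.ne
  have n6 := hbe.ne
  have n7 := hcd.ne
  have n8 := hce.ne
  have n9 := hde.ne
  have hinj : Function.Injective ![a, b, c, d, e] := by
    intro i j hij
    fin_cases i <;> fin_cases j <;> simp_all [eq_comm]
  obtain ⟨x, hx⟩ : ∃ x, G.Adj a b ∨ (x ≠ a ∧ x ≠ b ∧ x ≠ c ∧ x ≠ d ∧ x ≠ e ∧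
      G.Adj a x ∧ G.Adj b x) := by
    rcases h with h | ⟨x, hx⟩
    · exact ⟨a, .inl h⟩
    · exact ⟨x, .inr hx⟩
  refine hG.1 (containsSubdivision_of_subdivide_one ⟨_, hinj⟩ s(0, 1) x ?_)
  intro i j hij
  have hij := hij.ne
  rcases hx with hx | ⟨h1, h2, h3, h4, h5, h6, h7⟩
  · left
    fin_cases i <;> fin_cases j <;> simp_all [G.adj_comm]
  · have hw : ∀ w, ![a, b, c, d, e] w ≠ x := by
      intro w
      fin_cases w <;> simp_all [eq_comm]
    have h8 := h7.symm
    have h9 := h6.symm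
    simp only [Function.Embedding.coeFn_mk]
    fin_cases i <;> fin_cases j <;> first | exact absurd rfl hij | (left; simp_all [G.adj_comm]; done) | (right; refine ⟨by simp, hw, ?_, ?_⟩ <;> simpa)

theorem IsPlanar.not_subdivided_K33 (hG : IsPlanar G) {a b c x y z : V}
    (hab : a ≠ b) (hac : a ≠ c) (hbc : b ≠ c) (hxy : x ≠ y) (hxz : x ≠ z) (hyz : y ≠ z)
    (hax' : a ≠ x)
    (h : G.Adj a x ∨ ∃ w, w ≠ a ∧ w ≠ b ∧ w ≠ c ∧ w ≠ x ∧ w ≠ y ∧ w ≠ z ∧ G.Adj a w ∧ G.Adj x w)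
    (hay : G.Adj a y) (haz : G.Adj a z)
    (hbx : G.Adj b x) (hby : G.Adj b y) (hbz : G.Adj b z)
    (hcx : G.Adj c x) (hcy : G.Adj c y) (hcz : G.Adj c z) : False := by
  have n1 := hay.ne
  have n2 := haz.ne
  have n3 := hbx.ne
  have n4 := hby.ne
  have n5 := hbz.ne
  have n6 := hcx.ne
  have n7 := hcy.ne
  have n8 := hcz.ne
  have hinj : Function.Injective (Sum.elim ![a, b, c] ![x, y, z]) := by
    rintro (i | i) (j | j) hij <;> fin_cases i <;> fin_cases j <;> simp_all [eq_comm]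
  obtain ⟨w, hw⟩ : ∃ w, G.Adj a x ∨ (w ≠ a ∧ w ≠ b ∧ w ≠ c ∧ w ≠ x ∧ w ≠ y ∧ w ≠ z ∧
      G.Adj a w ∧ G.Adj x w) := by
    rcases h with h | ⟨w, hw⟩
    · exact ⟨a, .inl h⟩
    · exact ⟨w, .inr hw⟩
  refine hG.2 (containsSubdivision_of_subdivide_one ⟨_, hinj⟩ s(.inl 0, .inr 0) w ?_)
  intro i j hij
  rcases hw with hw | ⟨h1, h2, h3, h4, h5, h6, h7, h8⟩
  · left
    rcases i with i | i <;> rcases j with j | j <;> fin_cases i <;> fin_cases j <;>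
      simp_all [G.adj_comm]
  · have hu : ∀ u, Sum.elim ![a, b, c] ![x, y, z] u ≠ w := by
      rintro (u | u) <;> fin_cases u <;> (apply Ne.symm; assumption)
    have h9 := h7.symm
    have h10 := h8.symm
    simp only [Function.Embedding.coeFn_mk]
    rcases i with i | i <;> rcases j with j | j <;> fin_cases i <;> fin_cases j <;>
      first
      | (simp at hij; done)
      | (left; first | assumption | (apply SimpleGraph.Adj.symm; assumption))
      | (right; refine ⟨by simp, hu, ?_, ?_⟩ <;> assumption)

theorem IsPlanar.not_K33 (hG : IsPlanar G) {A B : Finset V} (hA : 2 < A.card) (hB : 2 < B.card)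
    (h : ∀ u ∈ A, ∀ v ∈ B, G.Adj u v) : False := by
  obtain ⟨a, b, c, ha, hb, hc, h1, h2, h3⟩ := Finset.two_lt_card_iff.1 hA
  obtain ⟨x, y, z, hx, hy, hz, h4, h5, h6⟩ := Finset.two_lt_card_iff.1 hB
  exact hG.not_subdivided_K33 h1 h2 h3 h4 h5 h6 (h a ha x hx).ne (.inl (h a ha x hx))
    (h a ha y hy) (h a ha z hz) (h b hb x hx) (h b hb y hy) (h b hb z hz)
    (h c hc x hx) (h c hc y hy) (h c hc z hz)

end Subdivision

section Cograph

variable {V : Type*} {G : SimpleGraph V}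

theorem not_path_of_not_containsInduced (hF : ¬ ContainsInduced (pathGraph 4) G) {a b c d : V}
    (hab : G.Adj a b) (hbc : G.Adj b c) (hcd : G.Adj c d)
    (hac : ¬ G.Adj a c) (had : ¬ G.Adj a d) (hbd : ¬ G.Adj b d) : False := by
  have n1 := hab.ne
  have n2 := hbc.ne
  have n3 := hcd.ne
  have n4 : a ≠ c := by rintro rfl; exact had hcd
  have n5 : a ≠ d := by rintro rfl; exact hac hcd.symm
  have n6 : b ≠ d := by rintro rfl; exact had hab
  have hinj : Function.Injective ![a, b, c, d] := by
    intro i j hij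
    fin_cases i <;> fin_cases j <;> simp_all [eq_comm]
  refine hF ⟨Set.range ![a, b, c, d], ⟨Equiv.ofInjective _ hinj, ?_⟩⟩
  intro i j
  simp only [SimpleGraph.comap_adj, Equiv.ofInjective_apply, Function.Embedding.subtype_apply,
    pathGraph_adj]
  fin_cases i <;> fin_cases j <;> simp_all [G.adj_comm]

/-- A set of at least two vertices of a `P₄`-free graph splits into two nonempty parts with either
no edges or all possible edges between them. -/
theorem exists_partition_of_P4_free [DecidableEq V]
    (h4 : ∀ a b c d, G.Adj a b → G.Adj b c → G.Adj c d → ¬ G.Adj a c → ¬ G.Adj a d →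
      ¬ G.Adj b d → False) (S : Finset V) (hS : 2 ≤ S.card) :
    ∃ A B, A.Nonempty ∧ B.Nonempty ∧ Disjoint A B ∧ A ∪ B = S ∧
      ((∀ u ∈ A, ∀ v ∈ B, ¬ G.Adj u v) ∨ ∀ u ∈ A, ∀ v ∈ B, G.Adj u v) := by
  classical
  induction S using Finset.induction_on with
  | empty => simp at hS
  | insert v S hv ih =>
    rw [Finset.card_insert_of_notMem hv] at hS
    by_cases hS2 : 2 ≤ S.card
    · obtain ⟨A, B, hA, hB, hd, hAB, h⟩ := ih hS2
      have hmem : ∀ u, u ∈ S ↔ u ∈ A ∨ u ∈ B := by simp [← hAB]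
      have hne : ∀ u ∈ S, u ≠ v := by rintro u hu rfl; exact hv hu
      have hcut : ∀ M : Finset V, M ⊆ S → M.Nonempty →
          ((∀ u ∈ M, ∀ w ∈ insert v (S \ M), ¬ G.Adj u w) ∨
            ∀ u ∈ M, ∀ w ∈ insert v (S \ M), G.Adj u w) →
          ∃ A B, A.Nonempty ∧ B.Nonempty ∧ Disjoint A B ∧ A ∪ B = insert v S ∧
            ((∀ u ∈ A, ∀ v ∈ B, ¬ G.Adj u v) ∨ ∀ u ∈ A, ∀ v ∈ B, G.Adj u v) := by
        intro M hM hMne hMc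
        refine ⟨M, insert v (S \ M), hMne, Finset.insert_nonempty _ _, ?_, ?_, hMc⟩
        · rw [Finset.disjoint_left]
          intro u hu
          have := hne u (hM hu)
          simp [this, hu]
        · ext u
          have := @hM u
          simp only [Finset.mem_union, Finset.mem_insert, Finset.mem_sdiff]
          tauto
      have hAS : A ⊆ S := fun u hu => (hmem u).2 (.inl hu)
      have hBS : B ⊆ S := fun u hu => (hmem u).2 (.inr hu)
      have hSA : ∀ w, w ∈ S \ A → w ∈ B := fun w hw => by
        have := hmem w; simp at hw; tauto
      have hSB : ∀ w, w ∈ S \ B → w ∈ A := fun w hw => by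
        have := hmem w; simp at hw; tauto
      by_cases hall : ∀ u ∈ S, G.Adj u v
      · exact hcut S subset_rfl (Finset.card_pos.1 (by omega)) (.inr (by simpa using hall))
      by_cases hnone : ∀ u ∈ S, ¬ G.Adj u v
      · exact hcut S subset_rfl (Finset.card_pos.1 (by omega)) (.inl (by simpa using hnone))
      push Not at hall hnone
      obtain ⟨p, hp, hpv⟩ := hall
      obtain ⟨q, hq, hqv⟩ := hnone
      rcases h with h | h
      · by_cases hvA : ∀ u ∈ A, ¬ G.Adj u v
        · refine hcut A hAS hA (.inl ?_)
          intro u hu w hw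
          rcases Finset.mem_insert.1 hw with rfl | hw
          · exact hvA u hu
          · exact h u hu w (hSA w hw)
        by_cases hvB : ∀ u ∈ B, ¬ G.Adj u v
        · refine hcut B hBS hB (.inl ?_)
          intro u hu w hw
          rcases Finset.mem_insert.1 hw with rfl | hw
          · exact hvB u hu
          · exact fun h' => h w (hSB w hw) u hu h'.symm
        push Not at hvA hvB
        obtain ⟨a, ha, hav⟩ := hvA
        obtain ⟨b, hb, hbv⟩ := hvB
        refine hcut {u ∈ S | ¬ G.Adj u v} (Finset.filter_subset _ _) ⟨p, by simp [hp, hpv]⟩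
          (.inl ?_)
        intro y hy x hx hyx
        simp only [Finset.mem_filter] at hy
        rcases Finset.mem_insert.1 hx with rfl | hx
        · exact hy.2 hyx
        simp only [Finset.mem_sdiff, Finset.mem_filter, not_and, not_not] at hx
        have hxv := hx.2 hx.1
        rcases (hmem y).1 hy.1 with hyA | hyB <;> rcases (hmem x).1 hx.1 with hxA | hxB
        · exact h4 y x v b hyx hxv hbv.symm hy.2 (h y hyA b hb) (h x hxA b hb)
        · exact h y hyA x hxB hyx
        · exact h x hxA y hyB hyx.symm
        · exact h4 y x v a hyx hxv hav.symm hy.2 (fun h' => h a ha y hyB h'.symm)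
            (fun h' => h a ha x hxB h'.symm)
      · by_cases hvA : ∀ u ∈ A, G.Adj u v
        · refine hcut A hAS hA (.inr ?_)
          intro u hu w hw
          rcases Finset.mem_insert.1 hw with rfl | hw
          · exact hvA u hu
          · exact h u hu w (hSA w hw)
        by_cases hvB : ∀ u ∈ B, G.Adj u v
        · refine hcut B hBS hB (.inr ?_)
          intro u hu w hw
          rcases Finset.mem_insert.1 hw with rfl | hw
          · exact hvB u hu
          · exact (h w (hSB w hw) u hu).symm
        push Not at hvA hvB
        obtain ⟨a, ha, hav⟩ := hvA
        obtain ⟨b, hb, hbv⟩ := hvB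
        refine hcut {u ∈ S | G.Adj u v} (Finset.filter_subset _ _) ⟨q, by simp [hq, hqv]⟩
          (.inr ?_)
        intro y hy x hx
        by_contra hyx
        simp only [Finset.mem_filter] at hy
        rcases Finset.mem_insert.1 hx with rfl | hx
        · exact hyx hy.2
        simp only [Finset.mem_sdiff, Finset.mem_filter, not_and] at hx
        have hxv := hx.2 hx.1
        have hyx' : ¬ G.Adj x y := fun h' => hyx h'.symm
        rcases (hmem y).1 hy.1 with hyA | hyB <;> rcases (hmem x).1 hx.1 with hxA | hxB
        · exact h4 x b y v (h x hxA b hb) (h y hyA b hb).symm hy.2 hyx' hxv hbv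
        · exact hyx (h y hyA x hxB)
        · exact hyx (h x hxA y hyB).symm
        · exact h4 x a y v (h a ha x hxB).symm (h a ha y hyB) hy.2 hyx' hxv hav
    · refine ⟨{v}, S, by simp, Finset.card_pos.1 (by omega), by simpa using hv, rfl, ?_⟩
      obtain ⟨s, rfl⟩ := Finset.card_eq_one.1 (show S.card = 1 by omega)
      by_cases hvs : G.Adj v s <;> simp [hvs]

end Cograph

section Counting

variable {V : Type*} {G : SimpleGraph V}

theorem adjCount_comm (S T : Finset V) : adjCount G S T = adjCount G T S := by
  classical
  unfold adjCount
  rw [Finset.sum_comm]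
  exact Finset.sum_congr rfl fun _ _ => Finset.sum_congr rfl fun _ _ =>
    if_congr (G.adj_comm _ _) rfl rfl

theorem adjCount_union [DecidableEq V] {A B : Finset V} (h : Disjoint A B) :
    adjCount G (A ∪ B) (A ∪ B) = adjCount G A A + adjCount G B B + 2 * adjCount G A B := by
  have h' := adjCount_comm (G := G) A B
  unfold adjCount at *
  simp only [Finset.sum_union h, Finset.sum_add_distrib]
  omega

theorem adjCount_eq_zero {A B : Finset V} (h : ∀ u ∈ A, ∀ v ∈ B, ¬ G.Adj u v) :
    adjCount G A B = 0 :=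
  Finset.sum_eq_zero fun u hu => Finset.sum_eq_zero fun v hv => if_neg (h u hu v hv)

theorem adjCount_eq_mul {A B : Finset V} (h : ∀ u ∈ A, ∀ v ∈ B, G.Adj u v) :
    adjCount G A B = A.card * B.card := by
  unfold adjCount
  rw [Finset.sum_congr rfl fun u hu => Finset.sum_congr rfl fun v hv => if_pos (h u hu v hv)]
  simp

theorem adjCount_eq_sum_card [DecidableRel G.Adj] (S T : Finset V) :
    adjCount G S T = ∑ u ∈ S, (T.filter (G.Adj u)).card := by
  unfold adjCount
  refine Finset.sum_congr rfl fun u _ => ?_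
  rw [Finset.card_filter]
  congr!

theorem adjCount_self_le (S : Finset V) : adjCount G S S ≤ S.card * (S.card - 1) := by
  classical
  rw [adjCount_eq_sum_card, ← smul_eq_mul]
  refine Finset.sum_le_card_nsmul _ _ _ fun u hu => ?_
  rw [← Finset.card_erase_of_mem hu]
  refine Finset.card_le_card fun v hv => ?_
  simp only [Finset.mem_filter] at hv
  exact Finset.mem_erase.2 ⟨hv.2.ne', hv.1⟩

/-- A set in which every edge has an end of degree one and all degrees are at most two spans at
most two edges for every three vertices. -/
theorem three_mul_adjCount_le [DecidableRel G.Adj] (S : Finset V)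
    (h2 : ∀ u ∈ S, (S.filter (G.Adj u)).card ≤ 2)
    (h1 : ∀ u ∈ S, ∀ v ∈ S, G.Adj u v →
      (S.filter (G.Adj u)).card ≤ 1 ∨ (S.filter (G.Adj v)).card ≤ 1) :
    3 * adjCount G S S ≤ 4 * S.card := by
  set d : V → ℕ := fun u => (S.filter (G.Adj u)).card with hd
  have hA : ∑ u ∈ S, ∑ v ∈ S, (if G.Adj u v then (d u : ℚ)⁻¹ else 0) ≤ S.card := by
    rw [← nsmul_one, ← Finset.sum_const]
    refine Finset.sum_le_sum fun u hu => ?_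
    rw [← Finset.sum_filter, Finset.sum_const, nsmul_eq_mul]
    exact mul_inv_le_one
  have hB : ∑ u ∈ S, ∑ v ∈ S, (if G.Adj u v then (d v : ℚ)⁻¹ else 0) ≤ S.card := by
    rw [Finset.sum_comm]
    simpa only [G.adj_comm] using hA
  have hC : (3 / 2 : ℚ) * adjCount G S S ≤
      ∑ u ∈ S, ∑ v ∈ S, (if G.Adj u v then (d u : ℚ)⁻¹ else 0) +
      ∑ u ∈ S, ∑ v ∈ S, (if G.Adj u v then (d v : ℚ)⁻¹ else 0) := by
    unfold adjCount
    push_cast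
    simp only [Finset.mul_sum, ← Finset.sum_add_distrib]
    refine Finset.sum_le_sum fun u hu => Finset.sum_le_sum fun v hv => ?_
    by_cases huv : G.Adj u v
    · have hu0 : 0 < d u := Finset.card_pos.2 ⟨v, by simp [hv, huv]⟩
      have hv0 : 0 < d v := Finset.card_pos.2 ⟨u, by simp [hu, huv.symm]⟩
      have hu2 : d u ≤ 2 := h2 u hu
      have hv2 : d v ≤ 2 := h2 v hv
      have huv1 : d u ≤ 1 ∨ d v ≤ 1 := h1 u hu v hv huv
      simp only [huv, if_true]
      generalize d u = m at *
      generalize d v = k at *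
      interval_cases m <;> interval_cases k <;> first | omega | norm_num
    · simp [huv]
  have : (3 : ℚ) * adjCount G S S ≤ 4 * S.card := by linarith
  exact_mod_cast this

/-- The bound for a set with two vertices `a`, `b` adjacent to all others. -/
theorem IsPlanar.adjCount_le_of_two_dominating [DecidableEq V] (hG : IsPlanar G)
    (h4 : ∀ a b c d, G.Adj a b → G.Adj b c → G.Adj c d → ¬ G.Adj a c → ¬ G.Adj a d →
      ¬ G.Adj b d → False) {A B : Finset V} (hA : A.card = 2) (hB : 3 ≤ B.card)
    (hd : Disjoint A B) (h : ∀ u ∈ A, ∀ v ∈ B, G.Adj u v) :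
    3 * adjCount G (A ∪ B) (A ∪ B) + 24 ≤ 16 * (A ∪ B).card ∧
      ((A ∪ B).card ≠ 6 → 3 * adjCount G (A ∪ B) (A ∪ B) + 26 ≤ 16 * (A ∪ B).card) := by
  classical
  rw [adjCount_union hd, adjCount_eq_mul h, Finset.card_union_of_disjoint hd]
  obtain ⟨a, b, hab, rfl⟩ := Finset.card_eq_two.1 hA
  have ha : ∀ v ∈ B, G.Adj a v := fun v hv => h a (by simp) v hv
  have hb : ∀ v ∈ B, G.Adj b v := fun v hv => h b (by simp) v hv
  have hdeg : ∀ u ∈ B, (B.filter (G.Adj u)).card ≤ 2 := by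
    intro u hu
    by_contra! h2
    refine hG.not_K33 (A := {a, b, u}) (B := B.filter (G.Adj u)) ?_ h2 ?_
    · rw [Finset.card_eq_three.2 ⟨a, b, u, hab, (ha u hu).ne, (hb u hu).ne, rfl⟩]
      norm_num
    · intro x hx v hv
      simp only [Finset.mem_filter] at hv
      simp only [Finset.mem_insert, Finset.mem_singleton] at hx
      rcases hx with rfl | rfl | rfl
      · exact ha v hv.1
      · exact hb v hv.1
      · exact hv.2
  rw [hA]
  by_cases hcase : G.Adj a b ∨ 5 ≤ B.card
  · have hextra : ∀ T : Finset V, T.card ≤ 4 → G.Adj a b ∨ ∃ x ∈ B, x ∉ T := by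
      intro T hT
      refine hcase.imp_right fun h5 => ?_
      exact Finset.exists_mem_notMem_of_card_lt_card (by omega)
    have htri : ∀ u ∈ B, ∀ v ∈ B, ∀ w ∈ B, G.Adj u v → G.Adj v w → ¬ G.Adj u w := by
      intro u hu v hv w hw huv hvw huw
      refine hG.not_subdivided_K5 hab ?_ (ha u hu) (ha v hv) (ha w hw) (hb u hu) (hb v hv)
        (hb w hw) huv huw hvw
      refine (hextra {u, v, w} (Finset.card_le_three.trans (by norm_num))).imp_right ?_
      rintro ⟨x, hx, hxT⟩
      simp only [Finset.mem_insert, Finset.mem_singleton, not_or] at hxT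
      exact ⟨x, (ha x hx).ne', (hb x hx).ne', hxT.1, hxT.2.1, hxT.2.2, ha x hx, hb x hx⟩
    have hsq : ∀ u ∈ B, ∀ v ∈ B, ∀ w ∈ B, ∀ z ∈ B, u ≠ w → v ≠ z →
        G.Adj u v → G.Adj v w → G.Adj w z → ¬ G.Adj u z := by
      intro u hu v hv w hw z hz huw hvz huv hvw hwz huz
      refine hG.not_subdivided_K33 (a := a) (b := u) (c := w) (x := b) (y := v) (z := z)
        (ha u hu).ne (ha w hw).ne huw (hb v hv).ne (hb z hz).ne hvz hab ?_ (ha v hv) (ha z hz)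
        (hb u hu).symm huv huz (hb w hw).symm hvw.symm hwz
      refine (hextra {u, v, w, z} Finset.card_le_four).imp_right ?_
      rintro ⟨x, hx, hxT⟩
      simp only [Finset.mem_insert, Finset.mem_singleton, not_or] at hxT
      exact ⟨x, (ha x hx).ne', hxT.1, hxT.2.2.1, (hb x hx).ne', hxT.2.1, hxT.2.2.2, ha x hx,
        hb x hx⟩
    have hone : ∀ u ∈ B, ∀ v ∈ B, G.Adj u v →
        (B.filter (G.Adj u)).card ≤ 1 ∨ (B.filter (G.Adj v)).card ≤ 1 := by
      intro u hu v hv huv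
      by_contra! hc
      obtain ⟨x, hx, hxv⟩ := Finset.exists_mem_ne hc.1 v
      obtain ⟨y, hy, hyu⟩ := Finset.exists_mem_ne hc.2 u
      simp only [Finset.mem_filter] at hx hy
      exact h4 x u v y hx.2.symm huv hy.2 (htri x hx.1 u hu v hv hx.2.symm huv)
        (hsq x hx.1 u hu v hv y hy.1 hxv hyu.symm hx.2.symm huv hy.2)
        (htri u hu v hv y hy.1 huv hy.2)
    have hBB := three_mul_adjCount_le B hdeg hone
    have hAA := adjCount_self_le (G := G) {a, b}
    rw [hA] at hAA
    omega
  · push Not at hcase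
    have hAA : adjCount G {a, b} {a, b} = 0 := by
      refine adjCount_eq_zero ?_
      simp [hcase.1, G.adj_comm b a]
    have hBB : adjCount G B B ≤ B.card * 2 := by
      rw [adjCount_eq_sum_card, ← smul_eq_mul]
      exact Finset.sum_le_card_nsmul _ _ _ hdeg
    omega

theorem IsPlanar.adjCount_le [DecidableEq V] (hG : IsPlanar G)
    (h4 : ∀ a b c d, G.Adj a b → G.Adj b c → G.Adj c d → ¬ G.Adj a c → ¬ G.Adj a d →
      ¬ G.Adj b d → False) (S : Finset V) (hS : 2 ≤ S.card) :
    3 * adjCount G S S + 24 ≤ 16 * S.card ∧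
      (S.card ≠ 6 → 3 * adjCount G S S + 26 ≤ 16 * S.card) := by
  induction hn : S.card using Nat.strong_induction_on generalizing S with
  | _ n ih =>
  subst hn
  by_cases hS4 : S.card ≤ 4
  · have := adjCount_self_le (G := G) S
    generalize S.card = m at *
    interval_cases m <;> omega
  have hone : ∀ T : Finset V, T.card = 1 → adjCount G T T = 0 := by
    intro T hT
    have := adjCount_self_le (G := G) T
    simpa [hT] using this
  have htwo := fun A B => hG.adjCount_le_of_two_dominating h4 (A := A) (B := B)
  obtain ⟨A, B, hA, hB, hd, rfl, hAB⟩ := exists_partition_of_P4_free h4 S hS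
  have hc := Finset.card_union_of_disjoint hd
  have hA' := hA.card_pos
  have hB' := hB.card_pos
  rcases hAB with hAB | hAB
  · have hE := adjCount_union (G := G) hd
    rw [adjCount_eq_zero hAB] at hE
    have iA := ih A.card (by omega) A
    have iB := ih B.card (by omega) B
    have oA := hone A
    have oB := hone B
    by_cases h1 : A.card = 1 <;> by_cases h2 : B.card = 1
    · omega
    · have := (iB (by omega) rfl).1
      have := oA h1
      omega
    · have := (iA (by omega) rfl).1
      have := oB h2
      omega
    · have := (iA (by omega) rfl).1
      have := (iB (by omega) rfl).1
      omega
  wlog hle : A.card ≤ B.card generalizing A B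
  · have := this B A hB hA hd.symm
    rw [Finset.union_comm B A] at this
    exact this hS ih hS4 (by omega) hB' hA' (fun u hu v hv => (hAB v hv u hu).symm) (by omega)
  have hA2 : A.card ≤ 2 := by
    by_contra! h
    exact hG.not_K33 h (by omega) hAB
  by_cases hA2' : A.card = 2
  · exact htwo A B hA2' (by omega) hd hAB
  obtain ⟨a, rfl⟩ := Finset.card_eq_one.1 (show A.card = 1 by omega)
  simp only [Finset.mem_singleton, forall_eq] at hAB
  rw [Finset.disjoint_singleton_left] at hd
  obtain ⟨C, D, hC, hD, hCD, rfl, hj⟩ := exists_partition_of_P4_free h4 B (by omega)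
  have hc' := Finset.card_union_of_disjoint hCD
  have hC' := hC.card_pos
  have hD' := hD.card_pos
  have haC : a ∉ C := fun h => hd (Finset.mem_union_left _ h)
  have haD : a ∉ D := fun h => hd (Finset.mem_union_right _ h)
  have h1 : ({a} : Finset V).card = 1 := Finset.card_singleton a
  have hdC : Disjoint {a} C := Finset.disjoint_singleton_left.2 haC
  have hdD : Disjoint {a} D := Finset.disjoint_singleton_left.2 haD
  have hcC := Finset.card_union_of_disjoint hdC
  have hcD := Finset.card_union_of_disjoint hdD
  rcases hj with hj | hj
  · have e1 := adjCount_union (G := G) (Finset.disjoint_singleton_left.2 hd)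
    have e2 := adjCount_union (G := G) hCD
    have e3 := adjCount_union (G := G) hdC
    have e4 := adjCount_union (G := G) hdD
    rw [hone _ h1, adjCount_eq_mul (A := {a}) (B := C ∪ D) (by simpa using hAB)] at e1
    rw [adjCount_eq_zero hj] at e2
    rw [hone _ h1, adjCount_eq_mul (A := {a}) (B := C)
      (by simpa using fun v hv => hAB v (Finset.mem_union_left _ hv))] at e3
    rw [hone _ h1, adjCount_eq_mul (A := {a}) (B := D)
      (by simpa using fun v hv => hAB v (Finset.mem_union_right _ hv))] at e4
    have iC := (ih _ (by omega) ({a} ∪ C) (by omega) rfl).1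
    have iD := (ih _ (by omega) ({a} ∪ D) (by omega) rfl).1
    rw [h1] at e1 e3 e4
    omega
  wlog hle' : C.card ≤ D.card generalizing C D
  · have := this D C hD hC hCD.symm
    rw [Finset.union_comm D C] at this
    exact this hB hB' hd hS ih hS4 hc hle hAB (by omega) hD' hC' haD haC hdD hdC hcD hcC
      (fun u hu v hv => (hj v hv u hu).symm) (by omega)
  have hC2 : C.card ≤ 2 := by
    by_contra! h
    exact hG.not_K33 h (by omega) hj
  by_cases hC2' : C.card = 2
  · have hdis : Disjoint C ({a} ∪ D) :=
      Finset.disjoint_union_right.2 ⟨hdC.symm, hCD⟩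
    have := htwo C ({a} ∪ D) hC2' (by omega) hdis ?_
    · rwa [Finset.union_left_comm] at this
    · intro u hu v hv
      rcases Finset.mem_union.1 hv with hv | hv
      · rw [Finset.mem_singleton.1 hv]
        exact (hAB u (Finset.mem_union_left _ hu)).symm
      · exact hj u hu v hv
  · have hdis : Disjoint ({a} ∪ C) D := Finset.disjoint_union_left.2 ⟨hdD, hCD⟩
    have := htwo ({a} ∪ C) D (by omega) (by omega) hdis ?_
    · rwa [Finset.union_assoc] at this
    · intro u hu v hv
      rcases Finset.mem_union.1 hu with hu | hu
      · rw [Finset.mem_singleton.1 hu]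
        exact hAB v (Finset.mem_union_right _ hv)
      · exact hj u hu v hv

end Counting

theorem stmt_10 (n : ℕ) (hn : 7 ≤ n) (G : SimpleGraph (Fin n))
    (hP : IsPlanar G) (hF : ¬ ContainsInduced (pathGraph 4) G) :
    G.edgeSet.ncard ≤ 8 * (n - 2) / 3 + 1 := by
  classical
  have h := (hP.adjCount_le (fun _ _ _ _ => not_path_of_not_containsInduced hF) Finset.univ
    (by simp; omega)).2 (by simp; omega)
  have hE : adjCount G Finset.univ Finset.univ = 2 * G.edgeSet.ncard := by
    rw [← SimpleGraph.coe_edgeFinset, Set.ncard_coe_finset, ← G.sum_degrees_eq_twice_card_edges,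
      adjCount_eq_sum_card]
    simp [← SimpleGraph.card_neighborFinset_eq_degree, SimpleGraph.neighborFinset_eq_filter]
  rw [hE, Finset.card_univ, Fintype.card_fin] at h
  omega
end

section
/- For every n ≥ 7, there exists a planar graph on n vertices that contains no induced copy of P_4 and has exactly ⌊8(n−2)/3⌋ + 1 edges. (One such graph is (aP_3 ∪ P_b) + K_2, the join of K_2 with the disjoint union of a copies of P_3 and one copy of P_b, where n − 2 = 3a + b with a ≥ 1 and 0 ≤ b < 3.) -/
open SimpleGraph

/-- The join of `K₂` (on the vertices `0` and `1`) with a disjoint union of paths whose vertex sets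
are the consecutive triples `{2, 3, 4}`, `{5, 6, 7}`, ..., the last one possibly truncated. -/
def joinPathsGraph (n : ℕ) : SimpleGraph (Fin n) where
  Adj i j := i ≠ j ∧ (i.val < 2 ∨ j.val < 2 ∨
    ((i.val + 1) / 3 = (j.val + 1) / 3 ∧ (j.val = i.val + 1 ∨ i.val = j.val + 1)))
  symm := ⟨by rintro i j ⟨h, h'⟩; exact ⟨h.symm, by omega⟩⟩
  loopless := ⟨fun i h => h.1 rfl⟩

namespace joinPathsGraph

theorem adj_iff {n : ℕ} {i j : Fin n} : (joinPathsGraph n).Adj i j ↔ i.val ≠ j.val ∧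
    (i.val < 2 ∨ j.val < 2 ∨
      ((i.val + 1) / 3 = (j.val + 1) / 3 ∧ (j.val = i.val + 1 ∨ i.val = j.val + 1))) := by
  rw [ne_eq, Fin.val_inj]; rfl

theorem not_containsInduced_pathGraph_four (n : ℕ) :
    ¬ ContainsInduced (pathGraph 4) (joinPathsGraph n) := by
  rintro ⟨s, ⟨e⟩⟩
  have key (a b : Fin 4) :
      (joinPathsGraph n).Adj (e a).val (e b).val ↔ a.val + 1 = b.val ∨ b.val + 1 = a.val := by
    rw [← pathGraph_adj]
    exact e.map_adj_iff
  have h01 := (key 0 1).2 (by simp)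
  have h12 := (key 1 2).2 (by simp)
  have h23 := (key 2 3).2 (by simp)
  have h02 := mt (key 0 2).1 (by simp)
  have h13 := mt (key 1 3).1 (by simp)
  have h03 := mt (key 0 3).1 (by simp)
  have hne (a b : Fin 4) (h : a ≠ b) : (e a).val.val ≠ (e b).val.val := fun h' =>
    h (e.injective (Subtype.ext (Fin.ext h')))
  have n02 := hne 0 2 (by decide)
  have n13 := hne 1 3 (by decide)
  have n03 := hne 0 3 (by decide)
  rw [adj_iff] at h01 h12 h23 h02 h13 h03
  omega

/-- The smaller neighbours of the vertex `j`. -/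
def lowerNeighbors (j : ℕ) : Finset ℕ :=
  if j = 0 then ∅ else if j = 1 then {0} else if (j + 1) % 3 = 0 then {0, 1} else {0, 1, j - 1}

theorem mem_lowerNeighbors {i j : ℕ} : i ∈ lowerNeighbors j ↔
    i < j ∧ (i < 2 ∨ ((i + 1) / 3 = (j + 1) / 3 ∧ j = i + 1)) := by
  unfold lowerNeighbors
  split_ifs <;> simp <;> omega

theorem card_lowerNeighbors (j : ℕ) : (lowerNeighbors j).card =
    if j = 0 then 0 else if j = 1 then 1 else if (j + 1) % 3 = 0 then 2 else 3 := by
  unfold lowerNeighbors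
  split_ifs
  · simp
  · simp
  · simp
  · rw [Finset.card_insert_of_notMem, Finset.card_insert_of_notMem, Finset.card_singleton] <;>
      simp <;> omega

theorem sum_card_lowerNeighbors (m : ℕ) :
    ∑ j ∈ Finset.range (m + 2), (lowerNeighbors j).card = 8 * m / 3 + 1 := by
  induction m with
  | zero => decide
  | succ m ih =>
    rw [show m + 1 + 2 = m + 2 + 1 by ring, Finset.sum_range_succ, ih, card_lowerNeighbors,
      if_neg (by omega), if_neg (by omega)]
    obtain ⟨q, r, hr, rfl⟩ : ∃ q r, r < 3 ∧ m = 3 * q + r := ⟨m / 3, m % 3, by omega, by omega⟩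
    interval_cases r <;> split_ifs <;> omega

theorem ncard_edgeSet (m : ℕ) : (joinPathsGraph (m + 2)).edgeSet.ncard = 8 * m / 3 + 1 := by
  have hinj : Function.Injective (Sym2.map (Fin.val : Fin (m + 2) → ℕ)) :=
    Sym2.map.injective Fin.val_injective
  have himage : Sym2.map Fin.val '' (joinPathsGraph (m + 2)).edgeSet =
      (fun x : (_ : ℕ) × ℕ => s(x.2, x.1)) ''
        ((Finset.range (m + 2)).sigma lowerNeighbors : Finset ((_ : ℕ) × ℕ)) := by
    ext x
    constructor
    · rintro ⟨y, hy, rfl⟩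
      induction y with | _ i j
      rw [mem_edgeSet, adj_iff] at hy
      rcases lt_or_ge i.val j.val with h | h
      · refine ⟨⟨j.val, i.val⟩, ?_, by simp⟩
        have := j.isLt
        simp only [Finset.coe_sigma, Set.mem_sigma_iff, Finset.mem_coe, Finset.mem_range,
          mem_lowerNeighbors]
        omega
      · refine ⟨⟨i.val, j.val⟩, ?_, by simp [Sym2.eq_swap]⟩
        have := i.isLt
        simp only [Finset.coe_sigma, Set.mem_sigma_iff, Finset.mem_coe, Finset.mem_range,
          mem_lowerNeighbors]
        omega
    · rintro ⟨⟨j, i⟩, h, rfl⟩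
      simp only [Finset.coe_sigma, Set.mem_sigma_iff, Finset.mem_coe, Finset.mem_range,
          mem_lowerNeighbors] at h
      refine ⟨s(⟨i, by omega⟩, ⟨j, by omega⟩), ?_, by simp⟩
      rw [mem_edgeSet, adj_iff]
      simp only
      omega
  rw [← Set.ncard_image_of_injective _ hinj, himage, Set.InjOn.ncard_image,
    Set.ncard_coe_finset, Finset.card_sigma, sum_card_lowerNeighbors]
  rintro ⟨j, i⟩ h ⟨j', i'⟩ h' heq
  simp only [Finset.coe_sigma, Set.mem_sigma_iff, Finset.mem_coe, mem_lowerNeighbors] at h h'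
  simp only [Sym2.eq_iff] at heq
  obtain ⟨rfl, rfl⟩ : j = j' ∧ i = i' := by omega
  rfl

theorem block_eq_of_walk {n : ℕ} {u v : Fin n} (p : (joinPathsGraph n).Walk u v)
    (hp : ∀ x ∈ p.support, 2 ≤ x.val) : (u.val + 1) / 3 = (v.val + 1) / 3 := by
  induction p with
  | nil => rfl
  | @cons u v w h p ih =>
    have hu := hp u (by simp)
    have hv := hp v (by simp)
    rw [← ih fun x hx => hp x (by simp [hx])]
    rw [adj_iff] at h
    omega

/-- Of three sets that pairwise share neither `0` nor `1`, one contains neither. -/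
theorem exists_forall_two_le {n : ℕ} (S : Fin 3 → Fin n → Prop)
    (hS : ∀ i j, i ≠ j → ∀ x, x.val < 2 → S i x → ¬ S j x) : ∃ i, ∀ x, S i x → 2 ≤ x.val := by
  by_contra! h
  choose x hx hx2 using h
  obtain ⟨i, j, hij, h⟩ := Fintype.exists_ne_map_eq_of_card_lt
    (fun i => (⟨(x i).val, hx2 i⟩ : Fin 2)) (by simp)
  have h : x i = x j := Fin.ext (by simpa using h)
  exact hS i j hij (x i) (hx2 i) (hx i) (h ▸ hx j)

/-- Two branch vertices other than `0` and `1` whose preimages have three common neighbours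
lie in the same triple. -/
theorem block_eq_of_common_neighbors {n : ℕ} {W : Type*} {H : SimpleGraph W} {f : W ↪ Fin n}
    {p : ∀ ⦃a b : W⦄, H.Adj a b → (joinPathsGraph n).Walk (f a) (f b)}
    (hp : ∀ ⦃a b c d : W⦄ (h₁ : H.Adj a b) (h₂ : H.Adj c d), s(a, b) ≠ s(c, d) →
      ∀ x, x ∈ (p h₁).support → x ∈ (p h₂).support →
        (x = f a ∨ x = f b) ∧ (x = f c ∨ x = f d))
    {a b : W} (ha : 2 ≤ (f a).val) (hb : 2 ≤ (f b).val) (t : Fin 3 ↪ W)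
    (hat : ∀ i, H.Adj a (t i)) (htb : ∀ i, H.Adj (t i) b) :
    ((f a).val + 1) / 3 = ((f b).val + 1) / 3 := by
  obtain ⟨i, hi⟩ := exists_forall_two_le
    (fun i x => x ∈ (p (hat i)).support ∨ x ∈ (p (htb i)).support) (by
      intro i j hij x hx hxi hxj
      have hxa : x ≠ f a := by rintro rfl; omega
      have hxb : x ≠ f b := by rintro rfl; omega
      have htij : t i ≠ t j := t.injective.ne hij
      have h1 := (hat i).ne
      have h2 := (hat j).ne
      have h3 := (htb i).ne
      have h4 := (htb j).ne
      have hcon : x = f (t i) → x = f (t j) → False := fun hi hj =>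
        htij (f.injective (hi.symm.trans hj))
      rcases hxi with hxi | hxi <;> rcases hxj with hxj | hxj
      · have := hp (hat i) (hat j) (by grind) x hxi hxj
        tauto
      · have := hp (hat i) (htb j) (by grind) x hxi hxj
        tauto
      · have := hp (htb i) (hat j) (by grind) x hxi hxj
        tauto
      · have := hp (htb i) (htb j) (by grind) x hxi hxj
        tauto)
  exact (block_eq_of_walk _ fun x hx => hi x (.inl hx)).trans
    (block_eq_of_walk _ fun x hx => hi x (.inr hx))

/-- The vertices `0` and `1` together with the `k`-th triple. -/
def hubsAndTriple (k : ℕ) : Finset ℕ := {0, 1, 3 * k - 1, 3 * k, 3 * k + 1}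

theorem mem_hubsAndTriple {k x : ℕ} (hk : 1 ≤ k) :
    x ∈ hubsAndTriple k ↔ x < 2 ∨ (x + 1) / 3 = k := by
  simp only [hubsAndTriple, Finset.mem_insert, Finset.mem_singleton]
  omega

theorem card_hubsAndTriple_le (k : ℕ) : (hubsAndTriple k).card ≤ 5 := Finset.card_le_five

theorem not_containsSubdivision_completeGraph_five (n : ℕ) :
    ¬ ContainsSubdivision (completeGraph (Fin 5)) (joinPathsGraph n) := by
  rintro ⟨f, p, -, hbranch, hdisj⟩
  have hf : Function.Injective fun a => (f a).val := Fin.val_injective.comp f.injective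
  obtain ⟨c, hc⟩ : ∃ c, 2 ≤ (f c).val := by
    obtain ⟨i, hi⟩ := exists_forall_two_le (fun i x => x = f (Fin.castLE (by omega) i)) (by
      rintro i j hij x - rfl h
      exact hij (Fin.castLE_injective _ (f.injective h)))
    exact ⟨_, hi _ rfl⟩
  have hblock (a : Fin 5) (ha : 2 ≤ (f a).val) :
      ((f a).val + 1) / 3 = ((f c).val + 1) / 3 := by
    by_cases hac : a = c
    · rw [hac]
    have hcommon : ∀ a c : Fin 5, a ≠ c →
        ∃ u v w, u ≠ v ∧ u ≠ w ∧ v ≠ w ∧ ∀ x, x = u ∨ x = v ∨ x = w → a ≠ x ∧ x ≠ c := by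
      decide
    obtain ⟨u, v, w, huv, huw, hvw, h⟩ := hcommon a c hac
    refine block_eq_of_common_neighbors hdisj ha hc ⟨![u, v, w], ?_⟩ ?_ ?_
    · intro i j
      fin_cases i <;> fin_cases j <;> simp [huv, huw, hvw, huv.symm, huw.symm, hvw.symm]
    · intro i
      exact (h (![u, v, w] i) (by fin_cases i <;> simp)).1
    · intro i
      exact (h (![u, v, w] i) (by fin_cases i <;> simp)).2
  set k := ((f c).val + 1) / 3
  have hk : 1 ≤ k := by omega
  have himage : Finset.univ.image (fun a => (f a).val) = hubsAndTriple k := by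
    refine Finset.eq_of_subset_of_card_le ?_ ?_
    · intro x hx
      obtain ⟨a, -, rfl⟩ := Finset.mem_image.1 hx
      have := hblock a
      rw [mem_hubsAndTriple hk]
      omega
    · rw [Finset.card_image_of_injective _ hf]
      exact card_hubsAndTriple_le k
  have hsurj (x : ℕ) (hx : x < 2 ∨ (x + 1) / 3 = k) : ∃ a, (f a).val = x := by
    rw [← mem_hubsAndTriple hk, ← himage] at hx
    simpa using hx
  obtain ⟨u, hu⟩ := hsurj (3 * k - 1) (by omega)
  obtain ⟨v, hv⟩ := hsurj (3 * k + 1) (by omega)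
  have huv : u ≠ v := by rintro rfl; omega
  have hnil : ¬ (p huv).Nil := Walk.not_nil_of_ne (f.injective.ne huv)
  have hadj := (p huv).adj_snd hnil
  rw [adj_iff] at hadj
  obtain ⟨w, hw⟩ := hsurj (p huv).snd.val (by omega)
  have hmem := hbranch huv w (by
    rw [Fin.ext hw]
    exact (p huv).getVert_mem_support 1)
  rcases hmem with rfl | rfl <;> omega

theorem not_containsSubdivision_completeBipartiteGraph_three (n : ℕ) :
    ¬ ContainsSubdivision (completeBipartiteGraph (Fin 3) (Fin 3)) (joinPathsGraph n) := by
  rintro ⟨f, p, -, -, hdisj⟩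
  have hf : Function.Injective fun a => (f a).val := Fin.val_injective.comp f.injective
  have hlr (i j : Fin 3) : (completeBipartiteGraph (Fin 3) (Fin 3)).Adj (.inl i) (.inr j) := by
    simp
  obtain ⟨c, hc⟩ := exists_forall_two_le (fun i x => x ∈ (p (hlr i i)).support) (by
    intro i j hij x _ hxi hxj
    obtain ⟨h1, h2⟩ := hdisj (hlr i i) (hlr j j) (by simp [hij]) x hxi hxj
    rcases h1 with rfl | rfl <;> simp [hij] at h2)
  have hcl : 2 ≤ (f (.inl c)).val := hc _ (Walk.start_mem_support _)
  have hcr : 2 ≤ (f (.inr c)).val := hc _ (Walk.end_mem_support _)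
  have hcc := block_eq_of_walk _ hc
  have hblock (a : Fin 3 ⊕ Fin 3) (ha : 2 ≤ (f a).val) :
      ((f a).val + 1) / 3 = ((f (.inl c)).val + 1) / 3 := by
    rcases a with i | i
    · exact block_eq_of_common_neighbors hdisj ha hcl .inr (fun j => hlr i j)
        (fun j => (hlr c j).symm)
    · rw [hcc]
      exact block_eq_of_common_neighbors hdisj ha hcr .inl (fun j => (hlr j i).symm)
        (fun j => hlr j c)
  set k := ((f (.inl c)).val + 1) / 3
  have hk : 1 ≤ k := by omega
  have hsub : Finset.univ.image (fun a => (f a).val) ⊆ hubsAndTriple k := by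
    intro x hx
    obtain ⟨a, -, rfl⟩ := Finset.mem_image.1 hx
    have := hblock a
    rw [mem_hubsAndTriple hk]
    omega
  have hcard := (Finset.card_le_card hsub).trans (card_hubsAndTriple_le k)
  rw [Finset.card_image_of_injective _ hf] at hcard
  simp at hcard

end joinPathsGraph

theorem stmt_11 (n : ℕ) (hn : 7 ≤ n) :
    ∃ G : SimpleGraph (Fin n), IsPlanar G ∧ ¬ ContainsInduced (pathGraph 4) G ∧
      G.edgeSet.ncard = 8 * (n - 2) / 3 + 1 := by
  obtain ⟨m, rfl⟩ : ∃ m, n = m + 2 := ⟨n - 2, by omega⟩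
  exact ⟨joinPathsGraph (m + 2),
    ⟨joinPathsGraph.not_containsSubdivision_completeGraph_five _,
      joinPathsGraph.not_containsSubdivision_completeBipartiteGraph_three _⟩,
    joinPathsGraph.not_containsInduced_pathGraph_four _, joinPathsGraph.ncard_edgeSet m⟩
end
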